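/- Let ω be a positive smooth function on S²∖{N,S} such that ln ω − ln sinθ extends to a C¹⁰ function on S², let a > 0, and let w̄ = (Φ̄,v̄) ∈ C³(S²) satisfy M(w̄) = 0 on S²∖{N,S} with v̄(N) = a and v̄(S) = −a, where for a pair w = (w₁,w₂) one sets u = w₁ − ln ω and M(w) = ( M₁(w), M₂(w) ) with M₁(w) = Δ_{g₀}w₁ − 2e^{4u}|∇_{g₀}w₂|² − Δ_{g₀} ln ω and M₂(w) = Δ_{g₀}w₂ + 4∇_{g₀}u·∇_{g₀}w₂. Define the energy E(w) = (1/2)∫_{S²}( |∇_{g₀}w₁|² + e^{4u}|∇_{g₀}w₂|² + 2(Δ_{g₀} ln ω)w₁ ) dvol_{g₀} and the norm ‖M(w)‖ = ( ∫_{S²}( M₁(w)² + ω⁻⁴ M₂(w)² ) dvol_{g₀} )^{1/2}. Fix α ∈ (0,1). Then there exist constants η > 0 and C̄ > 0, depending only on α and w̄, such that the Łojasiewicz–Simon inequality |E(w) − E(w̄)|^{1/2} ≤ C̄ ‖M(w)‖ holds for every pair w = (w₁,w₂) of C^{2,α} functions on S²∖{N,S} for which the weighted norm |w − w̄|*_{2,α}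 := Σ_{j=0}^{2}( sup_{S²}|∇_{g₀}^j(w₁−Φ̄)| + sup_{S²} ω^{j−7/2}|∇_{g₀}^j(w₂−v̄)| ) + [∇_{g₀}²(w₁−Φ̄)]_{C^α(S²)} + [∇_{g₀}²(w₂−v̄)]_{C^α(S²)} is finite and less than η. -/

import Mathlib

open Real MeasureTheory Set Filter

noncomputable section

/-- `θ`-partial derivative of a function of `(θ, φ)`. -/
def pdθ (f : ℝ → ℝ → ℝ) : ℝ → ℝ → ℝ := fun θ φ => deriv (fun x => f x φ) θ

/-- `φ`-partial derivative of a function of `(θ, φ)`. -/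
def pdφ (f : ℝ → ℝ → ℝ) : ℝ → ℝ → ℝ := fun θ φ => deriv (fun x => f θ x) φ

/-- coordinate derivative in direction `i` (`0 = θ`, `1 = φ`). -/
def pder2 (i : Fin 2) : (ℝ → ℝ → ℝ) → (ℝ → ℝ → ℝ) := if i = 0 then pdθ else pdφ

/-- Christoffel symbols `Γ^m_{i j}` of the round metric on `S²` in `(θ, φ)`. -/
def christoffel (m i j : Fin 2) (θ : ℝ) : ℝ :=
  if m = 0 ∧ i = 1 ∧ j = 1 then -(Real.sin θ * Real.cos θ)
  else if m = 1 ∧ ((i = 0 ∧ j = 1) ∨ (i = 1 ∧ j = 0)) then Real.cos θ / Real.sin θ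
  else 0

/-- covariant derivative (in the round metric) of a `k`-tensor on `S²`,
given by its coordinate components. -/
def covDer {k : ℕ} (T : (Fin k → Fin 2) → ℝ → ℝ → ℝ) :
    (Fin (k + 1) → Fin 2) → ℝ → ℝ → ℝ := fun I θ φ =>
  pder2 (I 0) (T fun j => I j.succ) θ φ
    - ∑ j : Fin k, ∑ m : Fin 2,
        christoffel m (I 0) (I j.succ) θ *
          T (Function.update (fun j' => I j'.succ) j m) θ φ

/-- the `k`-th covariant derivative of a function on `S²`. -/
def covIter (f : ℝ → ℝ → ℝ) : (k : ℕ) → (Fin k → Fin 2) → ℝ → ℝ → ℝ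
  | 0 => fun _ => f
  | k + 1 => covDer (covIter f k)

/-- inverse-metric weight used to compute tensor norms. -/
def sphWeight (i : Fin 2) (θ : ℝ) : ℝ := if i = 0 then 1 else (Real.sin θ ^ 2)⁻¹

/-- `|∇_{g₀}^k f|`, the norm of the `k`-th covariant derivative in the round metric. -/
def covNorm (k : ℕ) (f : ℝ → ℝ → ℝ) (θ φ : ℝ) : ℝ :=
  Real.sqrt (∑ I : Fin k → Fin 2, (∏ j, sphWeight (I j) θ) * (covIter f k I θ φ) ^ 2)

/-- `∇_{g₀}f·∇_{g₀}h` on the round sphere. -/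
def gradDotS2 (f g : ℝ → ℝ → ℝ) (θ φ : ℝ) : ℝ :=
  pdθ f θ φ * pdθ g θ φ + (Real.sin θ ^ 2)⁻¹ * pdφ f θ φ * pdφ g θ φ

/-- `|∇_{g₀}f|²` on the round sphere. -/
def gradNormSqS2 (f : ℝ → ℝ → ℝ) (θ φ : ℝ) : ℝ := gradDotS2 f f θ φ

/-- `Δ_{g₀}f`, the round Laplacian in coordinates. -/
def lapS2 (f : ℝ → ℝ → ℝ) (θ φ : ℝ) : ℝ :=
  pdθ (pdθ f) θ φ + (Real.cos θ / Real.sin θ) * pdθ f θ φ +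
    (Real.sin θ ^ 2)⁻¹ * pdφ (pdφ f) θ φ

/-- integral over `S²` with respect to `dvol_{g₀} = sinθ dθ dφ`. -/
def sphInt (f : ℝ → ℝ → ℝ) : ℝ :=
  ∫ θ in Ioo (0 : ℝ) π, (∫ φ in Ioo (0 : ℝ) (2 * π), f θ φ) * Real.sin θ

/-- round distance between the points with coordinates `(θ, φ)` and `(θ', φ')`. -/
def sDist (θ φ θ' φ' : ℝ) : ℝ :=
  Real.arccos (Real.cos θ * Real.cos θ' + Real.sin θ * Real.sin θ' * Real.cos (φ - φ'))

/-- a function on `S²` (in coordinates), of class `C^k`, with bounded covariant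
derivatives up to order `k`. -/
def CkSphere (k : ℕ) (f : ℝ → ℝ → ℝ) : Prop :=
  ContDiffOn ℝ k (fun p : ℝ × ℝ => f p.1 p.2) (Ioo 0 π ×ˢ (univ : Set ℝ)) ∧
  (∀ θ φ : ℝ, f θ (φ + 2 * π) = f θ φ) ∧
  ∃ C : ℝ, ∀ j ≤ k, ∀ θ ∈ Ioo (0 : ℝ) π, ∀ φ : ℝ, covNorm j f θ φ ≤ C

/-- a smooth function on `S²` (in coordinates), with bounded covariant derivatives
of all orders. -/
def SmoothSphere (f : ℝ → ℝ → ℝ) : Prop :=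
  ContDiffOn ℝ (⊤ : ℕ∞) (fun p : ℝ × ℝ => f p.1 p.2) (Ioo 0 π ×ˢ (univ : Set ℝ)) ∧
  (∀ θ φ : ℝ, f θ (φ + 2 * π) = f θ φ) ∧
  ∀ j : ℕ, ∃ C : ℝ, ∀ θ ∈ Ioo (0 : ℝ) π, ∀ φ : ℝ, covNorm j f θ φ ≤ C
/-- the renormalized energy functional `E(w)` on the sphere. -/
def Efun (ω w₁ w₂ : ℝ → ℝ → ℝ) : ℝ :=
  (1 / 2) * sphInt (fun θ φ =>
    gradNormSqS2 w₁ θ φ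
      + Real.exp (4 * (w₁ θ φ - Real.log (ω θ φ))) * gradNormSqS2 w₂ θ φ
      + 2 * lapS2 (fun θ φ => Real.log (ω θ φ)) θ φ * w₁ θ φ)

/-- the Euler–Lagrange operator `M₁(w)`. -/
def Mop1 (ω w₁ w₂ : ℝ → ℝ → ℝ) (θ φ : ℝ) : ℝ :=
  lapS2 w₁ θ φ
    - 2 * Real.exp (4 * (w₁ θ φ - Real.log (ω θ φ))) * gradNormSqS2 w₂ θ φ
    - lapS2 (fun θ φ => Real.log (ω θ φ)) θ φ

/-- the Euler–Lagrange operator `M₂(w)`. -/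
def Mop2 (ω w₁ w₂ : ℝ → ℝ → ℝ) (θ φ : ℝ) : ℝ :=
  lapS2 w₂ θ φ
    + 4 * gradDotS2 (fun θ φ => w₁ θ φ - Real.log (ω θ φ)) w₂ θ φ



/-! ### Regularity framework -/

/-- joint continuity on the coordinate domain -/
def CD (f : ℝ → ℝ → ℝ) : Prop :=
  ContinuousOn (fun p : ℝ × ℝ => f p.1 p.2) (Ioo 0 π ×ˢ (univ : Set ℝ))

structure R2 (f : ℝ → ℝ → ℝ) : Prop where
  per : ∀ θ φ : ℝ, f θ (φ + 2 * π) = f θ φ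
  c0 : CD f
  c1 : CD (pdθ f)
  c2 : CD (pdφ f)
  c11 : CD (pdθ (pdθ f))
  c22 : CD (pdφ (pdφ f))
  d1 : ∀ θ ∈ Ioo (0 : ℝ) π, ∀ φ : ℝ, HasDerivAt (fun x => f x φ) (pdθ f θ φ) θ
  d2 : ∀ θ ∈ Ioo (0 : ℝ) π, ∀ φ : ℝ, HasDerivAt (fun x => f θ x) (pdφ f θ φ) φ
  d11 : ∀ θ ∈ Ioo (0 : ℝ) π, ∀ φ : ℝ,
    HasDerivAt (fun x => pdθ f x φ) (pdθ (pdθ f) θ φ) θ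
  d22 : ∀ θ ∈ Ioo (0 : ℝ) π, ∀ φ : ℝ,
    HasDerivAt (fun x => pdφ f θ x) (pdφ (pdφ f) θ φ) φ

lemma isOpen_dom : IsOpen (Ioo 0 π ×ˢ (univ : Set ℝ)) := isOpen_Ioo.prod isOpen_univ

lemma mem_dom {θ φ : ℝ} (h : θ ∈ Ioo (0 : ℝ) π) :
    ((θ, φ) : ℝ × ℝ) ∈ Ioo (0 : ℝ) π ×ˢ (univ : Set ℝ) := ⟨h, mem_univ _⟩

lemma cd_hasDeriv_θ {f : ℝ → ℝ → ℝ} {n : WithTop ℕ∞} (hn : n ≠ 0)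
    (hf : ContDiffOn ℝ n (fun p : ℝ × ℝ => f p.1 p.2) (Ioo 0 π ×ˢ (univ : Set ℝ)))
    {θ : ℝ} (h : θ ∈ Ioo (0 : ℝ) π) (φ : ℝ) :
    HasDerivAt (fun x => f x φ) (fderiv ℝ (fun p : ℝ × ℝ => f p.1 p.2) (θ, φ) (1, 0)) θ := by
  have hd : DifferentiableAt ℝ (fun p : ℝ × ℝ => f p.1 p.2) (θ, φ) :=
    (hf.differentiableOn hn).differentiableAt (isOpen_dom.mem_nhds (mem_dom h))
  have h2 : HasDerivAt (fun x : ℝ => (x, φ)) ((1 : ℝ), (0 : ℝ)) θ :=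
    (hasDerivAt_id θ).prodMk (hasDerivAt_const θ φ)
  exact hd.hasFDerivAt.comp_hasDerivAt θ h2

lemma cd_hasDeriv_φ {f : ℝ → ℝ → ℝ} {n : WithTop ℕ∞} (hn : n ≠ 0)
    (hf : ContDiffOn ℝ n (fun p : ℝ × ℝ => f p.1 p.2) (Ioo 0 π ×ˢ (univ : Set ℝ)))
    {θ : ℝ} (h : θ ∈ Ioo (0 : ℝ) π) (φ : ℝ) :
    HasDerivAt (fun x => f θ x) (fderiv ℝ (fun p : ℝ × ℝ => f p.1 p.2) (θ, φ) (0, 1)) φ := by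
  have hd : DifferentiableAt ℝ (fun p : ℝ × ℝ => f p.1 p.2) (θ, φ) :=
    (hf.differentiableOn hn).differentiableAt (isOpen_dom.mem_nhds (mem_dom h))
  have h2 : HasDerivAt (fun x : ℝ => (θ, x)) ((0 : ℝ), (1 : ℝ)) φ :=
    (hasDerivAt_const φ θ).prodMk (hasDerivAt_id φ)
  exact hd.hasFDerivAt.comp_hasDerivAt φ h2

lemma cd_pdθ {f : ℝ → ℝ → ℝ} {n m : WithTop ℕ∞} (hn : m + 1 ≤ n)
    (hf : ContDiffOn ℝ n (fun p : ℝ × ℝ => f p.1 p.2) (Ioo 0 π ×ˢ (univ : Set ℝ))) :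
    ContDiffOn ℝ m (fun p : ℝ × ℝ => pdθ f p.1 p.2) (Ioo 0 π ×ˢ (univ : Set ℝ)) := by
  have hn0 : n ≠ 0 := by
    rintro rfl
    simp at hn
  have h1 := hf.fderiv_of_isOpen isOpen_dom hn
  have h2 := h1.clm_apply (contDiffOn_const (c := ((1 : ℝ), (0 : ℝ))))
  refine h2.congr ?_
  rintro ⟨θ, φ⟩ hp
  exact (cd_hasDeriv_θ hn0 hf hp.1 φ).deriv

lemma cd_pdφ {f : ℝ → ℝ → ℝ} {n m : WithTop ℕ∞} (hn : m + 1 ≤ n)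
    (hf : ContDiffOn ℝ n (fun p : ℝ × ℝ => f p.1 p.2) (Ioo 0 π ×ˢ (univ : Set ℝ))) :
    ContDiffOn ℝ m (fun p : ℝ × ℝ => pdφ f p.1 p.2) (Ioo 0 π ×ˢ (univ : Set ℝ)) := by
  have hn0 : n ≠ 0 := by
    rintro rfl
    simp at hn
  have h1 := hf.fderiv_of_isOpen isOpen_dom hn
  have h2 := h1.clm_apply (contDiffOn_const (c := ((0 : ℝ), (1 : ℝ))))
  refine h2.congr ?_
  rintro ⟨θ, φ⟩ hp
  exact (cd_hasDeriv_φ hn0 hf hp.1 φ).deriv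

lemma R2.of_contDiffOn {f : ℝ → ℝ → ℝ}
    (hf : ContDiffOn ℝ 2 (fun p : ℝ × ℝ => f p.1 p.2) (Ioo 0 π ×ˢ (univ : Set ℝ)))
    (hper : ∀ θ φ : ℝ, f θ (φ + 2 * π) = f θ φ) : R2 f := by
  have e1 : (1 : WithTop ℕ∞) + 1 ≤ 2 := by norm_num
  have e0 : (0 : WithTop ℕ∞) + 1 ≤ 1 := by norm_num
  have h1 := cd_pdθ e1 hf
  have h2 := cd_pdφ e1 hf
  refine ⟨hper, hf.continuousOn, h1.continuousOn, h2.continuousOn,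
    (cd_pdθ e0 h1).continuousOn, (cd_pdφ e0 h2).continuousOn, ?_, ?_, ?_, ?_⟩
  · intro θ h φ
    have := cd_hasDeriv_θ two_ne_zero hf h φ
    exact this.differentiableAt.hasDerivAt
  · intro θ h φ
    have := cd_hasDeriv_φ two_ne_zero hf h φ
    exact this.differentiableAt.hasDerivAt
  · intro θ h φ
    have := cd_hasDeriv_θ one_ne_zero h1 h φ
    exact this.differentiableAt.hasDerivAt
  · intro θ h φ
    have := cd_hasDeriv_φ one_ne_zero h2 h φ
    exact this.differentiableAt.hasDerivAt

lemma per_pdφ {f : ℝ → ℝ → ℝ} (hper : ∀ θ φ : ℝ, f θ (φ + 2 * π) = f θ φ) :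
    ∀ θ φ : ℝ, pdφ f θ (φ + 2 * π) = pdφ f θ φ := by
  intro θ φ
  unfold pdφ
  rw [← deriv_comp_add_const]
  simp_rw [hper]

lemma per_pdθ {f : ℝ → ℝ → ℝ} (hper : ∀ θ φ : ℝ, f θ (φ + 2 * π) = f θ φ) :
    ∀ θ φ : ℝ, pdθ f θ (φ + 2 * π) = pdθ f θ φ := by
  intro θ φ
  unfold pdθ
  simp_rw [hper]


section cdalg
variable {f g : ℝ → ℝ → ℝ}
lemma CD.sub (hf : CD f) (hg : CD g) : CD (fun θ φ => f θ φ - g θ φ) := ContinuousOn.sub hf hg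
lemma CD.add (hf : CD f) (hg : CD g) : CD (fun θ φ => f θ φ + g θ φ) := ContinuousOn.add hf hg
lemma CD.mul (hf : CD f) (hg : CD g) : CD (fun θ φ => f θ φ * g θ φ) := ContinuousOn.mul hf hg
lemma CD.neg (hf : CD f) : CD (fun θ φ => - f θ φ) := ContinuousOn.neg hf
lemma CD.pow (hf : CD f) (n : ℕ) : CD (fun θ φ => f θ φ ^ n) := ContinuousOn.pow hf n
lemma CD.exp (hf : CD f) : CD (fun θ φ => Real.exp (f θ φ)) := ContinuousOn.rexp hf
lemma CD.div (hf : CD f) (hg : CD g) (h : ∀ θ ∈ Ioo (0 : ℝ) π, ∀ φ, g θ φ ≠ 0) :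
    CD (fun θ φ => f θ φ / g θ φ) := ContinuousOn.div hf hg (fun p hp => h p.1 hp.1 p.2)
lemma CD.inv (hg : CD g) (h : ∀ θ ∈ Ioo (0 : ℝ) π, ∀ φ, g θ φ ≠ 0) :
    CD (fun θ φ => (g θ φ)⁻¹) := ContinuousOn.inv₀ hg (fun p hp => h p.1 hp.1 p.2)
lemma CD.log (hg : CD g) (h : ∀ θ ∈ Ioo (0 : ℝ) π, ∀ φ, g θ φ ≠ 0) :
    CD (fun θ φ => Real.log (g θ φ)) := ContinuousOn.log hg (fun p hp => h p.1 hp.1 p.2)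
lemma CD.const (c : ℝ) : CD (fun _ _ => c) := continuousOn_const
lemma CD.of_θ {h : ℝ → ℝ} (hh : ContinuousOn h (Ioo 0 π)) : CD (fun θ _ => h θ) :=
  ContinuousOn.comp (g := h) hh continuous_fst.continuousOn (fun _ hp => hp.1)
lemma CD.sin : CD (fun θ _ => Real.sin θ) := CD.of_θ continuous_sin.continuousOn
lemma CD.cos : CD (fun θ _ => Real.cos θ) := CD.of_θ continuous_cos.continuousOn
end cdalg

section sub
variable {f g : ℝ → ℝ → ℝ}

lemma R2.sub_θ (hf : R2 f) (hg : R2 g) {θ : ℝ} (h : θ ∈ Ioo (0 : ℝ) π) (φ : ℝ) :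
    pdθ (fun θ φ => f θ φ - g θ φ) θ φ = pdθ f θ φ - pdθ g θ φ :=
  ((hf.d1 θ h φ).sub (hg.d1 θ h φ)).deriv

lemma R2.sub_φ (hf : R2 f) (hg : R2 g) {θ : ℝ} (h : θ ∈ Ioo (0 : ℝ) π) (φ : ℝ) :
    pdφ (fun θ φ => f θ φ - g θ φ) θ φ = pdφ f θ φ - pdφ g θ φ :=
  ((hf.d2 θ h φ).sub (hg.d2 θ h φ)).deriv

lemma R2.sub_dθθ (hf : R2 f) (hg : R2 g) {θ : ℝ} (h : θ ∈ Ioo (0 : ℝ) π) (φ : ℝ) :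
    HasDerivAt (fun x => pdθ (fun θ φ => f θ φ - g θ φ) x φ)
     (pdθ (pdθ f) θ φ - pdθ (pdθ g) θ φ) θ := by
  refine ((hf.d11 θ h φ).sub (hg.d11 θ h φ)).congr_of_eventuallyEq ?_
  filter_upwards [isOpen_Ioo.mem_nhds h] with x hx
  exact hf.sub_θ hg hx φ

lemma R2.sub_dφφ (hf : R2 f) (hg : R2 g) {θ : ℝ} (h : θ ∈ Ioo (0 : ℝ) π) (φ : ℝ) :
    HasDerivAt (fun x => pdφ (fun θ φ => f θ φ - g θ φ) θ x)
     (pdφ (pdφ f) θ φ - pdφ (pdφ g) θ φ) φ := by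
  refine ((hf.d22 θ h φ).sub (hg.d22 θ h φ)).congr_of_eventuallyEq ?_
  filter_upwards with x
  exact hf.sub_φ hg h x

lemma R2.sub_θθ (hf : R2 f) (hg : R2 g) {θ : ℝ} (h : θ ∈ Ioo (0 : ℝ) π) (φ : ℝ) :
    pdθ (pdθ (fun θ φ => f θ φ - g θ φ)) θ φ = pdθ (pdθ f) θ φ - pdθ (pdθ g) θ φ :=
  (hf.sub_dθθ hg h φ).deriv

lemma R2.sub_φφ (hf : R2 f) (hg : R2 g) {θ : ℝ} (h : θ ∈ Ioo (0 : ℝ) π) (φ : ℝ) :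
    pdφ (pdφ (fun θ φ => f θ φ - g θ φ)) θ φ = pdφ (pdφ f) θ φ - pdφ (pdφ g) θ φ :=
  (hf.sub_dφφ hg h φ).deriv

lemma CD.congr {f g : ℝ → ℝ → ℝ} (hf : CD f)
    (h : ∀ θ ∈ Ioo (0 : ℝ) π, ∀ φ, g θ φ = f θ φ) : CD g :=
  ContinuousOn.congr hf (fun p hp => h p.1 hp.1 p.2)

lemma R2.sub (hf : R2 f) (hg : R2 g) : R2 (fun θ φ => f θ φ - g θ φ) where
  per θ φ := by rw [hf.per, hg.per]
  c0 := ContinuousOn.sub hf.c0 hg.c0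
  c1 := CD.congr (CD.sub hf.c1 hg.c1) (fun θ h φ => hf.sub_θ hg h φ)
  c2 := CD.congr (CD.sub hf.c2 hg.c2) (fun θ h φ => hf.sub_φ hg h φ)
  c11 := CD.congr (CD.sub hf.c11 hg.c11) (fun θ h φ => hf.sub_θθ hg h φ)
  c22 := CD.congr (CD.sub hf.c22 hg.c22) (fun θ h φ => hf.sub_φφ hg h φ)
  d1 θ h φ := by rw [hf.sub_θ hg h]; exact (hf.d1 θ h φ).sub (hg.d1 θ h φ)
  d2 θ h φ := by rw [hf.sub_φ hg h]; exact (hf.d2 θ h φ).sub (hg.d2 θ h φ)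
  d11 θ h φ := by rw [hf.sub_θθ hg h]; exact hf.sub_dθθ hg h φ
  d22 θ h φ := by rw [hf.sub_φφ hg h]; exact hf.sub_dφφ hg h φ

lemma R2.sub_lap (hf : R2 f) (hg : R2 g) {θ : ℝ} (h : θ ∈ Ioo (0 : ℝ) π) (φ : ℝ) :
    lapS2 (fun θ φ => f θ φ - g θ φ) θ φ = lapS2 f θ φ - lapS2 g θ φ := by
  unfold lapS2
  rw [hf.sub_θθ hg h, hf.sub_φφ hg h, hf.sub_θ hg h]
  ring

end sub

/-! ### Integration -/

lemma sin_pos_D {θ : ℝ} (h : θ ∈ Ioo (0 : ℝ) π) : 0 < sin θ := sin_pos_of_mem_Ioo h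

def inn (F : ℝ → ℝ → ℝ) (θ : ℝ) : ℝ := ∫ φ in (0 : ℝ)..(2 * π), F θ φ

lemma sphInt_eq (F : ℝ → ℝ → ℝ) :
    sphInt F = ∫ θ in Ioo (0 : ℝ) π, inn F θ * sin θ := by
  unfold sphInt inn
  simp_rw [intervalIntegral.integral_of_le two_pi_pos.le, integral_Ioc_eq_integral_Ioo]

lemma CD.slice {F : ℝ → ℝ → ℝ} (hF : CD F) {θ : ℝ} (h : θ ∈ Ioo (0 : ℝ) π) :
    Continuous (F θ) := by
  have : Continuous (fun φ : ℝ => ((θ, φ) : ℝ × ℝ)) := by fun_prop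
  rw [← continuousOn_univ]
  exact ContinuousOn.comp (g := fun p : ℝ × ℝ => F p.1 p.2) hF this.continuousOn
    (fun φ _ => mem_dom h)

lemma CD.slice_θ {F : ℝ → ℝ → ℝ} (hF : CD F) (φ : ℝ) :
    ContinuousOn (fun θ => F θ φ) (Ioo 0 π) := by
  have : Continuous (fun θ : ℝ => ((θ, φ) : ℝ × ℝ)) := by fun_prop
  exact ContinuousOn.comp (g := fun p : ℝ × ℝ => F p.1 p.2) hF this.continuousOn
    (fun θ h => mem_dom h)

lemma CD.loc_bound {F : ℝ → ℝ → ℝ} (hF : CD F) {θ₀ : ℝ} (h : θ₀ ∈ Ioo (0 : ℝ) π) :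
    ∃ s ∈ nhds θ₀, s ⊆ Ioo (0 : ℝ) π ∧ ∃ C : ℝ, ∀ θ ∈ s, ∀ φ ∈ Icc (0 : ℝ) (2 * π),
      |F θ φ| ≤ C := by
  obtain ⟨s, hs, hs2, hc⟩ : ∃ s ∈ nhds θ₀, s ⊆ Ioo (0 : ℝ) π ∧ IsCompact s := by
    obtain ⟨s, h1, h2, h3⟩ := local_compact_nhds (isOpen_Ioo.mem_nhds h)
    exact ⟨s, h1, h2, h3⟩
  refine ⟨s, hs, hs2, ?_⟩
  have hK : IsCompact (s ×ˢ Icc (0 : ℝ) (2 * π)) := hc.prod isCompact_Icc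
  obtain ⟨C, hC⟩ := hK.exists_bound_of_continuousOn
    (f := fun p : ℝ × ℝ => F p.1 p.2) (ContinuousOn.mono hF (prod_mono hs2 (subset_univ _)))
  exact ⟨C, fun θ hθ φ hφ => hC (θ, φ) ⟨hθ, hφ⟩⟩

lemma CD.inn_cont {F : ℝ → ℝ → ℝ} (hF : CD F) : ContinuousOn (inn F) (Ioo 0 π) := by
  intro θ₀ h
  apply ContinuousAt.continuousWithinAt
  obtain ⟨s, hs, hs2, C, hC⟩ := hF.loc_bound h
  unfold inn
  refine intervalIntegral.continuousAt_of_dominated_interval (bound := fun _ => C) ?_ ?_ ?_ ?_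
  · filter_upwards [hs] with θ hθ
    exact (hF.slice (hs2 hθ)).aestronglyMeasurable
  · filter_upwards [hs] with θ hθ
    refine Eventually.of_forall (fun φ hφ => ?_)
    rw [uIoc_of_le two_pi_pos.le] at hφ
    exact hC θ hθ φ ⟨hφ.1.le, hφ.2⟩
  · exact intervalIntegrable_const
  · refine Eventually.of_forall (fun φ _ => ?_)
    exact (hF.slice_θ φ).continuousAt (isOpen_Ioo.mem_nhds h)

structure Adm (F : ℝ → ℝ → ℝ) : Prop where
  cd : CD F
  bd : ∃ C : ℝ, ∀ θ ∈ Ioo (0 : ℝ) π, ∀ φ : ℝ, |F θ φ| * sin θ ≤ C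

lemma CD.ii {F : ℝ → ℝ → ℝ} (hF : CD F) {θ : ℝ} (h : θ ∈ Ioo (0 : ℝ) π) (a b : ℝ) :
    IntervalIntegrable (F θ) volume a b := (hF.slice h).intervalIntegrable a b

lemma Adm.int {F : ℝ → ℝ → ℝ} (hF : Adm F) :
    IntegrableOn (fun θ => inn F θ * sin θ) (Ioo 0 π) := by
  obtain ⟨C, hC⟩ := hF.bd
  have hc : ContinuousOn (fun θ => inn F θ * sin θ) (Ioo 0 π) :=
    hF.cd.inn_cont.mul continuous_sin.continuousOn
  refine Integrable.of_bound (hc.aestronglyMeasurable measurableSet_Ioo) (2 * π * C) ?_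
  refine (ae_restrict_iff' measurableSet_Ioo).2 (Eventually.of_forall fun θ hθ => ?_)
  have hs := sin_pos_D hθ
  have h1 : ‖inn F θ‖ ≤ (C / sin θ) * |2 * π - 0| := by
    refine intervalIntegral.norm_integral_le_of_norm_le_const fun φ _ => ?_
    rw [le_div_iff₀ hs]
    exact hC θ hθ φ
  rw [norm_mul, Real.norm_eq_abs (sin θ), abs_of_pos hs]
  rw [sub_zero, abs_of_pos two_pi_pos] at h1
  calc ‖inn F θ‖ * sin θ ≤ (C / sin θ) * (2 * π) * sin θ := by gcongr
    _ = 2 * π * C := by field_simp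

lemma sphInt_mono {F G : ℝ → ℝ → ℝ} (hF : Adm F) (hG : Adm G)
    (h : ∀ θ ∈ Ioo (0 : ℝ) π, ∀ φ, F θ φ ≤ G θ φ) : sphInt F ≤ sphInt G := by
  rw [sphInt_eq, sphInt_eq]
  refine setIntegral_mono_on hF.int hG.int measurableSet_Ioo fun θ hθ => ?_
  refine mul_le_mul_of_nonneg_right ?_ (sin_pos_D hθ).le
  exact intervalIntegral.integral_mono_on two_pi_pos.le (hF.cd.ii hθ _ _) (hG.cd.ii hθ _ _)
    (fun φ _ => h θ hθ φ)

lemma sphInt_congr {F G : ℝ → ℝ → ℝ}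
    (h : ∀ θ ∈ Ioo (0 : ℝ) π, ∀ φ, F θ φ = G θ φ) : sphInt F = sphInt G := by
  rw [sphInt_eq, sphInt_eq]
  refine setIntegral_congr_fun measurableSet_Ioo fun θ hθ => ?_
  have : F θ = G θ := funext (h θ hθ)
  simp only [inn, this]

lemma sphInt_add {F G : ℝ → ℝ → ℝ} (hF : Adm F) (hG : Adm G) :
    sphInt (fun θ φ => F θ φ + G θ φ) = sphInt F + sphInt G := by
  rw [sphInt_eq, sphInt_eq, sphInt_eq, ← integral_add hF.int hG.int]
  refine setIntegral_congr_fun measurableSet_Ioo fun θ hθ => ?_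
  simp only [inn]
  rw [intervalIntegral.integral_add (hF.cd.ii hθ _ _) (hG.cd.ii hθ _ _), add_mul]

lemma sphInt_smul (c : ℝ) (F : ℝ → ℝ → ℝ) :
    sphInt (fun θ φ => c * F θ φ) = c * sphInt F := by
  rw [sphInt_eq, sphInt_eq, ← integral_const_mul]
  refine setIntegral_congr_fun measurableSet_Ioo fun θ hθ => ?_
  simp only [inn]
  rw [intervalIntegral.integral_const_mul, mul_assoc]

lemma Adm.add {F G : ℝ → ℝ → ℝ} (hF : Adm F) (hG : Adm G) :
    Adm (fun θ φ => F θ φ + G θ φ) := by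
  refine ⟨ContinuousOn.add hF.cd hG.cd, ?_⟩
  obtain ⟨C, hC⟩ := hF.bd
  obtain ⟨C', hC'⟩ := hG.bd
  refine ⟨C + C', fun θ hθ φ => ?_⟩
  have h1 := hC θ hθ φ
  have h2 := hC' θ hθ φ
  have := abs_add_le (F θ φ) (G θ φ)
  nlinarith [sin_pos_D hθ]

lemma Adm.smul {F : ℝ → ℝ → ℝ} (c : ℝ) (hF : Adm F) :
    Adm (fun θ φ => c * F θ φ) := by
  refine ⟨ContinuousOn.mul continuousOn_const hF.cd, ?_⟩
  obtain ⟨C, hC⟩ := hF.bd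
  refine ⟨|c| * C, fun θ hθ φ => ?_⟩
  have h1 := hC θ hθ φ
  rw [abs_mul, mul_assoc]
  gcongr

lemma Adm.congr {F G : ℝ → ℝ → ℝ} (hF : Adm F)
    (h : ∀ θ ∈ Ioo (0 : ℝ) π, ∀ φ, G θ φ = F θ φ) : Adm G := by
  refine ⟨hF.cd.congr h, ?_⟩
  obtain ⟨C, hC⟩ := hF.bd
  exact ⟨C, fun θ hθ φ => by rw [h θ hθ φ]; exact hC θ hθ φ⟩

lemma Adm.sub {F G : ℝ → ℝ → ℝ} (hF : Adm F) (hG : Adm G) :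
    Adm (fun θ φ => F θ φ - G θ φ) :=
  (hF.add (hG.smul (-1))).congr (fun θ _ φ => by ring)

lemma sphInt_sub {F G : ℝ → ℝ → ℝ} (hF : Adm F) (hG : Adm G) :
    sphInt (fun θ φ => F θ φ - G θ φ) = sphInt F - sphInt G := by
  have := sphInt_add hF (hG.smul (-1))
  rw [sphInt_smul] at this
  rw [sub_eq_add_neg, ← neg_one_mul (sphInt G), ← this]
  congr 1
  ext θ φ
  ring

/-- derivative of the circle average of a divergence -/
lemma hasDerivAt_inn {A A' B B' : ℝ → ℝ → ℝ} (hA : CD A) (hA' : CD A') (hB' : CD B')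
    (dA : ∀ θ ∈ Ioo (0 : ℝ) π, ∀ φ : ℝ, HasDerivAt (fun x => A x φ) (A' θ φ) θ)
    (dB : ∀ θ ∈ Ioo (0 : ℝ) π, ∀ φ : ℝ, HasDerivAt (fun x => B θ x) (B' θ φ) φ)
    (hper : ∀ θ φ : ℝ, B θ (φ + 2 * π) = B θ φ) {θ : ℝ} (hθ : θ ∈ Ioo (0 : ℝ) π) :
    HasDerivAt (inn A) (inn (fun θ φ => A' θ φ + B' θ φ) θ) θ := by
  have h0 : inn (fun θ φ => A' θ φ + B' θ φ) θ = inn A' θ := by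
    unfold inn
    rw [intervalIntegral.integral_add (hA'.ii hθ _ _) (hB'.ii hθ _ _),
      intervalIntegral.integral_eq_sub_of_hasDerivAt (fun φ _ => dB θ hθ φ) (hB'.ii hθ _ _)]
    have := hper θ 0
    rw [zero_add] at this
    rw [this]
    ring
  rw [h0]
  obtain ⟨s, hs, hs2, C, hC⟩ := hA'.loc_bound hθ
  unfold inn
  refine (intervalIntegral.hasDerivAt_integral_of_dominated_loc_of_deriv_le
    (s := s) (bound := fun _ => C) hs ?_ (hA.ii hθ _ _) ?_ ?_ ?_ ?_).2
  · filter_upwards [hs] with x hx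
    exact (hA.slice (hs2 hx)).aestronglyMeasurable
  · exact (hA'.slice hθ).aestronglyMeasurable
  · refine Eventually.of_forall (fun φ hφ x hx => ?_)
    rw [uIoc_of_le two_pi_pos.le] at hφ
    exact hC x hx φ ⟨hφ.1.le, hφ.2⟩
  · exact intervalIntegrable_const
  · exact Eventually.of_forall (fun φ _ x hx => dA x (hs2 hx) φ)

lemma sphInt_div {A A' B B' F : ℝ → ℝ → ℝ} (hA : CD A) (hA' : CD A') (hB' : CD B')
    (dA : ∀ θ ∈ Ioo (0 : ℝ) π, ∀ φ : ℝ, HasDerivAt (fun x => A x φ) (A' θ φ) θ)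
    (dB : ∀ θ ∈ Ioo (0 : ℝ) π, ∀ φ : ℝ, HasDerivAt (fun x => B θ x) (B' θ φ) φ)
    (hper : ∀ θ φ : ℝ, B θ (φ + 2 * π) = B θ φ) (hF : Adm F)
    (hdiv : ∀ θ ∈ Ioo (0 : ℝ) π, ∀ φ, sin θ * F θ φ = A' θ φ + B' θ φ)
    {C : ℝ} (hbd : ∀ θ ∈ Ioo (0 : ℝ) π, ∀ φ, |A θ φ| ≤ C * sin θ) : sphInt F = 0 := by
  have key : ∀ θ ∈ Ioo (0 : ℝ) π, HasDerivAt (inn A) (inn F θ * sin θ) θ := by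
    intro θ hθ
    have h := hasDerivAt_inn hA hA' hB' dA dB hper hθ
    have : inn F θ * sin θ = inn (fun θ φ => A' θ φ + B' θ φ) θ := by
      unfold inn
      simp_rw [← hdiv θ hθ]
      rw [intervalIntegral.integral_const_mul, mul_comm]
    rw [this]
    exact h
  have bnd : ∀ θ ∈ Ioo (0 : ℝ) π, ‖inn A θ‖ ≤ 2 * π * C * sin θ := by
    intro θ hθ
    have h1 : ‖inn A θ‖ ≤ (C * sin θ) * |2 * π - 0| :=
      intervalIntegral.norm_integral_le_of_norm_le_const fun φ _ => hbd θ hθ φ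
    rw [sub_zero, abs_of_pos two_pi_pos] at h1
    linarith
  have lim0 : Tendsto (inn A) (nhdsWithin 0 (Ioi 0)) (nhds 0) := by
    refine squeeze_zero_norm' (a := fun θ => 2 * π * C * sin θ) ?_ ?_
    · filter_upwards [Ioo_mem_nhdsGT pi_pos] with θ hθ using bnd θ hθ
    · have : Continuous (fun θ => 2 * π * C * sin θ) := by fun_prop
      simpa using (this.tendsto 0).mono_left nhdsWithin_le_nhds
  have limπ : Tendsto (inn A) (nhdsWithin π (Iio π)) (nhds 0) := by
    refine squeeze_zero_norm' (a := fun θ => 2 * π * C * sin θ) ?_ ?_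
    · filter_upwards [Ioo_mem_nhdsLT pi_pos] with θ hθ using bnd θ hθ
    · have : Continuous (fun θ => 2 * π * C * sin θ) := by fun_prop
      simpa using (this.tendsto π).mono_left nhdsWithin_le_nhds
  rw [sphInt_eq, ← integral_Ioc_eq_integral_Ioo, ← intervalIntegral.integral_of_le pi_pos.le]
  have hinteg : IntervalIntegrable (fun θ => inn F θ * sin θ) volume 0 π := by
    rw [intervalIntegrable_iff_integrableOn_Ioo_of_le pi_pos.le]
    exact hF.int
  rw [intervalIntegral.integral_eq_sub_of_hasDerivAt_of_tendsto pi_pos key hinteg lim0 limπ]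
  simp


lemma cs_int {f : ℝ → ℝ} {a b : ℝ} (hab : a ≤ b) (hf : ContinuousOn f (Icc a b)) :
    (∫ x in a..b, f x) ^ 2 ≤ (b - a) * ∫ x in a..b, f x ^ 2 := by
  rcases hab.eq_or_lt with rfl | hlt
  · simp
  have hu : uIcc a b = Icc a b := uIcc_of_le hab
  have i1 : IntervalIntegrable f volume a b := ContinuousOn.intervalIntegrable (hu ▸ hf)
  have i2 : IntervalIntegrable (fun x => f x ^ 2) volume a b :=
    ContinuousOn.intervalIntegrable (hu ▸ hf.pow 2)
  set I := ∫ x in a..b, f x with hI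
  have h0 : 0 ≤ ∫ x in a..b, ((b - a) * f x - I) ^ 2 :=
    intervalIntegral.integral_nonneg hab (fun x _ => sq_nonneg _)
  have h1 : ∫ x in a..b, ((b - a) * f x - I) ^ 2
      = (b - a) ^ 2 * (∫ x in a..b, f x ^ 2) - 2 * (b - a) * I * I + (b - a) * I ^ 2 := by
    have : ∀ x, ((b - a) * f x - I) ^ 2
        = (b - a) ^ 2 * f x ^ 2 - 2 * (b - a) * I * f x + I ^ 2 := fun x => by ring
    simp_rw [this]
    rw [intervalIntegral.integral_add ((i2.const_mul _).sub (i1.const_mul _))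
      intervalIntegrable_const, intervalIntegral.integral_sub (i2.const_mul _) (i1.const_mul _),
      intervalIntegral.integral_const_mul, intervalIntegral.integral_const_mul,
      intervalIntegral.integral_const, ← hI]
    simp
  rw [h1] at h0
  have h2 : 0 < b - a := sub_pos.2 hlt
  have h3 : 0 ≤ (b - a) * ((b - a) * (∫ x in a..b, f x ^ 2) - I ^ 2) := by nlinarith
  have := nonneg_of_mul_nonneg_right h3 h2
  linarith

/-- circle estimate -/
lemma circle_est {h h' : ℝ → ℝ} (hd : ∀ x, HasDerivAt h (h' x) x) (hc : Continuous h')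
    {φ : ℝ} (hφ : φ ∈ Icc (0 : ℝ) (2 * π)) :
    (h φ - (2 * π)⁻¹ * ∫ x in (0 : ℝ)..(2 * π), h x) ^ 2
      ≤ 2 * π * ∫ x in (0 : ℝ)..(2 * π), h' x ^ 2 := by
  have hcont : Continuous h := continuous_iff_continuousAt.2 fun x => (hd x).continuousAt
  set D := ∫ x in (0 : ℝ)..(2 * π), h' x ^ 2
  have hp := two_pi_pos
  have hsub : ∀ a b : ℝ, 0 ≤ a → a ≤ b → b ≤ 2 * π → (h b - h a) ^ 2 ≤ 2 * π * D := by
    intro a b ha hab hb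
    have e := intervalIntegral.integral_eq_sub_of_hasDerivAt (fun x _ => hd x)
      (hc.intervalIntegrable a b)
    rw [← e]
    refine (cs_int hab hc.continuousOn).trans ?_
    have hD : ∫ x in a..b, h' x ^ 2 ≤ D := by
      refine intervalIntegral.integral_mono_interval ha hab hb ?_ ?_
      · exact Eventually.of_forall fun x => sq_nonneg _
      · exact (hc.pow 2).intervalIntegrable _ _
    have hD0 : 0 ≤ ∫ x in a..b, h' x ^ 2 :=
      intervalIntegral.integral_nonneg hab (fun x _ => sq_nonneg _)
    have : b - a ≤ 2 * π := by linarith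
    gcongr
  have hall : ∀ x ∈ Icc (0 : ℝ) (2 * π), (h φ - h x) ^ 2 ≤ 2 * π * D := by
    intro x hx
    rcases le_total x φ with hle | hle
    · exact hsub x φ hx.1 hle hφ.2
    · have := hsub φ x hφ.1 hle hx.2
      nlinarith
  have e1 : h φ - (2 * π)⁻¹ * ∫ x in (0 : ℝ)..(2 * π), h x
      = (2 * π)⁻¹ * ∫ x in (0 : ℝ)..(2 * π), (h φ - h x) := by
    rw [intervalIntegral.integral_sub intervalIntegrable_const (hcont.intervalIntegrable _ _),
      intervalIntegral.integral_const, smul_eq_mul]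
    field_simp
    ring
  have hcs := cs_int hp.le (f := fun x => h φ - h x) (by fun_prop)
  have hm : ∫ x in (0 : ℝ)..(2 * π), (h φ - h x) ^ 2 ≤ ∫ x in (0 : ℝ)..(2 * π), (2 * π * D) :=
    intervalIntegral.integral_mono_on hp.le
      (Continuous.intervalIntegrable (by fun_prop) _ _) intervalIntegrable_const hall
  rw [intervalIntegral.integral_const, smul_eq_mul] at hm
  rw [e1, mul_pow]
  have h5 : (∫ x in (0 : ℝ)..(2 * π), (h φ - h x)) ^ 2 ≤ (2 * π) ^ 2 * (2 * π * D) := by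
    calc _ ≤ _ := hcs
      _ ≤ (2 * π - 0) * ((2 * π - 0) * (2 * π * D)) := by
        apply mul_le_mul_of_nonneg_left hm; linarith
      _ = _ := by ring
  calc ((2 * π)⁻¹) ^ 2 * (∫ x in (0 : ℝ)..(2 * π), (h φ - h x)) ^ 2
      ≤ ((2 * π)⁻¹) ^ 2 * ((2 * π) ^ 2 * (2 * π * D)) := by gcongr
    _ = 2 * π * D := by field_simp

lemma inn_mono {F G : ℝ → ℝ → ℝ} (hF : CD F) (hG : CD G) {θ : ℝ} (hθ : θ ∈ Ioo (0 : ℝ) π)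
    (h : ∀ φ ∈ Icc (0 : ℝ) (2 * π), F θ φ ≤ G θ φ) : inn F θ ≤ inn G θ :=
  intervalIntegral.integral_mono_on two_pi_pos.le (hF.ii hθ _ _) (hG.ii hθ _ _) h

lemma sin_ge_of_between {θ x : ℝ} (hθ : θ ∈ Ioo (0 : ℝ) π) (hx : x ∈ uIcc θ (π / 2)) :
    sin θ ≤ sin x := by
  rcases le_total θ (π / 2) with h | h
  · rw [uIcc_of_le h] at hx
    exact sin_le_sin_of_le_of_le_pi_div_two (by linarith [hθ.1, pi_pos]) hx.2 hx.1
  · rw [uIcc_of_ge h] at hx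
    rw [← sin_pi_sub θ, ← sin_pi_sub x]
    exact sin_le_sin_of_le_of_le_pi_div_two (by linarith [hθ.2, pi_pos])
      (by linarith [hx.1]) (by linarith [hx.2])

lemma poincare {σ σ1 σ2 : ℝ → ℝ → ℝ} (c0 : CD σ) (c1 : CD σ1) (c2 : CD σ2)
    (d1 : ∀ θ ∈ Ioo (0 : ℝ) π, ∀ φ : ℝ, HasDerivAt (fun x => σ x φ) (σ1 θ φ) θ)
    (d2 : ∀ θ ∈ Ioo (0 : ℝ) π, ∀ φ : ℝ, HasDerivAt (fun x => σ θ x) (σ2 θ φ) φ)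
    (hb : ∃ C, ∀ θ ∈ Ioo (0 : ℝ) π, ∀ φ, |σ θ φ| ≤ C)
    (hA : Adm (fun θ φ => σ1 θ φ ^ 2 + (sin θ ^ 2)⁻¹ * σ2 θ φ ^ 2)) :
    ∃ c : ℝ, Adm (fun θ φ => (σ θ φ - c) ^ 2) ∧ sphInt (fun θ φ => (σ θ φ - c) ^ 2)
      ≤ 9 * π ^ 2 * sphInt (fun θ φ => σ1 θ φ ^ 2 + (sin θ ^ 2)⁻¹ * σ2 θ φ ^ 2) := by
  set G : ℝ → ℝ → ℝ := fun θ φ => σ1 θ φ ^ 2 + (sin θ ^ 2)⁻¹ * σ2 θ φ ^ 2 with hG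
  set m : ℝ → ℝ := fun θ => (2 * π)⁻¹ * inn σ θ with hm
  set c := m (π / 2) with hc
  have hpp := two_pi_pos
  have hadm : Adm (fun θ φ => (σ θ φ - c) ^ 2) := by
    refine ⟨(c0.sub (CD.const c)).pow 2, ?_⟩
    obtain ⟨C, hC⟩ := hb
    refine ⟨(C + |c|) ^ 2, fun θ hθ φ => ?_⟩
    have h1 : |σ θ φ - c| ≤ C + |c| := (abs_sub _ _).trans (by linarith [hC θ hθ φ])
    rw [abs_pow]
    have h2 : |σ θ φ - c| ^ 2 ≤ (C + |c|) ^ 2 := by gcongr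
    nlinarith [sin_pos_D hθ, sin_le_one θ, sq_nonneg |σ θ φ - c|]
  refine ⟨c, hadm, ?_⟩
  have hG0 : ∀ θ, 0 ≤ inn G θ := fun θ =>
    intervalIntegral.integral_nonneg hpp.le (fun φ _ => by positivity)
  have hσ1G : ∀ θ ∈ Ioo (0 : ℝ) π, inn (fun θ φ => σ1 θ φ ^ 2) θ ≤ inn G θ := fun θ hθ =>
    inn_mono (c1.pow 2) hA.cd hθ (fun φ _ => by
      simp only [hG]; have : 0 ≤ (sin θ ^ 2)⁻¹ * σ2 θ φ ^ 2 := by positivity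
      linarith)
  have hσ2G : ∀ θ ∈ Ioo (0 : ℝ) π, inn (fun θ φ => σ2 θ φ ^ 2) θ ≤ inn G θ := fun θ hθ =>
    inn_mono (c2.pow 2) hA.cd hθ (fun φ _ => by
      simp only [hG]
      have hs := sin_pos_D hθ
      have h1 : 1 ≤ (sin θ ^ 2)⁻¹ := (one_le_inv₀ (by positivity)).2
        (pow_le_one₀ hs.le (sin_le_one θ))
      nlinarith [sq_nonneg (σ1 θ φ), sq_nonneg (σ2 θ φ)])
  set S := sphInt G with hS
  have hSeq : S = ∫ θ in (0 : ℝ)..π, inn G θ * sin θ := by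
    rw [hS, sphInt_eq, intervalIntegral.integral_of_le pi_pos.le, integral_Ioc_eq_integral_Ioo]
  have hGii : IntervalIntegrable (fun θ => inn G θ * sin θ) volume 0 π := by
    rw [intervalIntegrable_iff_integrableOn_Ioo_of_le pi_pos.le]
    exact hA.int
  -- derivative of the mean
  have dm : ∀ θ ∈ Ioo (0 : ℝ) π, HasDerivAt m ((2 * π)⁻¹ * inn σ1 θ) θ := by
    intro θ hθ
    have := hasDerivAt_inn (B := fun _ _ => 0) (B' := fun _ _ => 0) c0 c1 (CD.const 0) d1
      (fun θ _ φ => hasDerivAt_const φ (0 : ℝ)) (fun _ _ => rfl) hθ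
    simp only [add_zero] at this
    exact this.const_mul _
  have dmsq : ∀ θ ∈ Ioo (0 : ℝ) π, ((2 * π)⁻¹ * inn σ1 θ) ^ 2 ≤ (2 * π)⁻¹ * inn G θ := by
    intro θ hθ
    have h1 := cs_int hpp.le (f := σ1 θ) (c1.slice hθ).continuousOn
    have h2 := hσ1G θ hθ
    have h3 : inn σ1 θ ^ 2 ≤ 2 * π * inn G θ := by
      refine h1.trans ?_
      rw [sub_zero]
      exact mul_le_mul_of_nonneg_left h2 hpp.le
    calc ((2 * π)⁻¹ * inn σ1 θ) ^ 2 = (2 * π)⁻¹ ^ 2 * inn σ1 θ ^ 2 := by ring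
      _ ≤ (2 * π)⁻¹ ^ 2 * (2 * π * inn G θ) := by gcongr
      _ = (2 * π)⁻¹ * inn G θ := by field_simp
  have hmid : π / 2 ∈ Ioo (0 : ℝ) π := ⟨by linarith [pi_pos], by linarith [pi_pos]⟩
  have cinn : ContinuousOn (fun θ => (2 * π)⁻¹ * inn σ1 θ) (Ioo 0 π) :=
    continuousOn_const.mul c1.inn_cont
  -- core: estimate on an interval `[x,y]` inside
  have core : ∀ x y : ℝ, x ∈ Ioo (0 : ℝ) π → y ∈ Ioo (0 : ℝ) π → x ≤ y → y - x ≤ π / 2 →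
      ∀ r > 0, (∀ z ∈ Icc x y, r ≤ sin z) → (m y - m x) ^ 2 * r ≤ 1 / 4 * S := by
    intro x y hx hy hxy hlen r hr hsin
    have hsub : Icc x y ⊆ Ioo 0 π := fun z hz => ⟨hx.1.trans_le hz.1, hz.2.trans_lt hy.2⟩
    have hc1 := cinn.mono hsub
    have e := intervalIntegral.integral_eq_sub_of_hasDerivAt (f := m) (a := x) (b := y)
      (fun z hz => dm z (hsub (by rwa [uIcc_of_le hxy] at hz)))
      (ContinuousOn.intervalIntegrable (by rwa [uIcc_of_le hxy]))
    rw [← e]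
    have h1 := cs_int hxy hc1
    have h2 : r * ∫ z in x..y, ((2 * π)⁻¹ * inn σ1 z) ^ 2
        ≤ ∫ z in x..y, (2 * π)⁻¹ * (inn G z * sin z) := by
      rw [← intervalIntegral.integral_const_mul]
      refine intervalIntegral.integral_mono_on hxy ?_ ?_ ?_
      · refine ContinuousOn.intervalIntegrable ?_
        rw [uIcc_of_le hxy]
        exact continuousOn_const.mul (hc1.pow 2)
      · refine ContinuousOn.intervalIntegrable ?_
        rw [uIcc_of_le hxy]
        exact continuousOn_const.mul ((hA.cd.inn_cont.mono hsub).mul continuous_sin.continuousOn)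
      · intro z hz
        have a1 := dmsq z (hsub hz)
        have a2 := hsin z hz
        calc r * ((2 * π)⁻¹ * inn σ1 z) ^ 2 ≤ r * ((2 * π)⁻¹ * inn G z) := by gcongr
          _ ≤ sin z * ((2 * π)⁻¹ * inn G z) := by
            have := hG0 z
            gcongr
          _ = _ := by ring
    have h3 : ∫ z in x..y, (inn G z * sin z) ≤ S := by
      rw [hSeq]
      refine intervalIntegral.integral_mono_interval hx.1.le hxy hy.2.le ?_ hGii
      refine (ae_restrict_iff' measurableSet_Ioc).2 (Eventually.of_forall fun z hz => ?_)
      exact mul_nonneg (hG0 z) (sin_nonneg_of_nonneg_of_le_pi hz.1.le hz.2)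
    rw [intervalIntegral.integral_const_mul] at h2
    have h4 : 0 ≤ ∫ z in x..y, ((2 * π)⁻¹ * inn σ1 z) ^ 2 :=
      intervalIntegral.integral_nonneg hxy (fun _ _ => sq_nonneg _)
    calc (∫ z in x..y, (2 * π)⁻¹ * inn σ1 z) ^ 2 * r
        ≤ ((y - x) * ∫ z in x..y, ((2 * π)⁻¹ * inn σ1 z) ^ 2) * r := by gcongr
      _ ≤ (π / 2 * ∫ z in x..y, ((2 * π)⁻¹ * inn σ1 z) ^ 2) * r := by gcongr
      _ = π / 2 * (r * ∫ z in x..y, ((2 * π)⁻¹ * inn σ1 z) ^ 2) := by ring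
      _ ≤ π / 2 * ((2 * π)⁻¹ * S) := by
        refine mul_le_mul_of_nonneg_left (h2.trans ?_) (by positivity)
        exact mul_le_mul_of_nonneg_left h3 (by positivity)
      _ = 1 / 4 * S := by field_simp; ring
  have hmc : ∀ θ ∈ Ioo (0 : ℝ) π, (m θ - c) ^ 2 * sin θ ≤ 1 / 4 * S := by
    intro θ hθ
    have hs := sin_pos_D hθ
    rcases le_total θ (π / 2) with h | h
    · have := core θ (π / 2) hθ hmid h (by linarith [hθ.1]) (sin θ) hs
        (fun z hz => sin_ge_of_between hθ (by rwa [uIcc_of_le h]))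
      rw [← hc] at this
      nlinarith
    · exact core (π / 2) θ hmid hθ h (by linarith [hθ.2]) (sin θ) hs
        (fun z hz => sin_ge_of_between hθ (by rwa [uIcc_of_ge h]))
  have hinn : ∀ θ ∈ Ioo (0 : ℝ) π, inn (fun θ φ => (σ θ φ - c) ^ 2) θ * sin θ
      ≤ 8 * π ^ 2 * (inn G θ * sin θ) + π * S := by
    intro θ hθ
    have hs := sin_pos_D hθ
    have h1 : inn (fun θ φ => (σ θ φ - c) ^ 2) θ
        ≤ inn (fun _ _ => 2 * (2 * π * inn G θ) + 2 * (m θ - c) ^ 2) θ := by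
      refine inn_mono hadm.cd (CD.const _) hθ (fun φ hφ => ?_)
      have h2 := circle_est (d2 θ hθ) (c2.slice hθ) hφ
      have h3 := hσ2G θ hθ
      have h4 : (σ θ φ - m θ) ^ 2 ≤ 2 * π * inn G θ :=
        h2.trans (mul_le_mul_of_nonneg_left h3 hpp.le)
      nlinarith [sq_nonneg ((σ θ φ - m θ) - (m θ - c))]
    have h5 : inn (fun _ _ => 2 * (2 * π * inn G θ) + 2 * (m θ - c) ^ 2) θ
        = 2 * π * (2 * (2 * π * inn G θ) + 2 * (m θ - c) ^ 2) := by
      unfold inn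
      rw [intervalIntegral.integral_const, smul_eq_mul, sub_zero]
    rw [h5] at h1
    calc _ ≤ 2 * π * (2 * (2 * π * inn G θ) + 2 * (m θ - c) ^ 2) * sin θ := by gcongr
      _ = 8 * π ^ 2 * (inn G θ * sin θ) + 4 * π * ((m θ - c) ^ 2 * sin θ) := by ring
      _ ≤ 8 * π ^ 2 * (inn G θ * sin θ) + 4 * π * (1 / 4 * S) := by
        have := hmc θ hθ
        gcongr
      _ = _ := by ring
  rw [sphInt_eq]
  have hcst : IntegrableOn (fun _ : ℝ => π * S) (Ioo (0 : ℝ) π) :=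
    integrableOn_const (by simp)
  calc ∫ θ in Ioo (0 : ℝ) π, inn (fun θ φ => (σ θ φ - c) ^ 2) θ * sin θ
      ≤ ∫ θ in Ioo (0 : ℝ) π, (8 * π ^ 2 * (inn G θ * sin θ) + π * S) := by
        refine setIntegral_mono_on hadm.int ?_ measurableSet_Ioo hinn
        exact (hA.int.const_mul _).add hcst
    _ = 9 * π ^ 2 * S := by
        rw [integral_add (hA.int.const_mul _) hcst, integral_const_mul, hS, sphInt_eq]
        simp [pi_pos.le]
        ring

/-! ### One dimensional Liouville -/

/-- the cylinder coordinate -/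
def tt (θ : ℝ) : ℝ := (1 / 2) * (log (1 + cos θ) - log (1 - cos θ))

lemma cos_bd {θ : ℝ} (hθ : θ ∈ Ioo (0 : ℝ) π) : 0 < 1 + cos θ ∧ 0 < 1 - cos θ := by
  have hs := sin_pos_D hθ
  have := sin_sq_add_cos_sq θ
  constructor <;> nlinarith [neg_one_le_cos θ, cos_le_one θ, sq_nonneg (sin θ)]

lemma hasDerivAt_tt {θ : ℝ} (hθ : θ ∈ Ioo (0 : ℝ) π) : HasDerivAt tt (-(sin θ)⁻¹) θ := by
  obtain ⟨h1, h2⟩ := cos_bd hθ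
  have hs := sin_pos_D hθ
  have e1 := ((hasDerivAt_cos θ).const_add 1).log h1.ne'
  have e2 := ((hasDerivAt_cos θ).const_sub 1).log h2.ne'
  have := (e1.sub e2).const_mul (1 / 2 : ℝ)
  refine this.congr_deriv ?_
  field_simp
  have := sin_sq_add_cos_sq θ
  nlinarith

lemma tt_surj (T : ℝ) : ∃ θ ∈ Ioo (0 : ℝ) π, tt θ = T := by
  have hlt : |tanh T| < 1 := Real.abs_tanh_lt_one T
  obtain ⟨l1, l2⟩ := abs_lt.1 hlt
  refine ⟨arccos (tanh T), ⟨arccos_pos.2 l2, ?_⟩, ?_⟩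
  · rcases (arccos_le_pi (tanh T)).lt_or_eq with h | h
    · exact h
    · rw [arccos_eq_pi] at h
      linarith
  · unfold tt
    rw [cos_arccos l1.le l2.le, tanh_eq_sinh_div_cosh]
    have hc := cosh_pos T
    have e1 : 1 + sinh T / cosh T = exp T / cosh T := by
      rw [← cosh_add_sinh]; field_simp
    have e2 : 1 - sinh T / cosh T = exp (-T) / cosh T := by
      rw [← cosh_sub_sinh]; field_simp
    rw [e1, e2, log_div (exp_pos _).ne' hc.ne', log_div (exp_pos _).ne' hc.ne', log_exp, log_exp]
    ring

lemma liouville {G H h : ℝ → ℝ}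
    (dG : ∀ θ ∈ Ioo (0 : ℝ) π, HasDerivAt G (H θ / sin θ) θ)
    (dH : ∀ θ ∈ Ioo (0 : ℝ) π, HasDerivAt H (h θ) θ)
    (h0 : ∀ θ ∈ Ioo (0 : ℝ) π, 0 ≤ h θ) {C : ℝ} (hb : ∀ θ ∈ Ioo (0 : ℝ) π, |G θ| ≤ C) :
    ∀ θ ∈ Ioo (0 : ℝ) π, H θ = 0 := by
  intro θ₀ hθ₀
  have monoH : MonotoneOn H (Ioo 0 π) := by
    refine monotoneOn_of_deriv_nonneg (convex_Ioo 0 π)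
      (fun x hx => (dH x hx).continuousAt.continuousWithinAt) ?_ ?_
    · rw [interior_Ioo]
      exact fun x hx => (dH x hx).differentiableAt.differentiableWithinAt
    · rw [interior_Ioo]
      intro x hx
      rw [(dH x hx).deriv]
      exact h0 x hx
  set k := H θ₀
  -- the convex function lies above its tangent
  have dK : ∀ θ ∈ Ioo (0 : ℝ) π,
      HasDerivAt (fun x => G x + k * tt x) ((H θ - k) / sin θ) θ := by
    intro θ hθ
    refine ((dG θ hθ).add ((hasDerivAt_tt hθ).const_mul k)).congr_deriv ?_
    ring
  have tang : ∀ θ ∈ Ioo (0 : ℝ) π, G θ₀ + k * tt θ₀ ≤ G θ + k * tt θ := by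
    intro θ hθ
    rcases le_total θ₀ θ with hle | hle
    · have hsub : Icc θ₀ θ ⊆ Ioo 0 π := fun z hz => ⟨hθ₀.1.trans_le hz.1, hz.2.trans_lt hθ.2⟩
      have : MonotoneOn (fun x => G x + k * tt x) (Icc θ₀ θ) := by
        refine monotoneOn_of_deriv_nonneg (convex_Icc _ _)
          (fun x hx => (dK x (hsub hx)).continuousAt.continuousWithinAt) ?_ ?_
        · exact fun x hx =>
            (dK x (hsub (interior_subset hx))).differentiableAt.differentiableWithinAt
        · intro x hx
          have hx' := interior_subset hx
          rw [(dK x (hsub hx')).deriv]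
          exact div_nonneg (sub_nonneg.2 (monoH hθ₀ (hsub hx') hx'.1)) (sin_pos_D (hsub hx')).le
      exact this (left_mem_Icc.2 hle) (right_mem_Icc.2 hle) hle
    · have hsub : Icc θ θ₀ ⊆ Ioo 0 π := fun z hz => ⟨hθ.1.trans_le hz.1, hz.2.trans_lt hθ₀.2⟩
      have : AntitoneOn (fun x => G x + k * tt x) (Icc θ θ₀) := by
        refine antitoneOn_of_deriv_nonpos (convex_Icc _ _)
          (fun x hx => (dK x (hsub hx)).continuousAt.continuousWithinAt) ?_ ?_
        · exact fun x hx =>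
            (dK x (hsub (interior_subset hx))).differentiableAt.differentiableWithinAt
        · intro x hx
          have hx' := interior_subset hx
          rw [(dK x (hsub hx')).deriv]
          exact div_nonpos_of_nonpos_of_nonneg (sub_nonpos.2 (monoH (hsub hx') hθ₀ hx'.2))
            (sin_pos_D (hsub hx')).le
      exact this (left_mem_Icc.2 hle) (right_mem_Icc.2 hle) hle
  by_contra hk
  obtain ⟨θ, hθ, ht⟩ := tt_surj (tt θ₀ - (2 * C + 1) / k)
  have := tang θ hθ
  rw [ht, mul_sub, mul_div_cancel₀ _ hk] at this
  have b1 := abs_le.1 (hb θ hθ)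
  have b2 := abs_le.1 (hb θ₀ hθ₀)
  linarith


/-! ### Hyperbolic plane algebra (Fermi coordinates along the geodesic from `-a` to `a`) -/

def Xr (a u v : ℝ) : ℝ := exp (2 * u) * (a - v ^ 2 / a) - exp (-(2 * u)) / (4 * a)
def kr (a u v : ℝ) : ℝ := exp (2 * u) * (a - v ^ 2 / a) + exp (-(2 * u)) / (4 * a)
def dX (a u v du dv : ℝ) : ℝ := 2 * kr a u v * du - 2 * exp (2 * u) * (v / a) * dv
def Jr (a u v du dv : ℝ) : ℝ := (v / a) * du + exp (2 * u) * kr a u v * dv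
def Pr (a u v : ℝ) : ℝ := exp (2 * u) * (a + v) ^ 2 / a + exp (-(2 * u)) / (4 * a)
def sr (a u v : ℝ) : ℝ := (1 / 4) * (log (Pr a u v) - log (Pr a u (-v)))

section
variable {a : ℝ}

lemma Pr_pos (ha : 0 < a) (u v : ℝ) : 0 < Pr a u v := by
  unfold Pr
  positivity

lemma exp4 (u : ℝ) : exp (4 * u) = exp (2 * u) ^ 2 := by
  rw [← exp_nat_mul]; congr 1; push_cast; ring

lemma PN_eq (ha : 0 < a) (u v : ℝ) : Pr a u v * Pr a u (-v) = 1 + Xr a u v ^ 2 := by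
  unfold Pr Xr
  rw [exp_neg]
  have hY := exp_pos (2 * u)
  generalize exp (2 * u) = Y at *
  field_simp
  ring

lemma K_eq (ha : 0 < a) (u v : ℝ) : (v / a) ^ 2 + kr a u v ^ 2 = 1 + Xr a u v ^ 2 := by
  unfold kr Xr
  rw [exp_neg]
  have hY := exp_pos (2 * u)
  generalize exp (2 * u) = Y at *
  field_simp
  ring

lemma e_mul (ha : 0 < a) (u v du dv : ℝ) : (1 + Xr a u v ^ 2) * (du ^ 2 + exp (4 * u) * dv ^ 2)
    = dX a u v du dv ^ 2 / 4 + Jr a u v du dv ^ 2 := by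
  rw [← K_eq ha, exp4]
  unfold dX Jr
  ring

lemma e_eq (ha : 0 < a) (u v du dv : ℝ) : du ^ 2 + exp (4 * u) * dv ^ 2
    = dX a u v du dv ^ 2 / (4 * (1 + Xr a u v ^ 2))
      + (1 + Xr a u v ^ 2) * (Jr a u v du dv / (1 + Xr a u v ^ 2)) ^ 2 := by
  have h := e_mul ha u v du dv
  have h1 : 0 < 1 + Xr a u v ^ 2 := by positivity
  field_simp
  linarith

/-- Cauchy-Schwarz for the tension field -/
lemma dX_sq_le (ha : 0 < a) (u v m1 m2 : ℝ) :
    dX a u v m1 m2 ^ 2 ≤ 4 * (1 + Xr a u v ^ 2) * (m1 ^ 2 + exp (4 * u) * m2 ^ 2) := by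
  have h := e_mul ha u v m1 m2
  nlinarith [sq_nonneg (Jr a u v m1 m2)]

lemma Jr_sq_le (ha : 0 < a) (u v m1 m2 : ℝ) :
    Jr a u v m1 m2 ^ 2 ≤ (1 + Xr a u v ^ 2) * (m1 ^ 2 + exp (4 * u) * m2 ^ 2) := by
  have h := e_mul ha u v m1 m2
  nlinarith [sq_nonneg (dX a u v m1 m2)]

lemma hasDerivAt_exp2 {f : ℝ → ℝ} {x f1 : ℝ} (hf : HasDerivAt f f1 x) :
    HasDerivAt (fun y => exp (2 * f y)) (exp (2 * f x) * (2 * f1)) x :=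
  (hf.const_mul 2).exp

lemma hasDerivAt_expn2 {f : ℝ → ℝ} {x f1 : ℝ} (hf : HasDerivAt f f1 x) :
    HasDerivAt (fun y => exp (-(2 * f y))) (exp (-(2 * f x)) * (-(2 * f1))) x :=
  (hf.const_mul 2).neg.exp

lemma hasDerivAt_Xr (ha : 0 < a) {f g : ℝ → ℝ} {x f1 g1 : ℝ} (hf : HasDerivAt f f1 x)
    (hg : HasDerivAt g g1 x) :
    HasDerivAt (fun y => Xr a (f y) (g y)) (dX a (f x) (g x) f1 g1) x := by
  have h := ((hasDerivAt_exp2 hf).mul (((hg.pow 2).div_const a).const_sub a)).sub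
    ((hasDerivAt_expn2 hf).div_const (4 * a))
  refine h.congr_deriv ?_
  simp only [dX, kr, Pi.pow_apply]
  rw [exp_neg]
  have hY := exp_pos (2 * f x)
  generalize exp (2 * f x) = Y at *
  field_simp
  push_cast
  ring

lemma hasDerivAt_kr (ha : 0 < a) {f g : ℝ → ℝ} {x f1 g1 : ℝ} (hf : HasDerivAt f f1 x)
    (hg : HasDerivAt g g1 x) :
    HasDerivAt (fun y => kr a (f y) (g y))
      (2 * Xr a (f x) (g x) * f1 - 2 * exp (2 * f x) * (g x / a) * g1) x := by
  have h := ((hasDerivAt_exp2 hf).mul (((hg.pow 2).div_const a).const_sub a)).add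
    ((hasDerivAt_expn2 hf).div_const (4 * a))
  refine h.congr_deriv ?_
  simp only [Xr, Pi.pow_apply]
  rw [exp_neg]
  have hY := exp_pos (2 * f x)
  generalize exp (2 * f x) = Y at *
  field_simp
  push_cast
  ring

lemma hasDerivAt_dX (ha : 0 < a) {f g f1 g1 : ℝ → ℝ} {x f11 g11 : ℝ} (hf : HasDerivAt f (f1 x) x)
    (hg : HasDerivAt g (g1 x) x) (hf1 : HasDerivAt f1 f11 x) (hg1 : HasDerivAt g1 g11 x) :
    HasDerivAt (fun y => dX a (f y) (g y) (f1 y) (g1 y))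
      (dX a (f x) (g x) (f11 - 2 * exp (4 * f x) * g1 x ^ 2) (g11 + 4 * f1 x * g1 x)
        + 4 * Xr a (f x) (g x) * (f1 x ^ 2 + exp (4 * f x) * g1 x ^ 2)) x := by
  have h := (((hasDerivAt_kr ha hf hg).const_mul 2).mul hf1).sub
    ((((hasDerivAt_exp2 hf).const_mul 2).mul (hg.div_const a)).mul hg1)
  refine h.congr_deriv ?_
  simp only [Pi.mul_apply, dX, Xr, kr, exp4]
  rw [exp_neg]
  have hY := exp_pos (2 * f x)
  generalize exp (2 * f x) = Y at *
  field_simp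
  ring

lemma hasDerivAt_Jr (ha : 0 < a) {f g f1 g1 : ℝ → ℝ} {x f11 g11 : ℝ} (hf : HasDerivAt f (f1 x) x)
    (hg : HasDerivAt g (g1 x) x) (hf1 : HasDerivAt f1 f11 x) (hg1 : HasDerivAt g1 g11 x) :
    HasDerivAt (fun y => Jr a (f y) (g y) (f1 y) (g1 y))
      (Jr a (f x) (g x) (f11 - 2 * exp (4 * f x) * g1 x ^ 2) (g11 + 4 * f1 x * g1 x)) x := by
  have h := ((hg.div_const a).mul hf1).add
    (((hasDerivAt_exp2 hf).mul (hasDerivAt_kr ha hf hg)).mul hg1)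
  refine h.congr_deriv ?_
  simp only [Pi.mul_apply, Jr, Xr, kr, exp4]
  rw [exp_neg]
  have hY := exp_pos (2 * f x)
  generalize exp (2 * f x) = Y at *
  field_simp
  ring

lemma hasDerivAt_Pr (ha : 0 < a) {f g : ℝ → ℝ} {x f1 g1 : ℝ} (hf : HasDerivAt f f1 x)
    (hg : HasDerivAt g g1 x) :
    HasDerivAt (fun y => Pr a (f y) (g y))
      ((2 * exp (2 * f x) * (a + g x) ^ 2 / a - exp (-(2 * f x)) / (2 * a)) * f1
        + 2 * exp (2 * f x) * (a + g x) / a * g1) x := by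
  have h := (((hasDerivAt_exp2 hf).mul ((hg.const_add a).pow 2)).div_const a).add
    ((hasDerivAt_expn2 hf).div_const (4 * a))
  refine h.congr_deriv ?_
  simp only [Pi.pow_apply]
  field_simp
  push_cast
  ring

lemma hasDerivAt_sr (ha : 0 < a) {f g : ℝ → ℝ} {x f1 g1 : ℝ} (hf : HasDerivAt f f1 x)
    (hg : HasDerivAt g g1 x) :
    HasDerivAt (fun y => sr a (f y) (g y))
      (Jr a (f x) (g x) f1 g1 / (1 + Xr a (f x) (g x) ^ 2)) x := by
  have hP := Pr_pos ha (f x) (g x)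
  have hN := Pr_pos ha (f x) (-g x)
  have h := (((hasDerivAt_Pr ha hf hg).log hP.ne').sub
    ((hasDerivAt_Pr ha hf hg.neg).log hN.ne')).const_mul (1 / 4 : ℝ)
  refine h.congr_deriv ?_
  rw [← PN_eq ha, div_sub_div _ _ hP.ne' (by exact hN.ne'), mul_div_assoc']
  congr 1
  simp only [Jr, kr, Pr, Pi.neg_apply]
  rw [exp_neg]
  have hY := exp_pos (2 * f x)
  generalize exp (2 * f x) = Y at *
  field_simp
  ring

lemma log_sub_le {A B m : ℝ} (hm : 0 < m) (hA : m ≤ A) (hB : m ≤ B) :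
    |log A - log B| ≤ |A - B| / m := by
  have hA0 := hm.trans_le hA
  have hB0 := hm.trans_le hB
  have key : ∀ x y : ℝ, m ≤ x → m ≤ y → log x - log y ≤ |x - y| / m := by
    intro x y hx hy
    have hx0 := hm.trans_le hx
    have hy0 := hm.trans_le hy
    rw [← log_div hx0.ne' hy0.ne']
    have h1 := log_le_sub_one_of_pos (div_pos hx0 hy0)
    have h2 : x / y - 1 = (x - y) / y := by field_simp
    calc log (x / y) ≤ (x - y) / y := by linarith
      _ ≤ |x - y| / y := by gcongr; exact le_abs_self _
      _ ≤ |x - y| / m := by gcongr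
  rw [abs_le]
  have h1 := key A B hA hB
  have h2 := key B A hB hA
  rw [abs_sub_comm] at h2
  constructor <;> linarith

/-- `s = ½ log P - ¼ log (1+X²)` -/
lemma sr_eq (ha : 0 < a) (u v : ℝ) : sr a u v = (1 / 2) * log (Pr a u v) - (1 / 4) * log (1 + Xr a u v ^ 2) := by
  rw [← PN_eq ha, log_mul (Pr_pos ha _ _).ne' (Pr_pos ha _ _).ne']
  unfold sr
  ring

lemma sr_neg (u v : ℝ) : sr a u (-v) = - sr a u v := by
  unfold sr
  rw [neg_neg]
  ring

lemma Xr_neg (u v : ℝ) : Xr a u (-v) = Xr a u v := by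
  unfold Xr
  rw [neg_sq]

end


/-! ### Flux identities -/

/-- a periodic function together with its first partial derivatives -/
structure Grad (g g1 g2 : ℝ → ℝ → ℝ) : Prop where
  per : ∀ θ φ : ℝ, g θ (φ + 2 * π) = g θ φ
  c0 : CD g
  c1 : CD g1
  c2 : CD g2
  d1 : ∀ θ ∈ Ioo (0 : ℝ) π, ∀ φ : ℝ, HasDerivAt (fun x => g x φ) (g1 θ φ) θ
  d2 : ∀ θ ∈ Ioo (0 : ℝ) π, ∀ φ : ℝ, HasDerivAt (fun x => g θ x) (g2 θ φ) φ

/-- a vector field together with the derivatives entering its divergence -/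
structure VF (V1 V2 V11 V22 : ℝ → ℝ → ℝ) : Prop where
  per : ∀ θ φ : ℝ, V2 θ (φ + 2 * π) = V2 θ φ
  c1 : CD V1
  c2 : CD V2
  c11 : CD V11
  c22 : CD V22
  d1 : ∀ θ ∈ Ioo (0 : ℝ) π, ∀ φ : ℝ, HasDerivAt (fun x => V1 x φ) (V11 θ φ) θ
  d2 : ∀ θ ∈ Ioo (0 : ℝ) π, ∀ φ : ℝ, HasDerivAt (fun x => V2 θ x) (V22 θ φ) φ

lemma sin_ne_D {θ : ℝ} (h : θ ∈ Ioo (0 : ℝ) π) : sin θ ≠ 0 := (sin_pos_D h).ne'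

lemma CD.sin_inv : CD (fun θ _ => (Real.sin θ)⁻¹) := CD.sin.inv (fun _ h _ => sin_ne_D h)

section flux
variable {g g1 g2 V1 V2 V11 V22 : ℝ → ℝ → ℝ}

lemma flux_dA (hg : Grad g g1 g2) (hV : VF V1 V2 V11 V22) :
    ∀ θ ∈ Ioo (0 : ℝ) π, ∀ φ : ℝ, HasDerivAt (fun x => g x φ * (sin x * V1 x φ))
      (g1 θ φ * (sin θ * V1 θ φ) + g θ φ * (cos θ * V1 θ φ + sin θ * V11 θ φ)) θ := by
  intro θ h φ
  exact (hg.d1 θ h φ).mul ((hasDerivAt_sin θ).mul (hV.d1 θ h φ))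

lemma flux_dB (hg : Grad g g1 g2) (hV : VF V1 V2 V11 V22) :
    ∀ θ ∈ Ioo (0 : ℝ) π, ∀ φ : ℝ, HasDerivAt (fun x => g θ x * V2 θ x * (sin θ)⁻¹)
      ((g2 θ φ * V2 θ φ + g θ φ * V22 θ φ) * (sin θ)⁻¹) φ := by
  intro θ h φ
  exact ((hg.d2 θ h φ).mul (hV.d2 θ h φ)).mul_const _

lemma flux_cA (hg : Grad g g1 g2) (hV : VF V1 V2 V11 V22) :
    CD (fun θ φ => g θ φ * (sin θ * V1 θ φ)) := hg.c0.mul (CD.sin.mul hV.c1)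

lemma flux_cA' (hg : Grad g g1 g2) (hV : VF V1 V2 V11 V22) :
    CD (fun θ φ => g1 θ φ * (sin θ * V1 θ φ) +
      g θ φ * (cos θ * V1 θ φ + sin θ * V11 θ φ)) :=
  (hg.c1.mul (CD.sin.mul hV.c1)).add (hg.c0.mul ((CD.cos.mul hV.c1).add (CD.sin.mul hV.c11)))

lemma flux_cB' (hg : Grad g g1 g2) (hV : VF V1 V2 V11 V22) :
    CD (fun θ φ => (g2 θ φ * V2 θ φ + g θ φ * V22 θ φ) * (sin θ)⁻¹) :=
  ((hg.c2.mul hV.c2).add (hg.c0.mul hV.c22)).mul CD.sin_inv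

lemma flux_alg {θ : ℝ} (h : θ ∈ Ioo (0 : ℝ) π) (g g1 g2 V1 V2 V11 V22 : ℝ) :
    sin θ * (g1 * V1 + (sin θ ^ 2)⁻¹ * (g2 * V2) +
      g * (V11 + cos θ / sin θ * V1 + (sin θ ^ 2)⁻¹ * V22))
    = g1 * (sin θ * V1) + g * (cos θ * V1 + sin θ * V11) + (g2 * V2 + g * V22) * (sin θ)⁻¹ := by
  have := sin_ne_D h
  field_simp
  ring

lemma flux_inn (hg : Grad g g1 g2) (hV : VF V1 V2 V11 V22) {F : ℝ → ℝ → ℝ}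
    (hF : ∀ θ ∈ Ioo (0 : ℝ) π, ∀ φ, F θ φ = g1 θ φ * V1 θ φ + (sin θ ^ 2)⁻¹ * (g2 θ φ * V2 θ φ) +
      g θ φ * (V11 θ φ + cos θ / sin θ * V1 θ φ + (sin θ ^ 2)⁻¹ * V22 θ φ))
    {θ : ℝ} (hθ : θ ∈ Ioo (0 : ℝ) π) :
    HasDerivAt (inn (fun θ φ => g θ φ * (sin θ * V1 θ φ))) (inn (fun θ φ => sin θ * F θ φ) θ) θ := by
  have h := hasDerivAt_inn (flux_cA hg hV) (flux_cA' hg hV) (flux_cB' hg hV) (flux_dA hg hV)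
    (flux_dB hg hV) (fun θ φ => by rw [hg.per, hV.per]) hθ
  convert h using 1
  unfold inn
  congr 1
  ext φ
  show sin θ * F θ φ = _
  rw [hF θ hθ, flux_alg hθ]

lemma flux_int (hg : Grad g g1 g2) (hV : VF V1 V2 V11 V22) {F : ℝ → ℝ → ℝ} (hFA : Adm F)
    (hF : ∀ θ ∈ Ioo (0 : ℝ) π, ∀ φ, F θ φ = g1 θ φ * V1 θ φ + (sin θ ^ 2)⁻¹ * (g2 θ φ * V2 θ φ) +
      g θ φ * (V11 θ φ + cos θ / sin θ * V1 θ φ + (sin θ ^ 2)⁻¹ * V22 θ φ))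
    {C : ℝ} (hb : ∀ θ ∈ Ioo (0 : ℝ) π, ∀ φ, |g θ φ * V1 θ φ| ≤ C) : sphInt F = 0 := by
  refine sphInt_div (C := C) (flux_cA hg hV) (flux_cA' hg hV) (flux_cB' hg hV) (flux_dA hg hV)
    (flux_dB hg hV) (fun θ φ => by rw [hg.per, hV.per]) hFA ?_ ?_
  · intro θ hθ φ
    rw [hF θ hθ, flux_alg hθ]
  · intro θ hθ φ
    have h1 := hb θ hθ φ
    have hs := sin_pos_D hθ
    calc |g θ φ * (sin θ * V1 θ φ)| = |g θ φ * V1 θ φ| * sin θ := by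
          rw [show g θ φ * (sin θ * V1 θ φ) = (g θ φ * V1 θ φ) * sin θ by ring, abs_mul,
            abs_of_pos hs]
      _ ≤ C * sin θ := by gcongr
end flux

/-! ### the map in Fermi coordinates -/

def M1 (u v : ℝ → ℝ → ℝ) (θ φ : ℝ) : ℝ :=
  lapS2 u θ φ - 2 * exp (4 * u θ φ) * gradNormSqS2 v θ φ
def M2 (u v : ℝ → ℝ → ℝ) (θ φ : ℝ) : ℝ := lapS2 v θ φ + 4 * gradDotS2 u v θ φ
def ee (u v : ℝ → ℝ → ℝ) (θ φ : ℝ) : ℝ :=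
  gradNormSqS2 u θ φ + exp (4 * u θ φ) * gradNormSqS2 v θ φ
def XX (a : ℝ) (u v : ℝ → ℝ → ℝ) (θ φ : ℝ) : ℝ := Xr a (u θ φ) (v θ φ)
def X1 (a : ℝ) (u v : ℝ → ℝ → ℝ) (θ φ : ℝ) : ℝ :=
  dX a (u θ φ) (v θ φ) (pdθ u θ φ) (pdθ v θ φ)
def X2 (a : ℝ) (u v : ℝ → ℝ → ℝ) (θ φ : ℝ) : ℝ :=
  dX a (u θ φ) (v θ φ) (pdφ u θ φ) (pdφ v θ φ)
def J1 (a : ℝ) (u v : ℝ → ℝ → ℝ) (θ φ : ℝ) : ℝ :=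
  Jr a (u θ φ) (v θ φ) (pdθ u θ φ) (pdθ v θ φ)
def J2 (a : ℝ) (u v : ℝ → ℝ → ℝ) (θ φ : ℝ) : ℝ :=
  Jr a (u θ φ) (v θ φ) (pdφ u θ φ) (pdφ v θ φ)
/-- deviation of the Fermi coordinate from the conformal coordinate -/
def sg (a : ℝ) (u v : ℝ → ℝ → ℝ) (θ φ : ℝ) : ℝ := sr a (u θ φ) (v θ φ) - tt θ
def S1 (a : ℝ) (u v : ℝ → ℝ → ℝ) (θ φ : ℝ) : ℝ :=
  J1 a u v θ φ / (1 + XX a u v θ φ ^ 2) + (sin θ)⁻¹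
def S2 (a : ℝ) (u v : ℝ → ℝ → ℝ) (θ φ : ℝ) : ℝ :=
  J2 a u v θ φ / (1 + XX a u v θ φ ^ 2)

section cdX
variable {a : ℝ} {u v du dv : ℝ → ℝ → ℝ}
lemma CD.Y (hu : CD u) : CD (fun θ φ => Real.exp (2 * u θ φ)) := ((CD.const 2).mul hu).exp
lemma CD.Yn (hu : CD u) : CD (fun θ φ => Real.exp (-(2 * u θ φ))) := ((CD.const 2).mul hu).neg.exp
lemma CD.Xr (ha : 0 < a) (hu : CD u) (hv : CD v) : CD (fun θ φ => Xr a (u θ φ) (v θ φ)) :=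
  (hu.Y.mul ((CD.const a).sub ((hv.pow 2).div (CD.const a) (fun _ _ _ => ha.ne')))).sub
    (hu.Yn.div (CD.const (4 * a)) (fun _ _ _ => (by positivity)))
lemma CD.kr (ha : 0 < a) (hu : CD u) (hv : CD v) : CD (fun θ φ => kr a (u θ φ) (v θ φ)) :=
  (hu.Y.mul ((CD.const a).sub ((hv.pow 2).div (CD.const a) (fun _ _ _ => ha.ne')))).add
    (hu.Yn.div (CD.const (4 * a)) (fun _ _ _ => (by positivity)))
lemma CD.dX (ha : 0 < a) (hu : CD u) (hv : CD v) (hdu : CD du) (hdv : CD dv) :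
    CD (fun θ φ => dX a (u θ φ) (v θ φ) (du θ φ) (dv θ φ)) :=
  (((CD.const 2).mul (CD.kr ha hu hv)).mul hdu).sub
    ((((CD.const 2).mul hu.Y).mul (hv.div (CD.const a) (fun _ _ _ => ha.ne'))).mul hdv)
lemma CD.Jr (ha : 0 < a) (hu : CD u) (hv : CD v) (hdu : CD du) (hdv : CD dv) :
    CD (fun θ φ => Jr a (u θ φ) (v θ φ) (du θ φ) (dv θ φ)) :=
  ((hv.div (CD.const a) (fun _ _ _ => ha.ne')).mul hdu).add
    ((hu.Y.mul (CD.kr ha hu hv)).mul hdv)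
lemma CD.Pr (ha : 0 < a) (hu : CD u) (hv : CD v) : CD (fun θ φ => Pr a (u θ φ) (v θ φ)) :=
  ((hu.Y.mul (((CD.const a).add hv).pow 2)).div (CD.const a) (fun _ _ _ => ha.ne')).add
    (hu.Yn.div (CD.const (4 * a)) (fun _ _ _ => (by positivity)))
lemma CD.sr (ha : 0 < a) (hu : CD u) (hv : CD v) : CD (fun θ φ => sr a (u θ φ) (v θ φ)) :=
  (CD.const (1 / 4)).mul (((CD.Pr ha hu hv).log (fun _ _ _ => (Pr_pos ha _ _).ne')).sub
    ((CD.Pr ha hu hv.neg).log (fun _ _ _ => (Pr_pos ha _ _).ne')))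
lemma CD.tt : CD (fun θ _ => tt θ) :=
  CD.of_θ (fun θ hθ => (hasDerivAt_tt hθ).continuousAt.continuousWithinAt)
lemma CD.e4 (hu : CD u) : CD (fun θ φ => Real.exp (4 * u θ φ)) := ((CD.const 4).mul hu).exp
lemma CD.sinv2 : CD (fun θ _ => (Real.sin θ ^ 2)⁻¹) :=
  (CD.sin.pow 2).inv (fun _ h _ => pow_ne_zero 2 (sin_ne_D h))
lemma CD.cot : CD (fun θ _ => Real.cos θ / Real.sin θ) := CD.cos.div CD.sin (fun _ h _ => sin_ne_D h)
lemma R2.cgd (hu : R2 u) (hv : R2 v) : CD (gradDotS2 u v) :=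
  (hu.c1.mul hv.c1).add ((CD.sinv2.mul hu.c2).mul hv.c2)
lemma R2.cg (hu : R2 u) : CD (gradNormSqS2 u) := hu.cgd hu
lemma R2.clap (hu : R2 u) : CD (lapS2 u) :=
  (hu.c11.add (CD.cot.mul hu.c1)).add (CD.sinv2.mul hu.c22)
lemma CD.M1 (hu : R2 u) (hv : R2 v) : CD (M1 u v) :=
  hu.clap.sub (((CD.const 2).mul hu.c0.e4).mul hv.cg)
lemma CD.M2 (hu : R2 u) (hv : R2 v) : CD (M2 u v) := hv.clap.add ((CD.const 4).mul (hu.cgd hv))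
lemma CD.ee (hu : R2 u) (hv : R2 v) : CD (ee u v) := hu.cg.add (hu.c0.e4.mul hv.cg)
end cdX

section maps
variable {a : ℝ} {u v : ℝ → ℝ → ℝ}

lemma XX_grad (ha : 0 < a) (hu : R2 u) (hv : R2 v) : Grad (XX a u v) (X1 a u v) (X2 a u v) where
  per θ φ := by simp only [XX, hu.per, hv.per]
  c0 := CD.Xr ha hu.c0 hv.c0
  c1 := CD.dX ha hu.c0 hv.c0 hu.c1 hv.c1
  c2 := CD.dX ha hu.c0 hv.c0 hu.c2 hv.c2
  d1 θ h φ := hasDerivAt_Xr ha (hu.d1 θ h φ) (hv.d1 θ h φ)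
  d2 θ h φ := hasDerivAt_Xr ha (hu.d2 θ h φ) (hv.d2 θ h φ)

def X11 (a : ℝ) (u v : ℝ → ℝ → ℝ) (θ φ : ℝ) : ℝ :=
  dX a (u θ φ) (v θ φ) (pdθ (pdθ u) θ φ - 2 * exp (4 * u θ φ) * pdθ v θ φ ^ 2)
      (pdθ (pdθ v) θ φ + 4 * pdθ u θ φ * pdθ v θ φ)
    + 4 * Xr a (u θ φ) (v θ φ) * (pdθ u θ φ ^ 2 + exp (4 * u θ φ) * pdθ v θ φ ^ 2)
def X22 (a : ℝ) (u v : ℝ → ℝ → ℝ) (θ φ : ℝ) : ℝ :=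
  dX a (u θ φ) (v θ φ) (pdφ (pdφ u) θ φ - 2 * exp (4 * u θ φ) * pdφ v θ φ ^ 2)
      (pdφ (pdφ v) θ φ + 4 * pdφ u θ φ * pdφ v θ φ)
    + 4 * Xr a (u θ φ) (v θ φ) * (pdφ u θ φ ^ 2 + exp (4 * u θ φ) * pdφ v θ φ ^ 2)
def J11 (a : ℝ) (u v : ℝ → ℝ → ℝ) (θ φ : ℝ) : ℝ :=
  Jr a (u θ φ) (v θ φ) (pdθ (pdθ u) θ φ - 2 * exp (4 * u θ φ) * pdθ v θ φ ^ 2)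
      (pdθ (pdθ v) θ φ + 4 * pdθ u θ φ * pdθ v θ φ)
def J22 (a : ℝ) (u v : ℝ → ℝ → ℝ) (θ φ : ℝ) : ℝ :=
  Jr a (u θ φ) (v θ φ) (pdφ (pdφ u) θ φ - 2 * exp (4 * u θ φ) * pdφ v θ φ ^ 2)
      (pdφ (pdφ v) θ φ + 4 * pdφ u θ φ * pdφ v θ φ)

lemma cd_second2 {u1 v1 v11 : ℝ → ℝ → ℝ} (hu1 : CD u1) (hv1 : CD v1)
    (hv11 : CD v11) : CD (fun θ φ => v11 θ φ + 4 * u1 θ φ * v1 θ φ) :=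
  hv11.add (((CD.const 4).mul hu1).mul hv1)
lemma cd_second3 {u u1 v v1 : ℝ → ℝ → ℝ} (ha : 0 < a) (hu : CD u) (hv : CD v) (hu1 : CD u1)
    (hv1 : CD v1) : CD (fun θ φ => 4 * Xr a (u θ φ) (v θ φ) *
      (u1 θ φ ^ 2 + exp (4 * u θ φ) * v1 θ φ ^ 2)) :=
  ((CD.const 4).mul (CD.Xr ha hu hv)).mul ((hu1.pow 2).add (hu.e4.mul (hv1.pow 2)))

lemma XX_VF (ha : 0 < a) (hu : R2 u) (hv : R2 v) :
    VF (X1 a u v) (X2 a u v) (X11 a u v) (X22 a u v) where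
  per θ φ := by simp only [X2, hu.per, hv.per, per_pdφ hu.per, per_pdφ hv.per]
  c1 := (XX_grad ha hu hv).c1
  c2 := (XX_grad ha hu hv).c2
  c11 := (CD.dX ha hu.c0 hv.c0 (hu.c11.sub (((CD.const 2).mul hu.c0.e4).mul (hv.c1.pow 2)))
    (cd_second2 hu.c1 hv.c1 hv.c11)).add (cd_second3 ha hu.c0 hv.c0 hu.c1 hv.c1)
  c22 := (CD.dX ha hu.c0 hv.c0 (hu.c22.sub (((CD.const 2).mul hu.c0.e4).mul (hv.c2.pow 2)))
    (cd_second2 hu.c2 hv.c2 hv.c22)).add (cd_second3 ha hu.c0 hv.c0 hu.c2 hv.c2)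
  d1 θ h φ := hasDerivAt_dX (f := fun x => u x φ) (g := fun x => v x φ)
    (f1 := fun x => pdθ u x φ) (g1 := fun x => pdθ v x φ) ha (hu.d1 θ h φ) (hv.d1 θ h φ)
    (hu.d11 θ h φ) (hv.d11 θ h φ)
  d2 θ h φ := hasDerivAt_dX (f := fun x => u θ x) (g := fun x => v θ x)
    (f1 := fun x => pdφ u θ x) (g1 := fun x => pdφ v θ x) ha (hu.d2 θ h φ) (hv.d2 θ h φ)
    (hu.d22 θ h φ) (hv.d22 θ h φ)

/-- the divergence of `∇X` -/
lemma XX_div (a : ℝ) (u v : ℝ → ℝ → ℝ) (θ φ : ℝ) :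
    X11 a u v θ φ + cos θ / sin θ * X1 a u v θ φ + (sin θ ^ 2)⁻¹ * X22 a u v θ φ
    = dX a (u θ φ) (v θ φ) (M1 u v θ φ) (M2 u v θ φ) + 4 * ee u v θ φ * XX a u v θ φ := by
  unfold X11 X22 X1 dX XX M1 M2 ee lapS2 gradNormSqS2 gradDotS2
  ring

lemma hasDerivAt_sin_inv {θ : ℝ} (h : θ ∈ Ioo (0 : ℝ) π) :
    HasDerivAt (fun x => (sin x)⁻¹) (-(cos θ / sin θ ^ 2)) θ := by
  have := (hasDerivAt_sin θ).inv (sin_ne_D h)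
  refine this.congr_deriv ?_
  ring

lemma J_VF (ha : 0 < a) (hu : R2 u) (hv : R2 v) :
    VF (fun θ φ => J1 a u v θ φ + (sin θ)⁻¹) (J2 a u v)
      (fun θ φ => J11 a u v θ φ - cos θ / sin θ ^ 2) (J22 a u v) where
  per θ φ := by simp only [J2, hu.per, hv.per, per_pdφ hu.per, per_pdφ hv.per]
  c1 := (CD.Jr ha hu.c0 hv.c0 hu.c1 hv.c1).add CD.sin_inv
  c2 := CD.Jr ha hu.c0 hv.c0 hu.c2 hv.c2
  c11 := (CD.Jr ha hu.c0 hv.c0 (hu.c11.sub (((CD.const 2).mul hu.c0.e4).mul (hv.c1.pow 2)))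
    (cd_second2 hu.c1 hv.c1 hv.c11)).sub
    (CD.cos.div (CD.sin.pow 2) (fun _ h _ => pow_ne_zero 2 (sin_ne_D h)))
  c22 := (CD.Jr ha hu.c0 hv.c0 (hu.c22.sub (((CD.const 2).mul hu.c0.e4).mul (hv.c2.pow 2)))
    (cd_second2 hu.c2 hv.c2 hv.c22))
  d1 θ h φ := by
    refine ((hasDerivAt_Jr (f := fun x => u x φ) (g := fun x => v x φ)
      (f1 := fun x => pdθ u x φ) (g1 := fun x => pdθ v x φ) ha (hu.d1 θ h φ) (hv.d1 θ h φ)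
      (hu.d11 θ h φ) (hv.d11 θ h φ)).add (hasDerivAt_sin_inv h)).congr_deriv ?_
    simp only [J11]
    ring
  d2 θ h φ := hasDerivAt_Jr (f := fun x => u θ x) (g := fun x => v θ x)
    (f1 := fun x => pdφ u θ x) (g1 := fun x => pdφ v θ x) ha (hu.d2 θ h φ) (hv.d2 θ h φ)
    (hu.d22 θ h φ) (hv.d22 θ h φ)

lemma J_div (a : ℝ) (u v : ℝ → ℝ → ℝ) (θ φ : ℝ) :
    (J11 a u v θ φ - cos θ / sin θ ^ 2) + cos θ / sin θ * (J1 a u v θ φ + (sin θ)⁻¹)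
      + (sin θ ^ 2)⁻¹ * J22 a u v θ φ
    = Jr a (u θ φ) (v θ φ) (M1 u v θ φ) (M2 u v θ φ) := by
  unfold J11 J22 J1 Jr M1 M2 lapS2 gradNormSqS2 gradDotS2
  ring

lemma sg_grad (ha : 0 < a) (hu : R2 u) (hv : R2 v) (c : ℝ) :
    Grad (fun θ φ => sg a u v θ φ - c) (S1 a u v) (S2 a u v) where
  per θ φ := by simp only [sg, hu.per, hv.per]
  c0 := ((CD.sr ha hu.c0 hv.c0).sub CD.tt).sub (CD.const c)
  c1 := ((CD.Jr ha hu.c0 hv.c0 hu.c1 hv.c1).div ((CD.const 1).add ((CD.Xr ha hu.c0 hv.c0).pow 2))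
    (fun _ _ _ => by positivity)).add CD.sin_inv
  c2 := ((CD.Jr ha hu.c0 hv.c0 hu.c2 hv.c2).div ((CD.const 1).add ((CD.Xr ha hu.c0 hv.c0).pow 2))
    (fun _ _ _ => by positivity))
  d1 θ h φ := by
    refine (((hasDerivAt_sr ha (hu.d1 θ h φ) (hv.d1 θ h φ)).sub (hasDerivAt_tt h)).sub_const
      c).congr_deriv ?_
    simp only [S1, J1, XX]
    ring
  d2 θ h φ := ((hasDerivAt_sr ha (hu.d2 θ h φ) (hv.d2 θ h φ)).sub_const (tt θ)).sub_const c

/-- energy density in Fermi coordinates -/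
lemma ee_eq (ha : 0 < a) (u v : ℝ → ℝ → ℝ) (θ φ : ℝ) :
    ee u v θ φ = (X1 a u v θ φ ^ 2 + (sin θ ^ 2)⁻¹ * X2 a u v θ φ ^ 2)
        / (4 * (1 + XX a u v θ φ ^ 2))
      + (1 + XX a u v θ φ ^ 2) *
        ((S1 a u v θ φ - (sin θ)⁻¹) ^ 2 + (sin θ ^ 2)⁻¹ * S2 a u v θ φ ^ 2) := by
  have h1 := e_eq ha (u θ φ) (v θ φ) (pdθ u θ φ) (pdθ v θ φ)
  have h2 := e_eq ha (u θ φ) (v θ φ) (pdφ u θ φ) (pdφ v θ φ)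
  have : ee u v θ φ = (pdθ u θ φ ^ 2 + exp (4 * u θ φ) * pdθ v θ φ ^ 2)
    + (sin θ ^ 2)⁻¹ * (pdφ u θ φ ^ 2 + exp (4 * u θ φ) * pdφ v θ φ ^ 2) := by
    unfold ee gradNormSqS2 gradDotS2
    ring
  rw [this, h1, h2]
  simp only [X1, X2, S1, S2, J1, J2, XX, add_sub_cancel_right]
  ring
end maps


/-! ### The main integral estimate -/

lemma Adm.of_bdd {F : ℝ → ℝ → ℝ} (hF : CD F) {C : ℝ}
    (h : ∀ θ ∈ Ioo (0 : ℝ) π, ∀ φ, |F θ φ| ≤ C) : Adm F := by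
  refine ⟨hF, C, fun θ hθ φ => ?_⟩
  have h1 := sin_pos_D hθ
  have h2 := sin_le_one θ
  nlinarith [h θ hθ φ, abs_nonneg (F θ φ)]

lemma Adm.of_le {F G : ℝ → ℝ → ℝ} (hF : CD F) (hG : Adm G)
    (h : ∀ θ ∈ Ioo (0 : ℝ) π, ∀ φ, |F θ φ| ≤ G θ φ) : Adm F := by
  obtain ⟨C, hC⟩ := hG.bd
  refine ⟨hF, C, fun θ hθ φ => ?_⟩
  have h1 := sin_pos_D hθ
  have h2 := hC θ hθ φ
  have h3 := h θ hθ φ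
  have h4 := le_abs_self (G θ φ)
  nlinarith

def gX (a : ℝ) (u v : ℝ → ℝ → ℝ) (θ φ : ℝ) : ℝ :=
  X1 a u v θ φ ^ 2 + (sin θ ^ 2)⁻¹ * X2 a u v θ φ ^ 2
def gS (a : ℝ) (u v : ℝ → ℝ → ℝ) (θ φ : ℝ) : ℝ :=
  S1 a u v θ φ ^ 2 + (sin θ ^ 2)⁻¹ * S2 a u v θ φ ^ 2
def QQ (a : ℝ) (u v : ℝ → ℝ → ℝ) (θ φ : ℝ) : ℝ :=
  ee u v θ φ + 2 * S1 a u v θ φ * (sin θ)⁻¹ - (sin θ ^ 2)⁻¹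

section
variable {a : ℝ} {u v : ℝ → ℝ → ℝ}

lemma ee_ge (ha : 0 < a) {θ : ℝ} (hθ : θ ∈ Ioo (0 : ℝ) π) {φ : ℝ} (h : gS a u v θ φ ≤ 1 / 4) :
    1 / 4 * (sin θ ^ 2)⁻¹ ≤ ee u v θ φ := by
  have hs := sin_pos_D hθ
  have hi : 1 ≤ (sin θ)⁻¹ := one_le_inv_iff₀.2 ⟨hs, sin_le_one θ⟩
  rw [ee_eq ha]
  have h1 : 0 ≤ (X1 a u v θ φ ^ 2 + (sin θ ^ 2)⁻¹ * X2 a u v θ φ ^ 2)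
        / (4 * (1 + XX a u v θ φ ^ 2)) := by positivity
  have h2 : 0 ≤ (sin θ ^ 2)⁻¹ * S2 a u v θ φ ^ 2 := by positivity
  have h3 : S1 a u v θ φ ≤ 1 / 2 := by
    unfold gS at h
    nlinarith
  have h4 : 1 / 4 * (sin θ ^ 2)⁻¹ ≤ (S1 a u v θ φ - (sin θ)⁻¹) ^ 2 := by
    rw [← inv_pow]
    nlinarith
  have h5 : 0 ≤ XX a u v θ φ ^ 2 * ((S1 a u v θ φ - (sin θ)⁻¹) ^ 2 +
    (sin θ ^ 2)⁻¹ * S2 a u v θ φ ^ 2) := by positivity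
  nlinarith

lemma QQ_eq (ha : 0 < a) (θ φ : ℝ) :
    QQ a u v θ φ = gX a u v θ φ / (4 * (1 + XX a u v θ φ ^ 2))
      + XX a u v θ φ ^ 2 *
        ((S1 a u v θ φ - (sin θ)⁻¹) ^ 2 + (sin θ ^ 2)⁻¹ * S2 a u v θ φ ^ 2)
      + gS a u v θ φ := by
  unfold QQ gS gX
  rw [ee_eq ha, ← inv_pow]
  ring

lemma QQ_nonneg (ha : 0 < a) (θ φ : ℝ) : 0 ≤ QQ a u v θ φ := by
  rw [QQ_eq ha]
  unfold gX gS
  positivity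

lemma grad_le_ee (ha : 0 < a) (θ φ : ℝ) :
    (S1 a u v θ φ - (sin θ)⁻¹) ^ 2 + (sin θ ^ 2)⁻¹ * S2 a u v θ φ ^ 2 ≤ ee u v θ φ := by
  rw [ee_eq ha]
  have h1 : 0 ≤ (X1 a u v θ φ ^ 2 + (sin θ ^ 2)⁻¹ * X2 a u v θ φ ^ 2)
        / (4 * (1 + XX a u v θ φ ^ 2)) := by positivity
  have h2 : 0 ≤ XX a u v θ φ ^ 2 *
        ((S1 a u v θ φ - (sin θ)⁻¹) ^ 2 + (sin θ ^ 2)⁻¹ * S2 a u v θ φ ^ 2) := by positivity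
  linarith

lemma QQ_le (ha : 0 < a) (θ φ : ℝ) :
    QQ a u v θ φ ≤ 1 / 2 * (gX a u v θ φ + 2 * (ee u v θ φ * XX a u v θ φ ^ 2))
      + gS a u v θ φ := by
  rw [QQ_eq ha]
  have h0 : 0 ≤ gX a u v θ φ := by unfold gX; positivity
  have h1 : gX a u v θ φ / (4 * (1 + XX a u v θ φ ^ 2)) ≤ 1 / 2 * gX a u v θ φ := by
    rw [div_le_iff₀ (by positivity)]
    nlinarith [mul_nonneg h0 (sq_nonneg (XX a u v θ φ))]
  have h2 := mul_le_mul_of_nonneg_left (grad_le_ee (u := u) (v := v) ha θ φ)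
    (sq_nonneg (XX a u v θ φ))
  linarith

lemma ee_le (ha : 0 < a) {B : ℝ} {θ φ : ℝ} (hgX : gX a u v θ φ ≤ B) (hgS : gS a u v θ φ ≤ 1 / 4)
    (hX1 : |XX a u v θ φ| ≤ 1) :
    ee u v θ φ ≤ B + 1 + 4 * (sin θ ^ 2)⁻¹ := by
  rw [ee_eq ha]
  have hx : XX a u v θ φ ^ 2 ≤ 1 := (sq_le_one_iff_abs_le_one _).2 hX1
  have h0 : 0 ≤ gX a u v θ φ := by unfold gX; positivity
  have h1 : gX a u v θ φ / (4 * (1 + XX a u v θ φ ^ 2)) ≤ gX a u v θ φ := by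
    rw [div_le_iff₀ (by positivity)]
    nlinarith [mul_nonneg h0 (sq_nonneg (XX a u v θ φ))]
  have h2 : (S1 a u v θ φ - (sin θ)⁻¹) ^ 2 + (sin θ ^ 2)⁻¹ * S2 a u v θ φ ^ 2
     ≤ 1 / 2 + 2 * (sin θ ^ 2)⁻¹ := by
    have : 0 ≤ (sin θ ^ 2)⁻¹ * S2 a u v θ φ ^ 2 := by positivity
    unfold gS at hgS
    rw [← inv_pow] at *
    nlinarith [sq_nonneg (S1 a u v θ φ + (sin θ)⁻¹)]
  have h3 : 0 ≤ (S1 a u v θ φ - (sin θ)⁻¹) ^ 2 + (sin θ ^ 2)⁻¹ * S2 a u v θ φ ^ 2 := by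
    positivity
  unfold gX at h1 hgX h0
  nlinarith

lemma main_est (ha : 0 < a) (hu : R2 u) (hv : R2 v) {B K : ℝ} {m : ℝ → ℝ → ℝ} (hB : 0 ≤ B)
    (hm : Adm m)
    (hmm : ∀ θ ∈ Ioo (0 : ℝ) π, ∀ φ,
      M1 u v θ φ ^ 2 + exp (4 * u θ φ) * M2 u v θ φ ^ 2 ≤ K * m θ φ)
    (hX1 : ∀ θ ∈ Ioo (0 : ℝ) π, ∀ φ, |XX a u v θ φ| ≤ 1)
    (hXs : ∀ θ ∈ Ioo (0 : ℝ) π, ∀ φ, |XX a u v θ φ| ≤ B * sin θ)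
    (hgX : ∀ θ ∈ Ioo (0 : ℝ) π, ∀ φ, gX a u v θ φ ≤ B)
    (hgS : ∀ θ ∈ Ioo (0 : ℝ) π, ∀ φ, gS a u v θ φ ≤ 1 / 4)
    (hσ : ∀ θ ∈ Ioo (0 : ℝ) π, ∀ φ, |sg a u v θ φ| ≤ B) :
    Adm (QQ a u v) ∧ sphInt (QQ a u v) ≤ (18 + 36 * π ^ 2) * K * sphInt m := by
  have hgr := XX_grad ha hu hv
  have cgX : CD (gX a u v) := (hgr.c1.pow 2).add (CD.sinv2.mul (hgr.c2.pow 2))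
  have hgs := sg_grad ha hu hv 0
  have cgS : CD (gS a u v) := (hgs.c1.pow 2).add (CD.sinv2.mul (hgs.c2.pow 2))
  have ngX : ∀ θ φ, 0 ≤ gX a u v θ φ := fun θ φ => by unfold gX; positivity
  have ngS : ∀ θ φ, 0 ≤ gS a u v θ φ := fun θ φ => by unfold gS; positivity
  have aX : Adm (gX a u v) := Adm.of_bdd cgX
    (fun θ hθ φ => by rw [abs_of_nonneg (ngX θ φ)]; exact hgX θ hθ φ)
  have aS : Adm (gS a u v) := Adm.of_bdd cgS
    (fun θ hθ φ => by rw [abs_of_nonneg (ngS θ φ)]; exact hgS θ hθ φ)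
  have xle : ∀ θ ∈ Ioo (0 : ℝ) π, ∀ φ, XX a u v θ φ ^ 2 ≤ 1 :=
    fun θ hθ φ => (sq_le_one_iff_abs_le_one _).2 (hX1 θ hθ φ)
  have xles : ∀ θ ∈ Ioo (0 : ℝ) π, ∀ φ, (sin θ ^ 2)⁻¹ * XX a u v θ φ ^ 2 ≤ B ^ 2 := by
    intro θ hθ φ
    have hs := sin_pos_D hθ
    rw [inv_mul_le_iff₀ (by positivity), ← sq_abs, ← mul_pow, mul_comm]
    gcongr
    exact hXs θ hθ φ
  have eX : ∀ θ ∈ Ioo (0 : ℝ) π, ∀ φ, (sin θ ^ 2)⁻¹ * XX a u v θ φ ^ 2 ≤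
      4 * (ee u v θ φ * XX a u v θ φ ^ 2) := by
    intro θ hθ φ
    have := mul_le_mul_of_nonneg_right (ee_ge ha hθ (hgS θ hθ φ)) (sq_nonneg (XX a u v θ φ))
    linarith
  have isin : ∀ θ ∈ Ioo (0 : ℝ) π, 1 ≤ (sin θ ^ 2)⁻¹ := by
    intro θ hθ
    have hs := sin_pos_D hθ
    rw [one_le_inv₀ (by positivity)]
    nlinarith [sin_le_one θ]
  have nee : ∀ θ φ, 0 ≤ ee u v θ φ := by
    intro θ φ
    rw [ee_eq ha]
    positivity
  have ceX : CD (fun θ φ => ee u v θ φ * XX a u v θ φ ^ 2) := (CD.ee hu hv).mul (hgr.c0.pow 2)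
  have aeX : Adm (fun θ φ => ee u v θ φ * XX a u v θ φ ^ 2) := by
    refine Adm.of_bdd (C := B + 1 + 4 * B ^ 2) ceX (fun θ hθ φ => ?_)
    rw [abs_of_nonneg (mul_nonneg (nee _ _) (sq_nonneg _))]
    have h1 := ee_le ha (hgX θ hθ φ) (hgS θ hθ φ) (hX1 θ hθ φ)
    have h2 := mul_le_mul_of_nonneg_right h1 (sq_nonneg (XX a u v θ φ))
    nlinarith [xles θ hθ φ, xle θ hθ φ]
  have dXM : ∀ θ ∈ Ioo (0 : ℝ) π, ∀ φ,
      dX a (u θ φ) (v θ φ) (M1 u v θ φ) (M2 u v θ φ) ^ 2 ≤ 8 * K * m θ φ := by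
    intro θ hθ φ
    have h1 := dX_sq_le ha (u θ φ) (v θ φ) (M1 u v θ φ) (M2 u v θ φ)
    have h2 := xle θ hθ φ
    have h3 := hmm θ hθ φ
    have h4 : 0 ≤ M1 u v θ φ ^ 2 + exp (4 * u θ φ) * M2 u v θ φ ^ 2 := by positivity
    unfold XX at h2
    nlinarith
  have JM : ∀ θ ∈ Ioo (0 : ℝ) π, ∀ φ,
      Jr a (u θ φ) (v θ φ) (M1 u v θ φ) (M2 u v θ φ) ^ 2 ≤ 2 * K * m θ φ := by
    intro θ hθ φ
    have h1 := Jr_sq_le ha (u θ φ) (v θ φ) (M1 u v θ φ) (M2 u v θ φ)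
    have h2 := xle θ hθ φ
    have h3 := hmm θ hθ φ
    have h4 : 0 ≤ M1 u v θ φ ^ 2 + exp (4 * u θ φ) * M2 u v θ φ ^ 2 := by positivity
    unfold XX at h2
    nlinarith
  have cdXM : CD (fun θ φ => dX a (u θ φ) (v θ φ) (M1 u v θ φ) (M2 u v θ φ)) :=
    CD.dX ha hu.c0 hv.c0 (CD.M1 hu hv) (CD.M2 hu hv)
  have cJM : CD (fun θ φ => Jr a (u θ φ) (v θ φ) (M1 u v θ φ) (M2 u v θ φ)) :=
    CD.Jr ha hu.c0 hv.c0 (CD.M1 hu hv) (CD.M2 hu hv)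
  -- step 1
  have step1 : sphInt (fun θ φ => gX a u v θ φ + 2 * (ee u v θ φ * XX a u v θ φ ^ 2))
      ≤ 4 * K * sphInt m := by
    set T : ℝ → ℝ → ℝ := fun θ φ =>
      XX a u v θ φ * dX a (u θ φ) (v θ φ) (M1 u v θ φ) (M2 u v θ φ) with hT
    have aT : Adm T := by
      refine Adm.of_le (hgr.c0.mul cdXM)
        ((Adm.of_bdd (CD.const 1) (C := 1) (fun _ _ _ => by simp)).add (hm.smul (4 * K))) ?_
      intro θ hθ φ
      have h1 := dXM θ hθ φ
      have h2 := xle θ hθ φ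
      show |XX a u v θ φ * dX a (u θ φ) (v θ φ) (M1 u v θ φ) (M2 u v θ φ)| ≤ _
      rw [abs_le]
      constructor <;> nlinarith [sq_nonneg (XX a u v θ φ - dX a (u θ φ) (v θ φ) (M1 u v θ φ) (M2 u v θ φ)), sq_nonneg (XX a u v θ φ + dX a (u θ φ) (v θ φ) (M1 u v θ φ) (M2 u v θ φ))]
    have aF : Adm (fun θ φ => gX a u v θ φ + 4 * (ee u v θ φ * XX a u v θ φ ^ 2) + T θ φ) :=
      (aX.add (aeX.smul 4)).add aT
    have h0 := flux_int hgr (XX_VF ha hu hv) aF (C := 1 + B) (by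
      intro θ hθ φ
      rw [XX_div]
      simp only [hT, gX]
      ring) (by
      intro θ hθ φ
      have h1 : X1 a u v θ φ ^ 2 ≤ B := by
        have := hgX θ hθ φ
        unfold gX at this
        have h2 : 0 ≤ (sin θ ^ 2)⁻¹ * X2 a u v θ φ ^ 2 := by positivity
        linarith
      have h2 := xle θ hθ φ
      rw [abs_le]
      constructor <;> nlinarith [sq_nonneg (XX a u v θ φ - X1 a u v θ φ), sq_nonneg (XX a u v θ φ + X1 a u v θ φ)])
    have h1 : sphInt (fun θ φ => gX a u v θ φ + 2 * (ee u v θ φ * XX a u v θ φ ^ 2)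
        - (4 * K) * m θ φ) ≤ 0 := by
      rw [← h0]
      refine sphInt_mono ((aX.add (aeX.smul 2)).sub (hm.smul _)) aF ?_
      intro θ hθ φ
      have h1 := dXM θ hθ φ
      have h2 := eX θ hθ φ
      have h3 := isin θ hθ
      have h4 : XX a u v θ φ ^ 2 ≤ (sin θ ^ 2)⁻¹ * XX a u v θ φ ^ 2 :=
        le_mul_of_one_le_left (sq_nonneg _) h3
      simp only [hT]
      nlinarith [sq_nonneg (XX a u v θ φ + dX a (u θ φ) (v θ φ) (M1 u v θ φ) (M2 u v θ φ))]
    rw [sphInt_sub (aX.add (aeX.smul 2)) (hm.smul _), sphInt_smul] at h1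
    linarith
  -- step 2
  have step2 : sphInt (gS a u v) ≤ (16 + 36 * π ^ 2) * K * sphInt m := by
    obtain ⟨c, aσ, hc⟩ := poincare hgs.c0 hgs.c1 hgs.c2 hgs.d1 hgs.d2
      ⟨B, fun θ hθ φ => by rw [sub_zero]; exact hσ θ hθ φ⟩ aS
    have hgc := sg_grad ha hu hv c
    simp only [sub_zero] at aσ hc
    set T : ℝ → ℝ → ℝ := fun θ φ =>
      (sg a u v θ φ - c) * Jr a (u θ φ) (v θ φ) (M1 u v θ φ) (M2 u v θ φ) with hT
    have aT : Adm T := by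
      refine Adm.of_le (hgc.c0.mul cJM) (aσ.add (hm.smul (2 * K))) ?_
      intro θ hθ φ
      have h1 := JM θ hθ φ
      show |(sg a u v θ φ - c) * Jr a (u θ φ) (v θ φ) (M1 u v θ φ) (M2 u v θ φ)| ≤ _
      rw [abs_le]
      constructor <;> nlinarith [sq_nonneg (sg a u v θ φ - c - Jr a (u θ φ) (v θ φ) (M1 u v θ φ) (M2 u v θ φ)), sq_nonneg (sg a u v θ φ - c + Jr a (u θ φ) (v θ φ) (M1 u v θ φ) (M2 u v θ φ)), sq_nonneg (sg a u v θ φ - c), sq_nonneg (Jr a (u θ φ) (v θ φ) (M1 u v θ φ) (M2 u v θ φ))]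
    have Jeq : ∀ θ φ, J1 a u v θ φ = (1 + XX a u v θ φ ^ 2) * (S1 a u v θ φ - (sin θ)⁻¹) ∧
        J2 a u v θ φ = (1 + XX a u v θ φ ^ 2) * S2 a u v θ φ := by
      intro θ φ
      have : 1 + XX a u v θ φ ^ 2 ≠ 0 := by positivity
      unfold S1 S2
      constructor <;> field_simp
      ring
    set R : ℝ → ℝ → ℝ := fun θ φ => S1 a u v θ φ * (J1 a u v θ φ + (sin θ)⁻¹)
      + (sin θ ^ 2)⁻¹ * (S2 a u v θ φ * J2 a u v θ φ) with hR
    have Req : ∀ θ φ, R θ φ = (1 + XX a u v θ φ ^ 2) * gS a u v θ φ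
        - XX a u v θ φ ^ 2 * S1 a u v θ φ * (sin θ)⁻¹ := by
      intro θ φ
      simp only [hR, (Jeq θ φ).1, (Jeq θ φ).2, gS]
      ring
    have hJV := J_VF ha hu hv
    have cR : CD R := (hgs.c1.mul hJV.c1).add (CD.sinv2.mul (hgs.c2.mul hJV.c2))
    have Rb : ∀ θ ∈ Ioo (0 : ℝ) π, ∀ φ,
      |XX a u v θ φ ^ 2 * S1 a u v θ φ * (sin θ)⁻¹| ≤ 1 / 4 * gS a u v θ φ +
        4 * (ee u v θ φ * XX a u v θ φ ^ 2) := by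
      intro θ hθ φ
      have h1 := eX θ hθ φ
      have h2 := xle θ hθ φ
      have h3 : S1 a u v θ φ ^ 2 ≤ gS a u v θ φ := by
        unfold gS
        have h2 : 0 ≤ (sin θ ^ 2)⁻¹ * S2 a u v θ φ ^ 2 := by positivity
        linarith
      have h4 : (XX a u v θ φ ^ 2 * (sin θ)⁻¹) ^ 2 ≤ (sin θ ^ 2)⁻¹ * XX a u v θ φ ^ 2 := by
        rw [← inv_pow]
        have : 0 ≤ (sin θ)⁻¹ ^ 2 * XX a u v θ φ ^ 2 := by positivity
        nlinarith
      rw [abs_le]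
      constructor <;> nlinarith [sq_nonneg (XX a u v θ φ ^ 2 * (sin θ)⁻¹ - 1 / 2 * S1 a u v θ φ), sq_nonneg (XX a u v θ φ ^ 2 * (sin θ)⁻¹ + 1 / 2 * S1 a u v θ φ)]
    have aR : Adm R := by
      refine Adm.of_le cR ((aS.smul 3).add (aeX.smul 4)) ?_
      intro θ hθ φ
      have h1 := Rb θ hθ φ
      have h2 := xle θ hθ φ
      have h3 := ngS θ φ
      rw [Req]
      rw [abs_le] at *
      constructor <;> nlinarith [mul_nonneg (sq_nonneg (XX a u v θ φ)) h3]
    have aF : Adm (fun θ φ => R θ φ + T θ φ) := aR.add aT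
    have h0 := flux_int hgc hJV aF (C := (B + |c|) * (1 + B)) (by
      intro θ hθ φ
      rw [J_div]) (by
      intro θ hθ φ
      have hs := sin_pos_D hθ
      have h1 : |S1 a u v θ φ| ≤ 1 / 2 := by
        have := hgS θ hθ φ
        unfold gS at this
        have h2 : 0 ≤ (sin θ ^ 2)⁻¹ * S2 a u v θ φ ^ 2 := by positivity
        rw [abs_le]
        constructor <;> nlinarith
      have h2 := xle θ hθ φ
      have h3 : |J1 a u v θ φ + (sin θ)⁻¹| ≤ 1 + B := by
        rw [(Jeq θ φ).1]
        have h4 : XX a u v θ φ ^ 2 * (sin θ)⁻¹ ≤ B := by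
          rw [mul_inv_le_iff₀ hs]
          have := hXs θ hθ φ
          have h5 := hX1 θ hθ φ
          rw [← sq_abs]
          nlinarith [abs_nonneg (XX a u v θ φ)]
        have h6 : 0 ≤ XX a u v θ φ ^ 2 * (sin θ)⁻¹ := by positivity
        rw [abs_le] at *
        constructor <;> nlinarith [sq_nonneg (XX a u v θ φ)]
      have h4 : |sg a u v θ φ - c| ≤ B + |c| :=
        (abs_sub _ _).trans (by gcongr; exact hσ θ hθ φ)
      rw [abs_mul]
      gcongr)
    rw [sphInt_add aR aT] at h0
    have hR1 : sphInt (fun θ φ => 3 / 4 * gS a u v θ φ - 4 * (ee u v θ φ * XX a u v θ φ ^ 2))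
        ≤ sphInt R := by
      refine sphInt_mono ((aS.smul _).sub (aeX.smul _)) aR ?_
      intro θ hθ φ
      have h1 := (abs_le.1 (Rb θ hθ φ)).2
      rw [Req]
      nlinarith [mul_nonneg (sq_nonneg (XX a u v θ φ)) (ngS θ φ)]
    have hpi := pi_pos
    have hT1 : sphInt (fun θ φ => -(1 / (36 * π ^ 2)) * (sg a u v θ φ - c) ^ 2
        - (18 * π ^ 2 * K) * m θ φ) ≤ sphInt T := by
      refine sphInt_mono ((aσ.smul _).sub (hm.smul _)) aT ?_
      intro θ hθ φ
      have h1 := JM θ hθ φ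
      simp only [hT]
      set A := sg a u v θ φ - c
      set Jm := Jr a (u θ φ) (v θ φ) (M1 u v θ φ) (M2 u v θ φ)
      have h2 : 0 ≤ (1 / (6 * π) * A + 3 * π * Jm) ^ 2 := sq_nonneg _
      have h3 : (1 / (6 * π) * A + 3 * π * Jm) ^ 2
        = 1 / (36 * π ^ 2) * A ^ 2 + A * Jm + 9 * π ^ 2 * Jm ^ 2 := by
        field_simp
        ring
      have h4 : 9 * π ^ 2 * Jm ^ 2 ≤ 9 * π ^ 2 * (2 * K * m θ φ) := by gcongr
      nlinarith
    rw [sphInt_sub (aS.smul _) (aeX.smul _), sphInt_smul, sphInt_smul] at hR1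
    rw [sphInt_sub (aσ.smul _) (hm.smul _), sphInt_smul, sphInt_smul] at hT1
    have h3 : (1 / (36 * π ^ 2)) * sphInt (fun θ φ => (sg a u v θ φ - c) ^ 2)
        ≤ 1 / 4 * sphInt (gS a u v) := by
      have : (1 / (36 * π ^ 2)) * (9 * π ^ 2 * sphInt (gS a u v)) = 1 / 4 * sphInt (gS a u v) := by
        field_simp
        ring
      rw [← this]
      gcongr
      exact hc
    have h4 : 2 * sphInt (fun θ φ => ee u v θ φ * XX a u v θ φ ^ 2) ≤ 4 * K * sphInt m := by
      rw [← sphInt_smul]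
      exact (sphInt_mono (aeX.smul 2) (aX.add (aeX.smul 2))
        (fun θ _ φ => by linarith [ngX θ φ])).trans step1
    nlinarith
  have aQ : Adm (QQ a u v) := by
    refine Adm.of_le (((CD.ee hu hv).add (((CD.const 2).mul hgs.c1).mul CD.sin_inv)).sub CD.sinv2)
      (((aX.add (aeX.smul 2)).smul (1 / 2)).add aS) (fun θ hθ φ => ?_)
    rw [abs_of_nonneg (QQ_nonneg ha θ φ)]
    exact QQ_le ha θ φ
  refine ⟨aQ, ?_⟩
  have h5 := sphInt_mono aQ (((aX.add (aeX.smul 2)).smul (1 / 2)).add aS)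
    (fun θ _ φ => QQ_le ha θ φ)
  rw [sphInt_add ((aX.add (aeX.smul 2)).smul (1 / 2)) aS, sphInt_smul] at h5
  nlinarith
end


/-! ### Bounds in Fermi coordinates and classification of the critical map -/

lemma sin_sq_fac (θ : ℝ) : sin θ ^ 2 = (1 - cos θ) * (1 + cos θ) := by
  rw [sin_sq]; ring

lemma Pr_le {a C u v s1 s2 : ℝ} (ha : 0 < a) (hs1 : 0 < s1) (hs2 : 0 < s2) (hs : s1 + s2 = 2)
    (hC : 0 ≤ C) (h1 : exp (2 * u) * (s1 * s2) ≤ C) (h2 : exp (-(2 * u)) ≤ C * (s1 * s2))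
    (h3 : |v + a| ≤ C * s2) : Pr a u v ≤ ((C ^ 3 + C) / a) * (s2 / s1) := by
  unfold Pr
  have hY := exp_pos (2 * u)
  have e1 : (a + v) ^ 2 ≤ (C * s2) ^ 2 := by
    rw [← sq_abs, add_comm a v]
    gcongr
  have e2 : exp (2 * u) * (a + v) ^ 2 ≤ C ^ 3 * (s2 / s1) := by
    calc exp (2 * u) * (a + v) ^ 2 ≤ exp (2 * u) * (C * s2) ^ 2 := by gcongr
      _ = (exp (2 * u) * (s1 * s2)) * (C ^ 2 * (s2 / s1)) := by field_simp
      _ ≤ C * (C ^ 2 * (s2 / s1)) := by gcongr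
      _ = _ := by ring
  have e3 : exp (-(2 * u)) ≤ 4 * C * (s2 / s1) := by
    calc exp (-(2 * u)) ≤ C * (s1 * s2) := h2
      _ = C * (s2 / s1) * s1 ^ 2 := by field_simp
      _ ≤ C * (s2 / s1) * 4 := by
          gcongr
          nlinarith
      _ = _ := by ring
  calc exp (2 * u) * (a + v) ^ 2 / a + exp (-(2 * u)) / (4 * a)
      ≤ (C ^ 3 * (s2 / s1)) / a + (4 * C * (s2 / s1)) / (4 * a) := by gcongr
    _ = _ := by field_simp

lemma fermi_bd {a C u v θ : ℝ} (ha : 0 < a) (hθ : θ ∈ Ioo (0 : ℝ) π) (hC : 0 ≤ C)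
    (h1 : exp (2 * u) * sin θ ^ 2 ≤ C) (h2 : exp (-(2 * u)) ≤ C * sin θ ^ 2)
    (h3 : |v - a| ≤ C * (1 - cos θ)) (h4 : |v + a| ≤ C * (1 + cos θ)) :
    Pr a u v ≤ ((C ^ 3 + C) / a) * ((1 + cos θ) / (1 - cos θ)) ∧
    Pr a u (-v) ≤ ((C ^ 3 + C) / a) * ((1 - cos θ) / (1 + cos θ)) := by
  obtain ⟨p1, p2⟩ := cos_bd hθ
  rw [sin_sq_fac] at h1 h2
  constructor
  · exact Pr_le ha p2 p1 (by ring) hC h1 h2 h4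
  · refine Pr_le ha p1 p2 (by ring) hC (by rwa [mul_comm (1 + cos θ)])
      (by rwa [mul_comm (1 + cos θ)]) ?_
    rwa [show -v + a = -(v - a) by ring, abs_neg]

lemma fermi_bd2 {a D u v θ : ℝ} (ha : 0 < a) (hθ : θ ∈ Ioo (0 : ℝ) π) (hD : 0 < D)
    (hP : Pr a u v ≤ D * ((1 + cos θ) / (1 - cos θ)))
    (hN : Pr a u (-v) ≤ D * ((1 - cos θ) / (1 + cos θ))) :
    Xr a u v ^ 2 ≤ D ^ 2 ∧ |sr a u v - tt θ| ≤ log D ∧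
    D⁻¹ * ((1 + cos θ) / (1 - cos θ)) ≤ Pr a u v ∧
    D⁻¹ * ((1 - cos θ) / (1 + cos θ)) ≤ Pr a u (-v) := by
  obtain ⟨p1, p2⟩ := cos_bd hθ
  have P0 := Pr_pos ha u v
  have N0 := Pr_pos ha u (-v)
  have hPN := PN_eq ha u v
  have h1 : Pr a u v * Pr a u (-v) ≤ D ^ 2 := by
    calc Pr a u v * Pr a u (-v)
        ≤ (D * ((1 + cos θ) / (1 - cos θ))) * (D * ((1 - cos θ) / (1 + cos θ))) := by gcongr
      _ = D ^ 2 := by field_simp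
  have h2 : 1 ≤ Pr a u v * Pr a u (-v) := by rw [hPN]; nlinarith [sq_nonneg (Xr a u v)]
  have lowP : D⁻¹ * ((1 + cos θ) / (1 - cos θ)) ≤ Pr a u v := by
    have : 1 ≤ Pr a u v * (D * ((1 - cos θ) / (1 + cos θ))) :=
      h2.trans (by gcongr)
    calc D⁻¹ * ((1 + cos θ) / (1 - cos θ))
        ≤ D⁻¹ * ((1 + cos θ) / (1 - cos θ)) * (Pr a u v * (D * ((1 - cos θ) / (1 + cos θ)))) :=
          le_mul_of_one_le_right (by positivity) this
      _ = _ := by field_simp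
  have lowN : D⁻¹ * ((1 - cos θ) / (1 + cos θ)) ≤ Pr a u (-v) := by
    have : 1 ≤ (D * ((1 + cos θ) / (1 - cos θ))) * Pr a u (-v) :=
      h2.trans (by gcongr)
    calc D⁻¹ * ((1 - cos θ) / (1 + cos θ))
        ≤ D⁻¹ * ((1 - cos θ) / (1 + cos θ)) * ((D * ((1 + cos θ) / (1 - cos θ))) * Pr a u (-v)) :=
          le_mul_of_one_le_right (by positivity) this
      _ = _ := by field_simp
  refine ⟨by linarith, ?_, lowP, lowN⟩
  have e1 : log ((1 + cos θ) / (1 - cos θ)) = 2 * tt θ := by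
    rw [log_div p1.ne' p2.ne']; unfold tt; ring
  have e2 : log ((1 - cos θ) / (1 + cos θ)) = -(2 * tt θ) := by
    rw [log_div p2.ne' p1.ne']; unfold tt; ring
  have l1 := log_le_log P0 hP
  have l2 := log_le_log N0 hN
  have l3 := log_le_log (by positivity) lowP
  have l4 := log_le_log (by positivity) lowN
  rw [log_mul (by positivity) (by positivity), e1] at l1
  rw [log_mul (by positivity) (by positivity), e2] at l2
  rw [log_mul (by positivity) (by positivity), e1, log_inv] at l3
  rw [log_mul (by positivity) (by positivity), e2, log_inv] at l4
  unfold sr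
  rw [abs_le]
  constructor <;> linarith

lemma inn_zero {F : ℝ → ℝ → ℝ} (hF : CD F) (h0 : ∀ θ ∈ Ioo (0 : ℝ) π, ∀ φ, 0 ≤ F θ φ)
    (hper : ∀ θ φ : ℝ, F θ (φ + 2 * π) = F θ φ) {θ : ℝ} (hθ : θ ∈ Ioo (0 : ℝ) π)
    (h : inn F θ = 0) : ∀ φ, F θ φ = 0 := by
  have hc := hF.slice hθ
  intro φ
  have hp : Function.Periodic (F θ) (2 * π) := hper θ
  obtain ⟨y, hy, hyφ⟩ := hp.exists_mem_Ico₀ two_pi_pos φ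
  rw [hyφ]
  unfold inn at h
  have h2 := (intervalIntegral.integral_eq_zero_iff_of_le_of_nonneg_ae two_pi_pos.le
    (Eventually.of_forall (h0 θ hθ)) (hF.ii hθ _ _)).1 h
  have h3 : EqOn (F θ) 0 (Icc 0 (2 * π)) := by
    have h4 : F θ =ᵐ[volume.restrict (Icc 0 (2 * π))] 0 := by
      rwa [restrict_Ioc_eq_restrict_Icc] at h2
    exact Measure.eqOn_Icc_of_ae_eq volume two_pi_pos.ne h4 hc.continuousOn continuousOn_const
  exact h3 ⟨hy.1, hy.2.le⟩

lemma liou_flux {g g1 g2 V1 V2 V11 V22 F : ℝ → ℝ → ℝ} (hg : Grad g g1 g2)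
    (hV : VF V1 V2 V11 V22) (h1 : ∀ θ ∈ Ioo (0 : ℝ) π, ∀ φ, V1 θ φ = g1 θ φ)
    (hcF : CD F)
    (hF : ∀ θ ∈ Ioo (0 : ℝ) π, ∀ φ, F θ φ = g1 θ φ * V1 θ φ + (sin θ ^ 2)⁻¹ * (g2 θ φ * V2 θ φ) +
      g θ φ * (V11 θ φ + cos θ / sin θ * V1 θ φ + (sin θ ^ 2)⁻¹ * V22 θ φ))
    (hF0 : ∀ θ ∈ Ioo (0 : ℝ) π, ∀ φ, 0 ≤ F θ φ)
    (hFp : ∀ θ φ : ℝ, F θ (φ + 2 * π) = F θ φ) {C : ℝ}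
    (hb : ∀ θ ∈ Ioo (0 : ℝ) π, ∀ φ, |g θ φ| ≤ C) :
    ∀ θ ∈ Ioo (0 : ℝ) π, ∀ φ, F θ φ = 0 := by
  have dG : ∀ θ ∈ Ioo (0 : ℝ) π, HasDerivAt (inn (fun θ φ => g θ φ ^ 2))
      (2 * inn (fun θ φ => g θ φ * (sin θ * V1 θ φ)) θ / sin θ) θ := by
    intro θ hθ
    have hs := sin_ne_D hθ
    have h := hasDerivAt_inn (B := fun _ _ => 0) (B' := fun _ _ => 0) (hg.c0.pow 2)
      (A' := fun θ φ => 2 * g θ φ * g1 θ φ) (((CD.const 2).mul hg.c0).mul hg.c1) (CD.const 0)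
      (fun θ hθ φ => ((hg.d1 θ hθ φ).pow 2).congr_deriv (by push_cast; ring))
      (fun θ _ φ => hasDerivAt_const _ _) (fun _ _ => rfl) hθ
    convert h using 1
    unfold inn
    rw [← intervalIntegral.integral_const_mul, ← intervalIntegral.integral_div]
    congr 1
    ext φ
    show 2 * (g θ φ * (sin θ * V1 θ φ)) / sin θ = 2 * g θ φ * g1 θ φ + 0
    rw [h1 θ hθ, add_zero]
    field_simp
  have dH : ∀ θ ∈ Ioo (0 : ℝ) π,
      HasDerivAt (fun θ => 2 * inn (fun θ φ => g θ φ * (sin θ * V1 θ φ)) θ)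
        (2 * inn (fun θ φ => sin θ * F θ φ) θ) θ :=
    fun θ hθ => (flux_inn hg hV hF hθ).const_mul 2
  have cs : CD (fun θ φ => sin θ * F θ φ) := CD.sin.mul hcF
  have key := liouville dG dH (fun θ hθ => by
      have : 0 ≤ inn (fun θ φ => sin θ * F θ φ) θ :=
        intervalIntegral.integral_nonneg two_pi_pos.le
          (fun φ _ => mul_nonneg (sin_pos_D hθ).le (hF0 θ hθ φ))
      linarith) (C := 2 * π * C ^ 2) (by
      intro θ hθ
      have h1 : ‖inn (fun θ φ => g θ φ ^ 2) θ‖ ≤ (C ^ 2) * |2 * π - 0| :=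
        intervalIntegral.norm_integral_le_of_norm_le_const fun φ _ => by
          rw [norm_pow]
          exact pow_le_pow_left₀ (abs_nonneg _) (hb θ hθ φ) 2
      rw [sub_zero, abs_of_pos two_pi_pos] at h1
      rw [norm_eq_abs] at h1
      linarith)
  intro θ hθ φ
  have hz : (2 * inn (fun θ φ => sin θ * F θ φ) θ) = 0 := by
    have h2 : HasDerivAt (fun θ => 2 * inn (fun θ φ => g θ φ * (sin θ * V1 θ φ)) θ) 0 θ := by
      refine (hasDerivAt_const θ (0 : ℝ)).congr_of_eventuallyEq ?_
      filter_upwards [isOpen_Ioo.mem_nhds hθ] with x hx using key x hx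
    exact (dH θ hθ).unique h2
  have := inn_zero cs (fun θ hθ φ => mul_nonneg (sin_pos_D hθ).le (hF0 θ hθ φ))
    (fun θ φ => by rw [hFp]) hθ (by linarith) φ
  exact (mul_eq_zero.1 this).resolve_left (sin_ne_D hθ)

lemma const_Ioo {g : ℝ → ℝ} (h : ∀ θ ∈ Ioo (0 : ℝ) π, HasDerivAt g 0 θ) {x y : ℝ}
    (hx : x ∈ Ioo (0 : ℝ) π) (hy : y ∈ Ioo (0 : ℝ) π) : g x = g y := by
  have := (convex_Ioo 0 π).norm_image_sub_le_of_norm_hasDerivWithin_le (C := 0)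
    (fun θ hθ => (h θ hθ).hasDerivWithinAt) (fun θ _ => by simp) hy hx
  rw [zero_mul, norm_le_zero_iff] at this
  linarith

/-- explicit structure of the critical map -/
structure Crit (a : ℝ) (u v : ℝ → ℝ → ℝ) : Prop where
  hX : ∀ θ ∈ Ioo (0 : ℝ) π, ∀ φ, Xr a (u θ φ) (v θ φ) = 0
  u1 : ∀ θ ∈ Ioo (0 : ℝ) π, ∀ φ, pdθ u θ φ = -(v θ φ / a) * (sin θ)⁻¹
  v1 : ∀ θ ∈ Ioo (0 : ℝ) π, ∀ φ, pdθ v θ φ = -(exp (-(4 * u θ φ)) / (2 * a)) * (sin θ)⁻¹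
  u2 : ∀ θ ∈ Ioo (0 : ℝ) π, ∀ φ, pdφ u θ φ = 0
  v2 : ∀ θ ∈ Ioo (0 : ℝ) π, ∀ φ, pdφ v θ φ = 0
  e : ∀ θ ∈ Ioo (0 : ℝ) π, ∀ φ, ee u v θ φ = (sin θ ^ 2)⁻¹

lemma crit_alg {a u v du dv J : ℝ} (ha : 0 < a) (hX : Xr a u v = 0) (hd : dX a u v du dv = 0)
    (hJ : Jr a u v du dv = J) : du = v / a * J ∧ dv = exp (-(4 * u)) / (2 * a) * J := by
  have hK := K_eq ha u v
  have hY := exp_pos (2 * u)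
  have hk : kr a u v = exp (-(2 * u)) / (2 * a) := by
    unfold Xr at hX
    unfold kr
    have : exp (-(2 * u)) / (2 * a) = 2 * (exp (-(2 * u)) / (4 * a)) := by field_simp; ring
    rw [this]
    linarith
  rw [hX] at hK
  have e4 : exp (-(4 * u)) = exp (-(2 * u)) * exp (-(2 * u)) := by rw [← exp_add]; congr 1; ring
  have ey : exp (-(2 * u)) * exp (2 * u) = 1 := by rw [← exp_add]; simp
  unfold dX at hd
  unfold Jr at hJ
  constructor
  · have : (v / a) * J = ((v / a) ^ 2 + kr a u v ^ 2) * du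
        - kr a u v / 2 * (2 * kr a u v * du - 2 * exp (2 * u) * (v / a) * dv) := by
      rw [← hJ]; ring
    rw [this, hK, hd]; ring
  · have h1 : kr a u v * J = exp (2 * u) * (((v / a) ^ 2 + kr a u v ^ 2) * dv)
        + (v / a) / 2 * (2 * kr a u v * du - 2 * exp (2 * u) * (v / a) * dv) := by
      rw [← hJ]; ring
    rw [hK, hd] at h1
    calc dv = (exp (-(2 * u)) * exp (2 * u)) * dv := by rw [ey, one_mul]
      _ = exp (-(2 * u)) * (kr a u v * J) := by rw [h1]; ring
      _ = _ := by rw [hk, e4]; ring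

lemma classify {a C : ℝ} {u v : ℝ → ℝ → ℝ} (ha : 0 < a) (hu : R2 u) (hv : R2 v) (hC : 0 < C)
    (hM : ∀ θ ∈ Ioo (0 : ℝ) π, ∀ φ, M1 u v θ φ = 0 ∧ M2 u v θ φ = 0)
    (h1 : ∀ θ ∈ Ioo (0 : ℝ) π, ∀ φ, exp (2 * u θ φ) * sin θ ^ 2 ≤ C)
    (h2 : ∀ θ ∈ Ioo (0 : ℝ) π, ∀ φ, exp (-(2 * u θ φ)) ≤ C * sin θ ^ 2)
    (h3 : ∀ θ ∈ Ioo (0 : ℝ) π, ∀ φ, |v θ φ - a| ≤ C * (1 - cos θ))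
    (h4 : ∀ θ ∈ Ioo (0 : ℝ) π, ∀ φ, |v θ φ + a| ≤ C * (1 + cos θ)) : Crit a u v := by
  set D := (C ^ 3 + C) / a
  have hD : 0 < D := by positivity
  have bd := fun θ (hθ : θ ∈ Ioo (0 : ℝ) π) φ =>
    fermi_bd2 ha hθ hD (fermi_bd ha hθ hC.le (h1 θ hθ φ) (h2 θ hθ φ) (h3 θ hθ φ) (h4 θ hθ φ)).1
    (fermi_bd ha hθ hC.le (h1 θ hθ φ) (h2 θ hθ φ) (h3 θ hθ φ) (h4 θ hθ φ)).2
  have dX0 : ∀ u v : ℝ, dX a u v 0 0 = 0 := fun u v => by unfold dX; ring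
  have Jr0 : ∀ u v : ℝ, Jr a u v 0 0 = 0 := fun u v => by unfold Jr; ring
  have nee : ∀ θ φ, 0 ≤ ee u v θ φ := by
    intro θ φ
    rw [ee_eq ha]
    positivity
  have hgr := XX_grad ha hu hv
  have z1 := liou_flux hgr (XX_VF ha hu hv) (fun _ _ _ => rfl)
    (F := fun θ φ => gX a u v θ φ + 4 * (ee u v θ φ * XX a u v θ φ ^ 2))
    (((hgr.c1.pow 2).add (CD.sinv2.mul (hgr.c2.pow 2))).add
      ((CD.const 4).mul ((CD.ee hu hv).mul (hgr.c0.pow 2))))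
    (fun θ hθ φ => by
      rw [XX_div, (hM θ hθ φ).1, (hM θ hθ φ).2, dX0]
      unfold gX
      ring)
    (fun θ _ φ => by
      have := nee θ φ
      unfold gX
      positivity)
    (fun θ φ => by
      simp only [gX, X1, X2, XX, ee, gradNormSqS2, gradDotS2, hu.per, hv.per, per_pdφ hu.per,
        per_pdφ hv.per, per_pdθ hu.per, per_pdθ hv.per])
    (C := D) (fun θ hθ φ => abs_le_of_sq_le_sq (bd θ hθ φ).1 hD.le)
  have sp : ∀ θ ∈ Ioo (0 : ℝ) π, ∀ φ, X1 a u v θ φ = 0 ∧ X2 a u v θ φ = 0 ∧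
      ee u v θ φ * XX a u v θ φ ^ 2 = 0 := by
    intro θ hθ φ
    have hs := sin_pos_D hθ
    have h := z1 θ hθ φ
    have p1 : 0 ≤ (sin θ ^ 2)⁻¹ * X2 a u v θ φ ^ 2 := by positivity
    have p2 : 0 ≤ ee u v θ φ * XX a u v θ φ ^ 2 := mul_nonneg (nee _ _) (sq_nonneg _)
    have p3 := sq_nonneg (X1 a u v θ φ)
    simp only [gX] at h
    refine ⟨?_, ?_, by linarith⟩
    · exact pow_eq_zero_iff two_ne_zero |>.1 (by linarith)
    · have : (sin θ ^ 2)⁻¹ * X2 a u v θ φ ^ 2 = 0 := by linarith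
      rcases mul_eq_zero.1 this with h | h
      · exact absurd h (by positivity)
      · exact pow_eq_zero_iff two_ne_zero |>.1 h
  have hX : ∀ θ ∈ Ioo (0 : ℝ) π, ∀ φ, XX a u v θ φ = 0 := by
    intro θ₀ hθ₀ φ
    by_contra hne
    have hc : ∀ θ ∈ Ioo (0 : ℝ) π, XX a u v θ φ = XX a u v θ₀ φ := fun θ hθ =>
      const_Ioo (g := fun θ => XX a u v θ φ)
        (fun θ hθ => (hgr.d1 θ hθ φ).congr_deriv (sp θ hθ φ).1) hθ hθ₀
    have he : ∀ θ ∈ Ioo (0 : ℝ) π, ee u v θ φ = 0 := by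
      intro θ hθ
      have := (sp θ hθ φ).2.2
      rw [hc θ hθ] at this
      rcases mul_eq_zero.1 this with h | h
      · exact h
      · exact absurd (pow_eq_zero_iff two_ne_zero |>.1 h) hne
    have hu1 : ∀ θ ∈ Ioo (0 : ℝ) π, pdθ u θ φ = 0 := by
      intro θ hθ
      have := he θ hθ
      unfold ee gradNormSqS2 gradDotS2 at this
      have q1 : 0 ≤ (sin θ ^ 2)⁻¹ * pdφ u θ φ * pdφ u θ φ := by
        rw [mul_assoc]
        exact mul_nonneg (by positivity) (mul_self_nonneg _)
      have q2 : 0 ≤ exp (4 * u θ φ) * (pdθ v θ φ * pdθ v θ φ + (sin θ ^ 2)⁻¹ * pdφ v θ φ * pdφ v θ φ) := by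
        refine mul_nonneg (exp_pos _).le (add_nonneg (mul_self_nonneg _) ?_)
        rw [mul_assoc]
        exact mul_nonneg (by positivity) (mul_self_nonneg _)
      have q3 := mul_self_nonneg (pdθ u θ φ)
      exact mul_self_eq_zero.1 (by linarith)
    have hcu : ∀ θ ∈ Ioo (0 : ℝ) π, u θ φ = u θ₀ φ := fun θ hθ =>
      const_Ioo (g := fun θ => u θ φ)
        (fun θ hθ => (hu.d1 θ hθ φ).congr_deriv (hu1 θ hθ)) hθ hθ₀
    have hlim : Tendsto (fun θ : ℝ => C * sin θ ^ 2) (nhdsWithin 0 (Ioi 0)) (nhds 0) := by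
      have : Continuous (fun θ : ℝ => C * sin θ ^ 2) := by fun_prop
      simpa using (this.tendsto 0).mono_left nhdsWithin_le_nhds
    have hle : exp (-(2 * u θ₀ φ)) ≤ 0 := by
      refine ge_of_tendsto hlim ?_
      filter_upwards [Ioo_mem_nhdsGT pi_pos] with θ hθ
      have := h2 θ hθ φ
      rwa [hcu θ hθ] at this
    exact absurd hle (not_le.2 (exp_pos _))
  have JS : ∀ θ ∈ Ioo (0 : ℝ) π, ∀ φ, J1 a u v θ φ + (sin θ)⁻¹ = S1 a u v θ φ ∧
      J2 a u v θ φ = S2 a u v θ φ := by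
    intro θ hθ φ
    unfold S1 S2
    rw [hX θ hθ]
    constructor <;> ring
  have hgs := sg_grad ha hu hv 0
  have z2 := liou_flux hgs (J_VF ha hu hv) (fun θ hθ φ => (JS θ hθ φ).1)
    (F := gS a u v) ((hgs.c1.pow 2).add (CD.sinv2.mul (hgs.c2.pow 2)))
    (fun θ hθ φ => by
      rw [J_div, (hM θ hθ φ).1, (hM θ hθ φ).2, Jr0, (JS θ hθ φ).1, (JS θ hθ φ).2]
      unfold gS
      ring)
    (fun θ _ φ => by
      unfold gS
      positivity)
    (fun θ φ => by
      simp only [gS, S1, S2, J1, J2, XX, hu.per, hv.per, per_pdφ hu.per,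
        per_pdφ hv.per, per_pdθ hu.per, per_pdθ hv.per])
    (C := log D) (fun θ hθ φ => by rw [sub_zero]; exact (bd θ hθ φ).2.1)
  have sS : ∀ θ ∈ Ioo (0 : ℝ) π, ∀ φ, S1 a u v θ φ = 0 ∧ S2 a u v θ φ = 0 := by
    intro θ hθ φ
    have hs := sin_pos_D hθ
    have h := z2 θ hθ φ
    have p1 : 0 ≤ (sin θ ^ 2)⁻¹ * S2 a u v θ φ ^ 2 := by positivity
    have p3 := sq_nonneg (S1 a u v θ φ)
    simp only [gS] at h
    refine ⟨?_, ?_⟩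
    · exact pow_eq_zero_iff two_ne_zero |>.1 (by linarith)
    · have : (sin θ ^ 2)⁻¹ * S2 a u v θ φ ^ 2 = 0 := by linarith
      rcases mul_eq_zero.1 this with h | h
      · exact absurd h (by positivity)
      · exact pow_eq_zero_iff two_ne_zero |>.1 h
  have A1 : ∀ θ ∈ Ioo (0 : ℝ) π, ∀ φ, _ := fun θ hθ φ =>
    crit_alg ha (hX θ hθ φ) (sp θ hθ φ).1 (J := -(sin θ)⁻¹) (by
      have := (JS θ hθ φ).1
      rw [(sS θ hθ φ).1] at this
      unfold J1 at this
      linarith)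
  have A2 : ∀ θ ∈ Ioo (0 : ℝ) π, ∀ φ, _ := fun θ hθ φ =>
    crit_alg ha (hX θ hθ φ) (sp θ hθ φ).2.1 (J := 0) (by
      have := (JS θ hθ φ).2
      rw [(sS θ hθ φ).2] at this
      exact this)
  refine ⟨hX, fun θ hθ φ => ?_, fun θ hθ φ => ?_, fun θ hθ φ => ?_, fun θ hθ φ => ?_,
    fun θ hθ φ => ?_⟩
  · rw [(A1 θ hθ φ).1]; ring
  · rw [(A1 θ hθ φ).2]; ring
  · rw [(A2 θ hθ φ).1]; ring
  · rw [(A2 θ hθ φ).2]; ring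
  · rw [ee_eq ha, (sp θ hθ φ).1, (sp θ hθ φ).2.1, (sS θ hθ φ).1, (sS θ hθ φ).2, hX θ hθ φ, ← inv_pow]
    ring


/-! ### A priori bounds for the critical map -/

lemma covNorm0 (f : ℝ → ℝ → ℝ) (θ φ : ℝ) : covNorm 0 f θ φ = |f θ φ| := by
  simp [covNorm, covIter, sqrt_sq_eq_abs]

lemma sphWeight_nonneg (i : Fin 2) (θ : ℝ) : 0 ≤ sphWeight i θ := by
  unfold sphWeight
  split_ifs <;> positivity

lemma covNorm_sq_ge {k : ℕ} (f : ℝ → ℝ → ℝ) (θ φ : ℝ) {I I' : Fin k → Fin 2} (hI : I ≠ I') :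
    (∏ j, sphWeight (I j) θ) * (covIter f k I θ φ) ^ 2
     + (∏ j, sphWeight (I' j) θ) * (covIter f k I' θ φ) ^ 2 ≤ covNorm k f θ φ ^ 2 := by
  have hn : ∀ I : Fin k → Fin 2, 0 ≤ (∏ j, sphWeight (I j) θ) * (covIter f k I θ φ) ^ 2 :=
    fun I => mul_nonneg (Finset.prod_nonneg fun j _ => sphWeight_nonneg _ _) (sq_nonneg _)
  unfold covNorm
  rw [sq_sqrt (Finset.sum_nonneg fun I _ => hn I)]
  rw [← Finset.sum_pair (f := fun I => (∏ j, sphWeight (I j) θ) * (covIter f k I θ φ) ^ 2) hI]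
  exact Finset.sum_le_sum_of_subset_of_nonneg (Finset.subset_univ _) (fun I _ _ => hn I)

lemma covNorm1 (f : ℝ → ℝ → ℝ) (θ φ : ℝ) :
    pdθ f θ φ ^ 2 + (sin θ ^ 2)⁻¹ * pdφ f θ φ ^ 2 ≤ covNorm 1 f θ φ ^ 2 := by
  have h := covNorm_sq_ge f θ φ (I := ![0]) (I' := ![1]) (by decide)
  simpa [covIter, covDer, pder2, sphWeight] using h

lemma covNorm2 (f : ℝ → ℝ → ℝ) (θ φ : ℝ) :
    lapS2 f θ φ ^ 2 ≤ 2 * covNorm 2 f θ φ ^ 2 := by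
  have h := covNorm_sq_ge f θ φ (I := ![0, 0]) (I' := ![1, 1]) (by decide)
  have c0 : (covDer (k := 0) (fun _ => f) fun _ => 0) = pdθ f := by
    funext x y
    simp [covDer, pder2]
  have c1 : (covDer (k := 0) (fun _ => f) fun _ => 1) = pdφ f := by
    funext x y
    simp [covDer, pder2]
  have e0 : covIter f 2 ![0, 0] θ φ = pdθ (pdθ f) θ φ := by
    simp [covIter, covDer, pder2, christoffel]
    change pdθ (covDer (k := 0) (fun _ => f) fun _ => 0) θ φ = _
    rw [c0]
  have e1 : covIter f 2 ![1, 1] θ φ = pdφ (pdφ f) θ φ + sin θ * cos θ * pdθ f θ φ := by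
    simp [covIter, covDer, pder2, christoffel]
    change pdφ (covDer (k := 0) (fun _ => f) fun _ => 1) θ φ = _
    rw [c1]
  rw [e0, e1] at h
  simp only [sphWeight, Fin.prod_univ_two, Matrix.cons_val_zero, Matrix.cons_val_one] at h
  norm_num at h
  have : lapS2 f θ φ = pdθ (pdθ f) θ φ +
      (sin θ ^ 2)⁻¹ * (pdφ (pdφ f) θ φ + sin θ * cos θ * pdθ f θ φ) := by
    unfold lapS2
    rcases eq_or_ne (sin θ) 0 with h0 | h0
    · simp [h0]
    · field_simp
      ring
  rw [this]
  rw [← inv_pow] at *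
  nlinarith [sq_nonneg (pdθ (pdθ f) θ φ - (sin θ)⁻¹ ^ 2 * (pdφ (pdφ f) θ φ + sin θ * cos θ * pdθ f θ φ))]

lemma ext_bd {h : ℝ → ℝ → ℝ} (hper : ∀ θ φ : ℝ, h θ (φ + 2 * π) = h θ φ)
    (hex : ∃ G : ℝ → ℝ → ℝ,
      ContinuousOn (fun p : ℝ × ℝ => G p.1 p.2) (Icc 0 π ×ˢ (univ : Set ℝ)) ∧
      ∀ θ ∈ Ioo (0 : ℝ) π, ∀ φ : ℝ, G θ φ = h θ φ) :
    ∃ C, ∀ θ ∈ Ioo (0 : ℝ) π, ∀ φ, |h θ φ| ≤ C := by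
  obtain ⟨G, hG, hGh⟩ := hex
  have hc : IsCompact (Icc (0 : ℝ) π ×ˢ Icc (0 : ℝ) (2 * π)) := isCompact_Icc.prod isCompact_Icc
  obtain ⟨C, hC⟩ := hc.exists_bound_of_continuousOn
    (hG.mono (prod_mono_right (subset_univ _)))
  refine ⟨C, fun θ hθ φ => ?_⟩
  have hp : Function.Periodic (h θ) (2 * π) := hper θ
  obtain ⟨y, hy, hyφ⟩ := hp.exists_mem_Ico₀ two_pi_pos φ
  rw [hyφ, ← hGh θ hθ]
  exact hC (θ, y) ⟨⟨hθ.1.le, hθ.2.le⟩, ⟨hy.1, hy.2.le⟩⟩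

lemma per_deriv_bd {h h' h'' : ℝ → ℝ} {K : ℝ} (hK : 0 ≤ K) (hp : ∀ x, h (x + 2 * π) = h x)
    (d1 : ∀ x, HasDerivAt h (h' x) x) (d2 : ∀ x, HasDerivAt h' (h'' x) x)
    (hb : ∀ x, h'' x ≤ K) (x : ℝ) : |h' x| ≤ 2 * π * K := by
  have mv : ∀ x y, x ≤ y → h' y - h' x ≤ K * (y - x) := by
    intro x y hxy
    exact Convex.image_sub_le_mul_sub_of_deriv_le (D := univ) convex_univ
      (fun z _ => (d2 z).continuousAt.continuousWithinAt)
      (fun z _ => (d2 z).differentiableAt.differentiableWithinAt)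
      (fun z _ => by rw [(d2 z).deriv]; exact hb z) x (mem_univ _) y (mem_univ _) hxy
  have rolle : ∀ x, ∃ z ∈ Ioo x (x + 2 * π), h' z = 0 := by
    intro x
    exact exists_hasDerivAt_eq_zero (by linarith [pi_pos])
      (fun z _ => (d1 z).continuousAt.continuousWithinAt) (hp x).symm (fun z _ => d1 z)
  rw [abs_le]
  constructor
  · obtain ⟨z, hz, hz0⟩ := rolle x
    have := mv x z hz.1.le
    rw [hz0] at this
    nlinarith [hz.2]
  · obtain ⟨z, hz, hz0⟩ := rolle (x - 2 * π)
    have := mv z x (by linarith [hz.2])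
    rw [hz0] at this
    nlinarith [hz.1]

lemma R2_logsin : R2 (fun θ _ => log (sin θ)) := by
  refine R2.of_contDiffOn ?_ (fun _ _ => rfl)
  refine ContDiffOn.log ?_ (fun p hp => sin_ne_D hp.1)
  exact (contDiff_sin.comp contDiff_fst).contDiffOn

lemma logsin_θ {θ : ℝ} (h : θ ∈ Ioo (0 : ℝ) π) (φ : ℝ) :
    pdθ (fun θ _ => log (sin θ)) θ φ = cos θ / sin θ :=
  ((hasDerivAt_sin θ).log (sin_ne_D h)).deriv

lemma logsin_φ (θ φ : ℝ) : pdφ (fun θ _ => log (sin θ)) θ φ = 0 := by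
  unfold pdφ
  simp

lemma logsin_θθ {θ : ℝ} (h : θ ∈ Ioo (0 : ℝ) π) (φ : ℝ) :
    pdθ (pdθ (fun θ _ => log (sin θ))) θ φ = -(sin θ ^ 2)⁻¹ := by
  have hs := sin_ne_D h
  have h1 : HasDerivAt (fun x => cos x / sin x) (-(sin θ ^ 2)⁻¹) θ := by
    refine ((hasDerivAt_cos θ).div (hasDerivAt_sin θ) hs).congr_deriv ?_
    have := sin_sq_add_cos_sq θ
    field_simp
    nlinarith
  have h2 : HasDerivAt (fun x => pdθ (fun θ _ => log (sin θ)) x φ) (-(sin θ ^ 2)⁻¹) θ := by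
    refine h1.congr_of_eventuallyEq ?_
    filter_upwards [isOpen_Ioo.mem_nhds h] with x hx using logsin_θ hx φ
  exact h2.deriv

lemma bd_of_limits {f f' : ℝ → ℝ} {C b : ℝ} (d : ∀ θ ∈ Ioo (0 : ℝ) π, HasDerivAt f (f' θ) θ)
    (hb : ∀ θ ∈ Ioo (0 : ℝ) π, |f' θ| ≤ C * sin θ) :
    (Tendsto f (nhdsWithin 0 (Ioi 0)) (nhds b) →
      ∀ θ ∈ Ioo (0 : ℝ) π, |f θ - b| ≤ C * (1 - cos θ)) ∧
    (Tendsto f (nhdsWithin π (Iio π)) (nhds b) →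
      ∀ θ ∈ Ioo (0 : ℝ) π, |f θ - b| ≤ C * (1 + cos θ)) := by
  have d1 : ∀ θ ∈ Ioo (0 : ℝ) π, HasDerivAt (fun x => f x - C * cos x) (f' θ + C * sin θ) θ :=
    fun θ hθ => ((d θ hθ).sub ((hasDerivAt_cos θ).const_mul C)).congr_deriv (by ring)
  have d2 : ∀ θ ∈ Ioo (0 : ℝ) π, HasDerivAt (fun x => f x + C * cos x) (f' θ - C * sin θ) θ :=
    fun θ hθ => ((d θ hθ).add ((hasDerivAt_cos θ).const_mul C)).congr_deriv (by ring)
  have m1 : MonotoneOn (fun x => f x - C * cos x) (Ioo 0 π) := by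
    refine monotoneOn_of_deriv_nonneg (convex_Ioo 0 π)
      (fun x hx => (d1 x hx).continuousAt.continuousWithinAt) ?_ ?_
    · rw [interior_Ioo]
      exact fun x hx => (d1 x hx).differentiableAt.differentiableWithinAt
    · rw [interior_Ioo]
      intro x hx
      rw [(d1 x hx).deriv]
      linarith [(abs_le.1 (hb x hx)).1]
  have m2 : AntitoneOn (fun x => f x + C * cos x) (Ioo 0 π) := by
    refine antitoneOn_of_deriv_nonpos (convex_Ioo 0 π)
      (fun x hx => (d2 x hx).continuousAt.continuousWithinAt) ?_ ?_
    · rw [interior_Ioo]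
      exact fun x hx => (d2 x hx).differentiableAt.differentiableWithinAt
    · rw [interior_Ioo]
      intro x hx
      rw [(d2 x hx).deriv]
      linarith [(abs_le.1 (hb x hx)).2]
  have cc : Continuous (fun x => C * cos x) := by fun_prop
  constructor
  · intro hl θ hθ
    have c1 : Tendsto (fun x => C * cos x) (nhdsWithin 0 (Ioi 0)) (nhds C) := by
      simpa using (cc.tendsto 0).mono_left nhdsWithin_le_nhds
    have e1 : b - C ≤ f θ - C * cos θ := by
      refine le_of_tendsto (hl.sub c1) ?_
      filter_upwards [Ioo_mem_nhdsGT hθ.1] with x hx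
      exact m1 ⟨hx.1, hx.2.trans hθ.2⟩ hθ hx.2.le
    have e2 : f θ + C * cos θ ≤ b + C := by
      refine ge_of_tendsto (hl.add c1) ?_
      filter_upwards [Ioo_mem_nhdsGT hθ.1] with x hx
      exact m2 ⟨hx.1, hx.2.trans hθ.2⟩ hθ hx.2.le
    rw [abs_le]
    constructor <;> linarith
  · intro hl θ hθ
    have c1 : Tendsto (fun x => C * cos x) (nhdsWithin π (Iio π)) (nhds (-C)) := by
      simpa using (cc.tendsto π).mono_left nhdsWithin_le_nhds
    have e1 : f θ - C * cos θ ≤ b - -C := by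
      refine ge_of_tendsto (hl.sub c1) ?_
      filter_upwards [Ioo_mem_nhdsLT hθ.2] with x hx
      exact m1 hθ ⟨hθ.1.trans hx.1, hx.2⟩ hx.1.le
    have e2 : b + -C ≤ f θ + C * cos θ := by
      refine le_of_tendsto (hl.add c1) ?_
      filter_upwards [Ioo_mem_nhdsLT hθ.2] with x hx
      exact m2 hθ ⟨hθ.1.trans hx.1, hx.2⟩ hx.1.le
    rw [abs_le]
    constructor <;> linarith


structure Bar (a C : ℝ) (Φ L v : ℝ → ℝ → ℝ) : Prop where
  rΦ : R2 Φ
  rL : R2 L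
  rv : R2 v
  one : 1 ≤ C
  cr : Crit a (fun θ φ => Φ θ φ - L θ φ) v
  e1 : ∀ θ ∈ Ioo (0 : ℝ) π, ∀ φ, exp (2 * (Φ θ φ - L θ φ)) * sin θ ^ 2 ≤ C
  e2 : ∀ θ ∈ Ioo (0 : ℝ) π, ∀ φ, exp (-(2 * (Φ θ φ - L θ φ))) ≤ C * sin θ ^ 2
  v3 : ∀ θ ∈ Ioo (0 : ℝ) π, ∀ φ, |v θ φ - a| ≤ C * (1 - cos θ)
  v4 : ∀ θ ∈ Ioo (0 : ℝ) π, ∀ φ, |v θ φ + a| ≤ C * (1 + cos θ)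
  bΦ : ∀ θ ∈ Ioo (0 : ℝ) π, ∀ φ, |Φ θ φ| ≤ C
  bΦ1 : ∀ θ ∈ Ioo (0 : ℝ) π, ∀ φ, |pdθ Φ θ φ| ≤ C
  bΦ2 : ∀ θ ∈ Ioo (0 : ℝ) π, ∀ φ, |pdφ Φ θ φ| ≤ C * sin θ
  bL1 : ∀ θ ∈ Ioo (0 : ℝ) π, ∀ φ, |sin θ * pdθ L θ φ - cos θ| ≤ C * sin θ
  bL2 : ∀ θ ∈ Ioo (0 : ℝ) π, ∀ φ, |pdφ L θ φ| ≤ C * sin θ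
  bΔ : ∀ θ ∈ Ioo (0 : ℝ) π, ∀ φ, |lapS2 L θ φ| ≤ C
  hM : ∀ θ ∈ Ioo (0 : ℝ) π, ∀ φ, M1 (fun θ φ => Φ θ φ - L θ φ) v θ φ = 0 ∧
      M2 (fun θ φ => Φ θ φ - L θ φ) v θ φ = 0
  w1 : ∀ θ ∈ Ioo (0 : ℝ) π, ∀ φ, exp (L θ φ) ≤ C * sin θ
  w2 : ∀ θ ∈ Ioo (0 : ℝ) π, ∀ φ, sin θ ≤ C * exp (L θ φ)

lemma grad_split {x y s K : ℝ} (hs : 0 < s) (hK : 0 ≤ K) (h : x ^ 2 + (s ^ 2)⁻¹ * y ^ 2 ≤ K ^ 2) :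
    |x| ≤ K ∧ |y| ≤ K * s := by
  have e : (s ^ 2)⁻¹ * y ^ 2 = (y / s) ^ 2 := by field_simp
  rw [e] at h
  have hx : x ^ 2 ≤ K ^ 2 := by nlinarith [sq_nonneg (y / s)]
  have hy : (y / s) ^ 2 ≤ K ^ 2 := by nlinarith [sq_nonneg x]
  refine ⟨abs_le_of_sq_le_sq hx hK, ?_⟩
  have := abs_le_of_sq_le_sq hy hK
  rw [abs_div, abs_of_pos hs, div_le_iff₀ hs] at this
  exact this

set_option maxHeartbeats 2000000 in
lemma bar_core {a K : ℝ} {Φ L v : ℝ → ℝ → ℝ} (ha : 0 < a) (hK : 0 ≤ K) (rΦ : R2 Φ) (rL : R2 L)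
    (rv : R2 v)
    (hM : ∀ θ ∈ Ioo (0 : ℝ) π, ∀ φ, M1 (fun θ φ => Φ θ φ - L θ φ) v θ φ = 0 ∧
      M2 (fun θ φ => Φ θ φ - L θ φ) v θ φ = 0)
    (bΦ : ∀ θ ∈ Ioo (0 : ℝ) π, ∀ φ, |Φ θ φ| ≤ K)
    (gΦ : ∀ θ ∈ Ioo (0 : ℝ) π, ∀ φ, pdθ Φ θ φ ^ 2 + (sin θ ^ 2)⁻¹ * pdφ Φ θ φ ^ 2 ≤ K ^ 2)
    (gv : ∀ θ ∈ Ioo (0 : ℝ) π, ∀ φ, pdθ v θ φ ^ 2 + (sin θ ^ 2)⁻¹ * pdφ v θ φ ^ 2 ≤ K ^ 2)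
    (lΦ : ∀ θ ∈ Ioo (0 : ℝ) π, ∀ φ, |lapS2 Φ θ φ| ≤ 2 * K)
    (lv : ∀ θ ∈ Ioo (0 : ℝ) π, ∀ φ, |lapS2 v θ φ| ≤ 2 * K)
    (f0 : ∀ θ ∈ Ioo (0 : ℝ) π, ∀ φ, |L θ φ - log (sin θ)| ≤ K)
    (f1 : ∀ θ ∈ Ioo (0 : ℝ) π, ∀ φ, |pdθ L θ φ - cos θ / sin θ| ≤ K)
    (f2 : ∀ θ ∈ Ioo (0 : ℝ) π, ∀ φ, |pdθ (pdθ L) θ φ + (sin θ ^ 2)⁻¹| ≤ K)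
    (htrN : ∀ φ : ℝ, Tendsto (fun θ => v θ φ) (nhdsWithin 0 (Ioi 0)) (nhds a))
    (htrS : ∀ φ : ℝ, Tendsto (fun θ => v θ φ) (nhdsWithin π (Iio π)) (nhds (-a))) :
    ∃ C, Bar a C Φ L v := by
  have pp := pi_pos
  set u : ℝ → ℝ → ℝ := fun θ φ => Φ θ φ - L θ φ with hu
  have ru : R2 u := rΦ.sub rL
  have E := fun θ (hθ : θ ∈ Ioo (0 : ℝ) π) => exp_log (sin_pos_D hθ)
  -- exponentials
  have e1 : ∀ θ ∈ Ioo (0 : ℝ) π, ∀ φ, exp (2 * u θ φ) * sin θ ^ 2 ≤ exp (4 * K) := by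
    intro θ hθ φ
    have h1 := abs_le.1 (bΦ θ hθ φ)
    have h2 := abs_le.1 (f0 θ hθ φ)
    conv_lhs => rw [← E θ hθ, ← exp_nat_mul, ← exp_add]
    apply exp_le_exp.2
    simp only [hu]
    push_cast
    linarith
  have e2 : ∀ θ ∈ Ioo (0 : ℝ) π, ∀ φ, exp (-(2 * u θ φ)) ≤ exp (4 * K) * sin θ ^ 2 := by
    intro θ hθ φ
    have h1 := abs_le.1 (bΦ θ hθ φ)
    have h2 := abs_le.1 (f0 θ hθ φ)
    conv_rhs => rw [← E θ hθ, ← exp_nat_mul, ← exp_add]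
    apply exp_le_exp.2
    simp only [hu]
    push_cast
    linarith
  have w1 : ∀ θ ∈ Ioo (0 : ℝ) π, ∀ φ, exp (L θ φ) ≤ exp (4 * K) * sin θ := by
    intro θ hθ φ
    have h2 := abs_le.1 (f0 θ hθ φ)
    conv_rhs => rw [← E θ hθ, ← exp_add]
    apply exp_le_exp.2
    linarith
  have w2 : ∀ θ ∈ Ioo (0 : ℝ) π, ∀ φ, sin θ ≤ exp (4 * K) * exp (L θ φ) := by
    intro θ hθ φ
    have h2 := abs_le.1 (f0 θ hθ φ)
    conv_lhs => rw [← E θ hθ]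
    rw [← exp_add]
    apply exp_le_exp.2
    linarith
  -- the angular derivative of L
  have hlapL : ∀ θ ∈ Ioo (0 : ℝ) π, ∀ φ,
      lapS2 L θ φ = lapS2 Φ θ φ - 2 * exp (4 * u θ φ) * gradNormSqS2 v θ φ := by
    intro θ hθ φ
    have h := (hM θ hθ φ).1
    unfold M1 at h
    rw [rΦ.sub_lap rL hθ] at h
    linarith
  have hgn : ∀ θ φ, 0 ≤ gradNormSqS2 v θ φ := by
    intro θ φ
    unfold gradNormSqS2 gradDotS2
    rw [mul_assoc, ← sq, ← sq]
    positivity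
  have hL22 : ∀ θ ∈ Ioo (0 : ℝ) π, ∀ φ, pdφ (pdφ L) θ φ ≤ (4 * K + 1) * sin θ := by
    intro θ hθ φ
    have hs := sin_pos_D hθ
    have hs1 := sin_le_one θ
    have h1 := abs_le.1 (lΦ θ hθ φ)
    have h2 := abs_le.1 (f1 θ hθ φ)
    have h3 := abs_le.1 (f2 θ hθ φ)
    have h4 := hlapL θ hθ φ
    have h5 : 0 ≤ 2 * exp (4 * u θ φ) * gradNormSqS2 v θ φ := by
      have := hgn θ φ; positivity
    have h6 : lapS2 L θ φ ≤ 2 * K := by linarith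
    unfold lapS2 at h6
    set r1 := pdθ (pdθ L) θ φ + (sin θ ^ 2)⁻¹ with hr1
    set r2 := pdθ L θ φ - cos θ / sin θ with hr2
    have q1 : pdθ (pdθ L) θ φ = r1 - (sin θ ^ 2)⁻¹ := by rw [hr1]; ring
    have q2 : pdθ L θ φ = r2 + cos θ / sin θ := by rw [hr2]; ring
    rw [q1, q2] at h6
    have h7 : pdφ (pdφ L) θ φ = sin θ ^ 2 * (r1 - (sin θ ^ 2)⁻¹ + cos θ / sin θ * (r2 + cos θ / sin θ)
        + (sin θ ^ 2)⁻¹ * pdφ (pdφ L) θ φ) - sin θ ^ 2 * r1 + 1 - cos θ * sin θ * r2 - cos θ ^ 2 := by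
      field_simp
      ring
    have h8 := mul_le_mul_of_nonneg_left h6 (sq_nonneg (sin θ))
    have h9 : |cos θ * r2| ≤ 1 * K := by
      rw [abs_mul]
      exact mul_le_mul (abs_cos_le_one θ) (f1 θ hθ φ) (abs_nonneg _) zero_le_one
    have h10 := (abs_le.1 h9).1
    have h11 : sin θ ^ 2 ≤ sin θ := by nlinarith
    have := sin_sq_add_cos_sq θ
    rw [h7]
    nlinarith [mul_le_mul_of_nonneg_left h3.1 (sq_nonneg (sin θ)), mul_le_mul_of_nonneg_left h10 hs.le,
      mul_le_mul_of_nonneg_left h11 hK]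
  have hL2 : ∀ θ ∈ Ioo (0 : ℝ) π, ∀ φ, |pdφ L θ φ| ≤ (2 * π * (4 * K + 1)) * sin θ := by
    intro θ hθ φ
    have hs := sin_pos_D hθ
    have := per_deriv_bd (h := L θ) (K := (4 * K + 1) * sin θ) (by positivity) (rL.per θ) (rL.d2 θ hθ) (rL.d22 θ hθ)
      (hL22 θ hθ) φ
    linarith
  set K1 := 2 * π * (4 * K + 1) with hK1
  have hK1p : 0 ≤ K1 := by positivity
  -- the decay of v
  set K3 := 2 * K + 8 * K ^ 2 + 4 * (K + K1) * K + K with hK3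
  have hK3p : 0 ≤ K3 := by positivity
  have hv1 : ∀ θ ∈ Ioo (0 : ℝ) π, ∀ φ, |pdθ v θ φ| ≤ K3 * sin θ := by
    intro θ hθ φ
    have hs := sin_pos_D hθ
    obtain ⟨a1, a2⟩ := grad_split hs hK (gΦ θ hθ φ)
    obtain ⟨b1, b2⟩ := grad_split hs hK (gv θ hθ φ)
    have h := (hM θ hθ φ).2
    unfold M2 gradDotS2 at h
    rw [rΦ.sub_θ rL hθ, rΦ.sub_φ rL hθ] at h
    set r2 := pdθ L θ φ - cos θ / sin θ with hr2
    have q2 : pdθ L θ φ = r2 + cos θ / sin θ := by rw [hr2]; ring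
    rw [q2] at h
    have key : 4 * (cos θ * pdθ v θ φ) = sin θ * (lapS2 v θ φ + 4 * (pdθ Φ θ φ - r2) * pdθ v θ φ)
        + 4 * (pdφ Φ θ φ - pdφ L θ φ) * (pdφ v θ φ / sin θ) := by
      have := congrArg (fun x => sin θ * x) h
      field_simp at this ⊢
      linarith
    have hr : |r2| ≤ K := f1 θ hθ φ
    have t1 : |(pdθ Φ θ φ - r2) * pdθ v θ φ| ≤ (K + K) * K := by
      rw [abs_mul]
      exact mul_le_mul ((abs_sub _ _).trans (add_le_add a1 hr)) b1 (abs_nonneg _) (by positivity)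
    have t2 : |(pdφ Φ θ φ - pdφ L θ φ) * (pdφ v θ φ / sin θ)| ≤ (K * sin θ + K1 * sin θ) * K := by
      rw [abs_mul]
      refine mul_le_mul ((abs_sub _ _).trans (add_le_add a2 (hL2 θ hθ φ))) ?_ (abs_nonneg _) (by positivity)
      rw [abs_div, abs_of_pos hs, div_le_iff₀ hs]
      exact b2
    have t3 := abs_le.1 (lv θ hθ φ)
    have t4 := abs_le.1 t1
    have t5 := abs_le.1 t2
    have t6 : |4 * (cos θ * pdθ v θ φ)| ≤ (2 * K + 8 * K ^ 2 + 4 * (K + K1) * K) * sin θ := by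
      rw [key, abs_le]
      constructor <;> nlinarith
    have t7 : |pdθ v θ φ| ≤ sin θ * K + |cos θ * pdθ v θ φ| := by
      have e : pdθ v θ φ = sin θ * (sin θ * pdθ v θ φ) + cos θ * (cos θ * pdθ v θ φ) := by
        have := sin_sq_add_cos_sq θ
        linear_combination -(pdθ v θ φ) * this
      calc |pdθ v θ φ| = |sin θ * (sin θ * pdθ v θ φ) + cos θ * (cos θ * pdθ v θ φ)| := by rw [← e]
        _ ≤ |sin θ * (sin θ * pdθ v θ φ)| + |cos θ * (cos θ * pdθ v θ φ)| := abs_add_le _ _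
        _ ≤ _ := by
          rw [abs_mul, abs_of_pos hs, abs_mul (cos θ) (cos θ * _), abs_mul (sin θ), abs_of_pos hs]
          refine add_le_add (mul_le_mul_of_nonneg_left ?_ hs.le) ?_
          · nlinarith [sin_le_one θ, abs_nonneg (pdθ v θ φ)]
          · nlinarith [abs_cos_le_one θ, abs_nonneg (cos θ * pdθ v θ φ)]
    rw [abs_mul, abs_of_pos (by norm_num : (0:ℝ) < 4)] at t6
    nlinarith [abs_nonneg (cos θ * pdθ v θ φ)]
  have v3 : ∀ θ ∈ Ioo (0 : ℝ) π, ∀ φ, |v θ φ - a| ≤ K3 * (1 - cos θ) := fun θ hθ φ =>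
    (bd_of_limits (f := fun x => v x φ) (fun x hx => rv.d1 x hx φ) (fun x hx => hv1 x hx φ)).1 (htrN φ) θ hθ
  have v4 : ∀ θ ∈ Ioo (0 : ℝ) π, ∀ φ, |v θ φ + a| ≤ K3 * (1 + cos θ) := by
    intro θ hθ φ
    have := (bd_of_limits (f := fun x => v x φ) (fun x hx => rv.d1 x hx φ) (fun x hx => hv1 x hx φ)).2 (htrS φ) θ hθ
    simpa using this
  -- classification
  set C0 := exp (4 * K) + K3 with hC0
  have C0p : 0 < C0 := by positivity
  have hE : exp (4 * K) ≤ C0 := by linarith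
  have hE3 : K3 ≤ C0 := by have := exp_pos (4 * K); linarith
  have cr : Crit a u v := classify ha ru rv C0p hM (fun θ hθ φ => (e1 θ hθ φ).trans hE)
    (fun θ hθ φ => (e2 θ hθ φ).trans (by gcongr))
    (fun θ hθ φ => (v3 θ hθ φ).trans (mul_le_mul_of_nonneg_right hE3 (cos_bd hθ).2.le))
    (fun θ hθ φ => (v4 θ hθ φ).trans (mul_le_mul_of_nonneg_right hE3 (cos_bd hθ).1.le))
  have hΔ : ∀ θ ∈ Ioo (0 : ℝ) π, ∀ φ, |lapS2 L θ φ| ≤ 2 * K + exp (4 * K) ^ 2 / (2 * a ^ 2) := by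
    intro θ hθ φ
    have hs := sin_pos_D hθ
    have hg : exp (4 * u θ φ) * gradNormSqS2 v θ φ = (exp (-(2 * u θ φ)) / sin θ) ^ 2 / (4 * a ^ 2) := by
      unfold gradNormSqS2 gradDotS2
      rw [cr.v1 θ hθ, cr.v2 θ hθ]
      have q : exp (4 * u θ φ) * exp (-(4 * u θ φ)) = 1 := by rw [← exp_add]; simp
      have q2 : exp (-(4 * u θ φ)) = exp (-(2 * u θ φ)) ^ 2 := by rw [← exp_nat_mul]; congr 1; push_cast; ring
      rw [q2] at q ⊢
      have : exp (4 * u θ φ) * (-(exp (-(2 * u θ φ)) ^ 2 / (2 * a)) * (sin θ)⁻¹ * (-(exp (-(2 * u θ φ)) ^ 2 / (2 * a)) * (sin θ)⁻¹) + (sin θ ^ 2)⁻¹ * 0 * 0) =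
        (exp (4 * u θ φ) * exp (-(2 * u θ φ)) ^ 2) * (exp (-(2 * u θ φ)) / sin θ) ^ 2 / (4 * a ^ 2) := by
        field_simp
        ring
      rw [this, q, one_mul]
    have h0 : exp (-(2 * u θ φ)) / sin θ ≤ exp (4 * K) := by
      rw [div_le_iff₀ hs]
      refine (e2 θ hθ φ).trans ?_
      have := exp_pos (4 * K)
      gcongr
      nlinarith [sin_le_one θ]
    have h1 : exp (4 * u θ φ) * gradNormSqS2 v θ φ ≤ exp (4 * K) ^ 2 / (4 * a ^ 2) := by
      rw [hg]
      gcongr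
    have h2 : 0 ≤ exp (4 * u θ φ) * gradNormSqS2 v θ φ := by
      have := hgn θ φ; positivity
    have h3 := hlapL θ hθ φ
    have h4 := abs_le.1 (lΦ θ hθ φ)
    have h5 : exp (4 * K) ^ 2 / (2 * a ^ 2) = 2 * (exp (4 * K) ^ 2 / (4 * a ^ 2)) := by field_simp; norm_num
    rw [h5, abs_le]
    constructor <;> nlinarith
  set C := C0 + K + K1 + (2 * K + exp (4 * K) ^ 2 / (2 * a ^ 2)) + 1 with hC
  have i0 : 0 ≤ 2 * K + exp (4 * K) ^ 2 / (2 * a ^ 2) := by positivity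
  have j1 : exp (4 * K) ≤ C := by linarith
  have j2 : K3 ≤ C := by linarith
  have j3 : K ≤ C := by linarith
  have j4 : K1 ≤ C := by linarith
  have j5 : 2 * K + exp (4 * K) ^ 2 / (2 * a ^ 2) ≤ C := by linarith
  refine ⟨C, rΦ, rL, rv, by linarith, cr, fun θ hθ φ => (e1 θ hθ φ).trans j1,
    fun θ hθ φ => (e2 θ hθ φ).trans (by gcongr),
    fun θ hθ φ => (v3 θ hθ φ).trans (mul_le_mul_of_nonneg_right j2 (cos_bd hθ).2.le),
    fun θ hθ φ => (v4 θ hθ φ).trans (mul_le_mul_of_nonneg_right j2 (cos_bd hθ).1.le),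
    fun θ hθ φ => (bΦ θ hθ φ).trans j3,
    fun θ hθ φ => (grad_split (sin_pos_D hθ) hK (gΦ θ hθ φ)).1.trans j3,
    fun θ hθ φ => (grad_split (sin_pos_D hθ) hK (gΦ θ hθ φ)).2.trans
      (mul_le_mul_of_nonneg_right j3 (sin_pos_D hθ).le), ?_,
    fun θ hθ φ => (hL2 θ hθ φ).trans (mul_le_mul_of_nonneg_right j4 (sin_pos_D hθ).le),
    fun θ hθ φ => (hΔ θ hθ φ).trans j5, hM,
    fun θ hθ φ => (w1 θ hθ φ).trans (mul_le_mul_of_nonneg_right j1 (sin_pos_D hθ).le),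
    fun θ hθ φ => (w2 θ hθ φ).trans (mul_le_mul_of_nonneg_right j1 (exp_pos _).le)⟩
  intro θ hθ φ
  have hs := sin_pos_D hθ
  have : sin θ * pdθ L θ φ - cos θ = (pdθ L θ φ - cos θ / sin θ) * sin θ := by field_simp
  rw [this, abs_mul, abs_of_pos hs]
  exact mul_le_mul_of_nonneg_right ((f1 θ hθ φ).trans j3) hs.le


lemma ck_bounds {f : ℝ → ℝ → ℝ} (h : CkSphere 3 f) :
    R2 f ∧ ∃ C, 0 ≤ C ∧ ∀ θ ∈ Ioo (0 : ℝ) π, ∀ φ, |f θ φ| ≤ C ∧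
      pdθ f θ φ ^ 2 + (sin θ ^ 2)⁻¹ * pdφ f θ φ ^ 2 ≤ C ^ 2 ∧ |lapS2 f θ φ| ≤ 2 * C := by
  obtain ⟨hc, hp, C, hC⟩ := h
  have h0 : ∀ j θ φ, 0 ≤ covNorm j f θ φ := fun j θ φ => sqrt_nonneg _
  have hpi : π / 2 ∈ Ioo (0 : ℝ) π := ⟨by linarith [pi_pos], by linarith [pi_pos]⟩
  have hC0 : 0 ≤ C := (h0 0 _ 0).trans (hC 0 (by norm_num) _ hpi 0)
  refine ⟨R2.of_contDiffOn (hc.of_le (by norm_cast)) hp, C, hC0, fun θ hθ φ => ⟨?_, ?_, ?_⟩⟩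
  · rw [← covNorm0]
    exact hC 0 (by norm_num) θ hθ φ
  · refine (covNorm1 f θ φ).trans ?_
    have := hC 1 (by norm_num) θ hθ φ
    have := h0 1 θ φ
    gcongr
  · refine abs_le_of_sq_le_sq ((covNorm2 f θ φ).trans ?_) (by positivity)
    have h1 := hC 2 (by norm_num) θ hθ φ
    have h2 := h0 2 θ φ
    nlinarith

lemma bar_exists
    (ω : ℝ → ℝ → ℝ) (a : ℝ) (ha : 0 < a)
    (hωpos : ∀ θ ∈ Ioo (0 : ℝ) π, ∀ φ : ℝ, 0 < ω θ φ)
    (hωper : ∀ θ φ : ℝ, ω θ (φ + 2 * π) = ω θ φ)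
    (hωsmooth : ContDiffOn ℝ (⊤ : ℕ∞) (fun p : ℝ × ℝ => ω p.1 p.2)
      (Ioo 0 π ×ˢ (univ : Set ℝ)))
    (hωext : ∀ l n : ℕ, l + n ≤ 10 → ∃ G : ℝ → ℝ → ℝ,
      ContinuousOn (fun p : ℝ × ℝ => G p.1 p.2) (Icc 0 π ×ˢ (univ : Set ℝ)) ∧
      ∀ θ ∈ Ioo (0 : ℝ) π, ∀ φ : ℝ,
        G θ φ = (pdθ^[l] (pdφ^[n]
          (fun θ φ => Real.log (ω θ φ) - Real.log (Real.sin θ)))) θ φ)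
    (Φb vb : ℝ → ℝ → ℝ)
    (hΦb : CkSphere 3 Φb) (hvb : CkSphere 3 vb)
    (hcrit : ∀ θ ∈ Ioo (0 : ℝ) π, ∀ φ : ℝ,
      Mop1 ω Φb vb θ φ = 0 ∧ Mop2 ω Φb vb θ φ = 0)
    (htrN : ∀ φ : ℝ, Tendsto (fun θ => vb θ φ) (nhdsWithin 0 (Ioi 0)) (nhds a))
    (htrS : ∀ φ : ℝ, Tendsto (fun θ => vb θ φ) (nhdsWithin π (Iio π)) (nhds (-a))) :
    ∃ C, Bar a C Φb (fun θ φ => log (ω θ φ)) vb := by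
  obtain ⟨rΦ, K1, hK1, b1⟩ := ck_bounds hΦb
  obtain ⟨rv, K2, hK2, b2⟩ := ck_bounds hvb
  have rL : R2 (fun θ φ => log (ω θ φ)) := by
    refine R2.of_contDiffOn ?_ (fun θ φ => by rw [hωper])
    exact ContDiffOn.log (hωsmooth.of_le (by norm_cast)) (fun p hp => (hωpos p.1 hp.1 p.2).ne')
  have rf := rL.sub R2_logsin
  obtain ⟨A0, hA0⟩ := ext_bd rf.per (hωext 0 0 (by norm_num))
  obtain ⟨A1, hA1⟩ := ext_bd (per_pdθ rf.per) (hωext 1 0 (by norm_num))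
  obtain ⟨A2, hA2⟩ := ext_bd (per_pdθ (per_pdθ rf.per)) (hωext 2 0 (by norm_num))
  set K := K1 + K2 + |A0| + |A1| + |A2| with hK
  have p0 := abs_nonneg A0
  have p1 := abs_nonneg A1
  have p2 := abs_nonneg A2
  have q0 := le_abs_self A0
  have q1 := le_abs_self A1
  have q2 := le_abs_self A2
  have hKp : 0 ≤ K := by positivity
  have k1 : K1 ≤ K := by linarith
  have k2 : K2 ≤ K := by linarith
  refine bar_core ha hKp rΦ rL rv ?_ (fun θ hθ φ => (b1 θ hθ φ).1.trans k1)
    (fun θ hθ φ => (b1 θ hθ φ).2.1.trans (by gcongr)) (fun θ hθ φ => (b2 θ hθ φ).2.1.trans (by gcongr))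
    (fun θ hθ φ => (b1 θ hθ φ).2.2.trans (by gcongr)) (fun θ hθ φ => (b2 θ hθ φ).2.2.trans (by gcongr))
    (fun θ hθ φ => (hA0 θ hθ φ).trans (by linarith)) ?_ ?_ htrN htrS
  · intro θ hθ φ
    refine ⟨?_, (hcrit θ hθ φ).2⟩
    have := (hcrit θ hθ φ).1
    unfold Mop1 at this
    unfold M1
    rw [rΦ.sub_lap rL hθ]
    linarith
  · intro θ hθ φ
    have := hA1 θ hθ φ
    rw [Function.iterate_zero_apply, rL.sub_θ R2_logsin hθ, logsin_θ hθ] at this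
    linarith
  · intro θ hθ φ
    have := hA2 θ hθ φ
    rw [Function.iterate_zero_apply, rL.sub_θθ R2_logsin hθ, logsin_θθ hθ, sub_neg_eq_add] at this
    linarith


/-- pointwise data of a perturbation of the base map -/
structure Pt (a C η s U V p q : ℝ) : Prop where
  ha : 0 < a
  hC : 1 ≤ C
  hη : 0 ≤ η
  hη4 : η ≤ 1 / 4
  hs : 0 < s
  hs1 : s ≤ 1
  e1 : exp (2 * U) * s ^ 2 ≤ C
  e2 : exp (-(2 * U)) ≤ C * s ^ 2
  hX : Xr a U V = 0
  hp : |p| ≤ η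
  hq : |q| ≤ η * s ^ 3

lemma mul_bd {x y A B : ℝ} (hx : |x| ≤ A) (hy : |y| ≤ B) : |x * y| ≤ A * B := by
  rw [abs_mul]
  exact mul_le_mul hx hy (abs_nonneg _) ((abs_nonneg _).trans hx)

lemma add_bd {x y A B : ℝ} (hx : |x| ≤ A) (hy : |y| ≤ B) : |x + y| ≤ A + B :=
  (abs_add_le x y).trans (add_le_add hx hy)

lemma sub_bd {x y A B : ℝ} (hx : |x| ≤ A) (hy : |y| ≤ B) : |x - y| ≤ A + B :=
  (abs_sub x y).trans (add_le_add hx hy)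

section
variable {a C η s U V p q : ℝ}

lemma exp_split (U p : ℝ) : exp (2 * (U + p)) = exp (2 * U) * exp (2 * p) := by
  rw [← exp_add]; ring_nf

lemma exp_split' (U p : ℝ) : exp (-(2 * (U + p))) = exp (-(2 * U)) * exp (-(2 * p)) := by
  rw [← exp_add]; ring_nf

lemma EI (U : ℝ) : exp (2 * U) * exp (-(2 * U)) = 1 := by
  rw [← exp_add]; simp

namespace Pt
lemma t1 (h : Pt a C η s U V p q) : |exp (2 * p) - 1| ≤ 4 * η := by
  have := h.hp; have := h.hη4
  refine (abs_exp_sub_one_le ?_).trans ?_ <;> rw [abs_mul, abs_two] <;> linarith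

lemma r1 (h : Pt a C η s U V p q) : |exp (-(2 * p)) - 1| ≤ 4 * η := by
  have := h.hp; have := h.hη4
  refine (abs_exp_sub_one_le ?_).trans ?_ <;> rw [abs_neg, abs_mul, abs_two] <;> linarith

lemma t2 (h : Pt a C η s U V p q) : |exp (2 * p)| ≤ 2 := by
  have := abs_le.1 h.t1; have := h.hη4
  rw [abs_le]; constructor <;> linarith

lemma r2 (h : Pt a C η s U V p q) : |exp (-(2 * p))| ≤ 2 := by
  have := abs_le.1 h.r1; have := h.hη4
  rw [abs_le]; constructor <;> linarith

lemma Vsq (h : Pt a C η s U V p q) : V ^ 2 + exp (-(2 * U)) ^ 2 / 4 = a ^ 2 := by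
  have h0 := h.hX
  have ha := h.ha
  have := EI U
  unfold Xr at h0
  set E := exp (2 * U)
  set I := exp (-(2 * U))
  have h1 : I * (E * (a - V ^ 2 / a) - I / (4 * a)) = 0 := by rw [h0, mul_zero]
  have h2 : I * (E * (a - V ^ 2 / a) - I / (4 * a)) = (E * I) * (a - V ^ 2 / a) - I ^ 2 / (4 * a) := by ring
  rw [h2, this] at h1
  field_simp at h1
  linarith

lemma Vle (h : Pt a C η s U V p q) : |V| ≤ a := by
  refine abs_le_of_sq_le_sq ?_ h.ha.le
  have := h.Vsq
  nlinarith [sq_nonneg (exp (-(2 * U)))]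

lemma s3 (h : Pt a C η s U V p q) : s ^ 3 ≤ 1 := pow_le_one₀ h.hs.le h.hs1

lemma qle (h : Pt a C η s U V p q) : |q| ≤ 1 := by
  refine h.hq.trans ?_
  have := h.s3; have := h.hη; have := h.hη4; have := pow_pos h.hs 3
  nlinarith

lemma vle (h : Pt a C η s U V p q) : |(V + q) / a| ≤ (a + 1) / a := by
  rw [abs_div, abs_of_pos h.ha]
  have := add_bd h.Vle h.qle
  have := h.ha
  gcongr

lemma qq (h : Pt a C η s U V p q) : |(2 * V + q) / a| ≤ (2 * a + 1) / a := by
  rw [abs_div, abs_of_pos h.ha]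
  have h1 : |2 * V| ≤ 2 * a := by rw [abs_mul, abs_two]; linarith [h.Vle]
  have := add_bd h1 h.qle
  have := h.ha
  gcongr

/-- weight times a quantity vanishing like `s ^ 2 * (η * s ^ k)` -/
lemma Emul (h : Pt a C η s U V p q) {x y : ℝ} (hx : |x| ≤ y * s ^ 2) : |exp (2 * U) * x| ≤ C * y := by
  have hs := h.hs
  have e := h.e1
  have hy : 0 ≤ y := by
    have := (abs_nonneg x).trans hx
    by_contra hc
    push Not at hc
    nlinarith [pow_pos hs 2]
  rw [abs_mul, abs_of_pos (exp_pos _)]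
  calc exp (2 * U) * |x| ≤ exp (2 * U) * (y * s ^ 2) := by gcongr
    _ = (exp (2 * U) * s ^ 2) * y := by ring
    _ ≤ C * y := by gcongr

lemma Ele (h : Pt a C η s U V p q) : |exp (-(2 * U))| ≤ C * s ^ 2 := by
  rw [abs_of_pos (exp_pos _)]; exact h.e2

lemma s2s (h : Pt a C η s U V p q) : s ^ 2 ≤ s := by
  have := h.hs; have := h.hs1; nlinarith

lemma X_eq (h : Pt a C η s U V p q) : Xr a (U + p) (V + q) =
    exp (-(2 * U)) * (exp (2 * p) - exp (-(2 * p))) / (4 * a)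
      - exp (2 * p) * (exp (2 * U) * q) * ((2 * V + q) / a) := by
  have h0 := h.hX
  have ha := h.ha
  unfold Xr at h0 ⊢
  rw [exp_split, exp_split']
  linear_combination (exp (2 * p)) * h0

lemma k_eq (h : Pt a C η s U V p q) : kr a (U + p) (V + q) =
    exp (-(2 * U)) * (exp (2 * p) + exp (-(2 * p))) / (4 * a)
      - exp (2 * p) * (exp (2 * U) * q) * ((2 * V + q) / a) := by
  have h0 := h.hX
  have ha := h.ha
  unfold Xr at h0
  unfold kr
  rw [exp_split, exp_split']
  linear_combination (exp (2 * p)) * h0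

lemma Eq (h : Pt a C η s U V p q) : |exp (2 * U) * q| ≤ C * (η * s) :=
  h.Emul (h.hq.trans (by ring_nf; rfl))

lemma Xq (h : Pt a C η s U V p q) :
    |exp (2 * p) * (exp (2 * U) * q) * ((2 * V + q) / a)| ≤ 2 * (C * (η * s)) * ((2 * a + 1) / a) :=
  mul_bd (mul_bd h.t2 h.Eq) h.qq

lemma X_bd (h : Pt a C η s U V p q) :
    |Xr a (U + p) (V + q)| ≤ (2 * C / a + 2 * C * ((2 * a + 1) / a)) * (η * s) := by
  have ha := h.ha
  have hC := h.hC
  rw [h.X_eq]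
  have h1 : |exp (2 * p) - exp (-(2 * p))| ≤ 8 * η := by
    have := sub_bd h.t1 h.r1
    rw [show exp (2 * p) - exp (-(2 * p)) = (exp (2 * p) - 1) - (exp (-(2 * p)) - 1) by ring]
    linarith
  have h2 : |exp (-(2 * U)) * (exp (2 * p) - exp (-(2 * p))) / (4 * a)| ≤ C * s * (8 * η) / (4 * a) := by
    rw [abs_div, abs_of_pos (by positivity : 0 < 4 * a)]
    have := mul_bd (h.Ele.trans (mul_le_mul_of_nonneg_left h.s2s (by linarith))) h1
    gcongr
  refine (sub_bd h2 h.Xq).trans (le_of_eq ?_)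
  field_simp
  ring

lemma k_bd (h : Pt a C η s U V p q) :
    |kr a (U + p) (V + q)| ≤ (2 * C / a + 2 * C * ((2 * a + 1) / a)) * s := by
  have ha := h.ha
  have hC := h.hC
  have hs := h.hs
  rw [h.k_eq]
  have h1 : |exp (2 * p) + exp (-(2 * p))| ≤ 4 := by
    have := add_bd h.t2 h.r2
    linarith
  have h2 : |exp (-(2 * U)) * (exp (2 * p) + exp (-(2 * p))) / (4 * a)| ≤ C * s * 4 / (4 * a) := by
    rw [abs_div, abs_of_pos (by positivity : 0 < 4 * a)]
    have := mul_bd (h.Ele.trans (mul_le_mul_of_nonneg_left h.s2s (by linarith))) h1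
    gcongr
  refine (sub_bd h2 h.Xq).trans ?_
  have h3 : 2 * (C * (η * s)) * ((2 * a + 1) / a) ≤ 2 * (C * (1 * s)) * ((2 * a + 1) / a) := by
    have := h.hη4
    gcongr; linarith
  have h4 : C * s * 4 / (4 * a) ≤ 2 * C / a * s := by
    rw [show C * s * 4 / (4 * a) = C / a * s by field_simp]
    gcongr; linarith
  linarith

/-- the coefficient of `dv` in the current -/
lemma j_bd (h : Pt a C η s U V p q) :
    |s * (exp (2 * (U + p)) * kr a (U + p) (V + q) - 1 / (2 * a))|
      ≤ (2 / a + 4 * C ^ 2 * ((2 * a + 1) / a)) * η := by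
  have ha := h.ha
  have hC := h.hC
  have hs := h.hs
  have e : s * (exp (2 * (U + p)) * kr a (U + p) (V + q) - 1 / (2 * a)) =
      s * (exp (4 * p) - 1) / (4 * a)
       - exp (2 * p) * exp (2 * p) * (exp (2 * U) * (exp (2 * U) * (s * q))) * ((2 * V + q) / a) := by
    rw [h.k_eq, exp_split]
    have i1 := EI U
    have i2 := EI p
    have i3 : exp (4 * p) = exp (2 * p) * exp (2 * p) := by rw [← exp_add]; ring_nf
    rw [i3]
    set E := exp (2 * U)
    set I := exp (-(2 * U))
    set t := exp (2 * p)
    set r := exp (-(2 * p))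
    linear_combination (s * (t * t + t * r) / (4 * a)) * i1 + s / (4 * a) * i2
  rw [e]
  have h1 : |exp (4 * p) - 1| ≤ 8 * η := by
    have := h.hp; have := h.hη4
    refine (abs_exp_sub_one_le ?_).trans ?_ <;> rw [abs_mul, abs_of_pos (by norm_num : (0:ℝ) < 4)] <;> linarith
  have h2 : |s * (exp (4 * p) - 1) / (4 * a)| ≤ 1 * (8 * η) / (4 * a) := by
    rw [abs_div, abs_of_pos (by positivity : 0 < 4 * a)]
    have := mul_bd ((abs_of_pos hs).le.trans h.hs1) h1
    gcongr
  have h3 : |s * q| ≤ (η * s ^ 2) * s ^ 2 := by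
    have := mul_bd (abs_of_pos hs).le h.hq
    refine this.trans (le_of_eq (by ring))
  have h4 : |exp (2 * U) * (s * q)| ≤ (C * η) * s ^ 2 := (h.Emul h3).trans (by ring_nf; rfl)
  have h5 := mul_bd (mul_bd (mul_bd h.t2 h.t2) (h.Emul h4)) h.qq
  refine (sub_bd h2 h5).trans (le_of_eq ?_)
  field_simp
  ring

lemma j_bd' (h : Pt a C η s U V p q) :
    |s * (exp (2 * (U + p)) * kr a (U + p) (V + q))|
      ≤ 2 / a + 4 * C ^ 2 * ((2 * a + 1) / a) + 1 / (2 * a) := by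
  have ha := h.ha
  have hC := h.hC
  have hs := h.hs
  have e : s * (exp (2 * (U + p)) * kr a (U + p) (V + q)) =
    s * (exp (2 * (U + p)) * kr a (U + p) (V + q) - 1 / (2 * a)) + s * (1 / (2 * a)) := by ring
  rw [e]
  refine (add_bd h.j_bd (B := 1 / (2 * a)) ?_).trans ?_
  · rw [abs_of_pos (by positivity)]
    have : 0 < 1 / (2 * a) := by positivity
    nlinarith [h.hs1]
  · have : 0 ≤ 2 / a + 4 * C ^ 2 * ((2 * a + 1) / a) := by positivity
    nlinarith [h.hη4]

end Pt
end


/-- constants -/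
def B0 (a C : ℝ) : ℝ := 2 * C / a + 2 * C * ((2 * a + 1) / a)
def Bj (a C : ℝ) : ℝ := 2 / a + 4 * C ^ 2 * ((2 * a + 1) / a) + 1 / (2 * a)
def BX (a C : ℝ) : ℝ := 4 * B0 a C + 4 * (C * (C ^ 2 / (2 * a) + 1)) * ((a + 1) / a)
def BJ (a C : ℝ) : ℝ := 1 / a + (a + 1) / a + Bj a C * (C ^ 2 / (2 * a)) + Bj a C

lemma B0_pos {a C : ℝ} (ha : 0 < a) (hC : 1 ≤ C) : 0 < B0 a C := by unfold B0; positivity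
lemma Bj_pos {a C : ℝ} (ha : 0 < a) (hC : 1 ≤ C) : 0 < Bj a C := by unfold Bj; positivity
lemma BX_pos {a C : ℝ} (ha : 0 < a) (hC : 1 ≤ C) : 0 < BX a C := by
  have := B0_pos ha hC
  unfold BX; positivity
lemma BJ_pos {a C : ℝ} (ha : 0 < a) (hC : 1 ≤ C) : 0 < BJ a C := by
  have := Bj_pos ha hC
  unfold BJ; positivity

namespace Pt
section
variable {a C η s U V p q U1 V1 p1 p2 q1 q2 : ℝ}

lemma η1 (h : Pt a C η s U V p q) : η ≤ 1 := by have := h.hη4; linarith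

lemma div_s {x A s : ℝ} (hs : 0 < s) (hx : |x| ≤ A * s) : |x / s| ≤ A := by
  rw [abs_div, abs_of_pos hs, div_le_iff₀ hs]; exact hx

lemma sU1 (h : Pt a C η s U V p q) (hU1 : U1 = -(V / a) * s⁻¹) : |s * U1| ≤ 1 := by
  have hs := h.hs
  have ha := h.ha
  rw [show s * U1 = -(V / a) by rw [hU1]; field_simp, abs_neg, abs_div, abs_of_pos ha, div_le_one ha]
  exact h.Vle

lemma V1b (h : Pt a C η s U V p q) (hV1 : V1 = -(exp (-(4 * U)) / (2 * a)) * s⁻¹) :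
    |V1| ≤ C ^ 2 / (2 * a) * s ^ 3 := by
  have hs := h.hs
  have ha := h.ha
  have e : V1 = -((exp (-(2 * U)) / s) * exp (-(2 * U)) / (2 * a)) := by
    rw [hV1, show exp (-(4 * U)) = exp (-(2 * U)) * exp (-(2 * U)) by rw [← exp_add]; ring_nf]
    field_simp
  have h1 : |exp (-(2 * U)) / s| ≤ C * s := div_s hs (h.Ele.trans (le_of_eq (by ring)))
  rw [e, abs_neg, abs_div, abs_of_pos (by positivity : 0 < 2 * a), div_le_iff₀ (by positivity)]
  refine (mul_bd h1 h.Ele).trans (le_of_eq ?_)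
  field_simp

lemma X1_bd (h : Pt a C η s U V p q) (hU1 : U1 = -(V / a) * s⁻¹)
    (hV1 : V1 = -(exp (-(4 * U)) / (2 * a)) * s⁻¹) (hp1 : |p1| ≤ η) (hq1 : |q1| ≤ η * s ^ 2) :
    |dX a (U + p) (V + q) (U1 + p1) (V1 + q1)| ≤ BX a C := by
  have hs := h.hs
  have ha := h.ha
  have hC := h.hC
  have e : dX a (U + p) (V + q) (U1 + p1) (V1 + q1) =
     2 * ((kr a (U + p) (V + q) / s) * (s * U1 + s * p1))
      - 2 * ((exp (2 * p) * (exp (2 * U) * (V1 + q1))) * ((V + q) / a)) := by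
    unfold dX
    rw [exp_split]
    field_simp
  have h1 : |kr a (U + p) (V + q) / s| ≤ B0 a C := div_s hs h.k_bd
  have h2 : |s * p1| ≤ 1 * 1 := mul_bd ((abs_of_pos hs).le.trans h.hs1) (hp1.trans h.η1)
  have h3 := mul_bd h1 (add_bd (h.sU1 hU1) h2)
  have h4 : |V1 + q1| ≤ (C ^ 2 / (2 * a) + 1) * s ^ 2 := by
    have hp := h.η1
    refine (add_bd (h.V1b hV1) hq1).trans ?_
    rw [add_mul]
    have : s ^ 3 ≤ s ^ 2 := pow_le_pow_of_le_one hs.le h.hs1 (by norm_num)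
    gcongr
  have h5 := mul_bd (mul_bd h.t2 (h.Emul h4)) h.vle
  have h6 : |2 * ((kr a (U + p) (V + q) / s) * (s * U1 + s * p1))| ≤ 2 * _ :=
    mul_bd (le_of_eq abs_two) h3
  have h7 : |2 * ((exp (2 * p) * (exp (2 * U) * (V1 + q1))) * ((V + q) / a))| ≤ 2 * _ :=
    mul_bd (le_of_eq abs_two) h5
  rw [e]
  refine (sub_bd h6 h7).trans (le_of_eq ?_)
  unfold BX
  ring

lemma X2_bd (h : Pt a C η s U V p q) (hp2 : |p2| ≤ η * s) (hq2 : |q2| ≤ η * s ^ 3) :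
    |dX a (U + p) (V + q) p2 q2| ≤ BX a C * s := by
  have hs := h.hs
  have ha := h.ha
  have hC := h.hC
  have e : dX a (U + p) (V + q) p2 q2 =
     2 * (kr a (U + p) (V + q) * p2)
      - 2 * ((exp (2 * p) * (exp (2 * U) * q2)) * ((V + q) / a)) := by
    unfold dX
    rw [exp_split]
    field_simp
  have h2 : |p2| ≤ 1 := by
    refine hp2.trans ?_
    have := h.η1; have := h.hs1; have := h.hη
    nlinarith
  have h1 : |kr a (U + p) (V + q)| ≤ B0 a C * s := h.k_bd
  have h4 : |q2| ≤ s * s ^ 2 := by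
    have := h.η1
    refine hq2.trans ?_
    have : 0 < s ^ 3 := by positivity
    nlinarith
  have h5 := mul_bd (mul_bd h.t2 (h.Emul h4)) h.vle
  have h6 : |2 * (kr a (U + p) (V + q) * p2)| ≤ 2 * _ :=
    mul_bd (le_of_eq abs_two) (mul_bd h1 h2)
  have h7 : |2 * ((exp (2 * p) * (exp (2 * U) * q2)) * ((V + q) / a))| ≤ 2 * _ :=
    mul_bd (le_of_eq abs_two) h5
  rw [e]
  refine (sub_bd h6 h7).trans ?_
  have hb := B0_pos ha hC
  have h8 : 0 ≤ 2 * B0 a C * s + 4 * (C * (C ^ 2 / (2 * a))) * ((a + 1) / a) * s := by positivity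
  unfold BX
  nlinarith

lemma J1_bd (h : Pt a C η s U V p q) (hU1 : U1 = -(V / a) * s⁻¹)
    (hV1 : V1 = -(exp (-(4 * U)) / (2 * a)) * s⁻¹) (hp1 : |p1| ≤ η) (hq1 : |q1| ≤ η * s ^ 2) :
    |Jr a (U + p) (V + q) (U1 + p1) (V1 + q1) + s⁻¹| ≤ BJ a C * η := by
  have hs := h.hs
  have ha := h.ha
  have hC := h.hC
  have hη := h.hη
  set j := exp (2 * (U + p)) * kr a (U + p) (V + q) with hj
  have b0 : (V / a) * U1 + 1 / (2 * a) * V1 + s⁻¹ = 0 := by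
    have := h.Vsq
    rw [hU1, hV1, show exp (-(4 * U)) = exp (-(2 * U)) ^ 2 by rw [← exp_nat_mul]; push_cast; ring_nf]
    field_simp
    linarith
  have e : Jr a (U + p) (V + q) (U1 + p1) (V1 + q1) + s⁻¹ =
      (q / s) * (s * U1) / a + ((V + q) / a) * p1 + (s * (j - 1 / (2 * a))) * (V1 / s) + (s * j) * (q1 / s) := by
    unfold Jr
    rw [← hj]
    have : (q / s) * (s * U1) / a + ((V + q) / a) * p1 + (s * (j - 1 / (2 * a))) * (V1 / s) + (s * j) * (q1 / s)
      = (q * U1) / a + ((V + q) / a) * p1 + (j - 1 / (2 * a)) * V1 + j * q1 := by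
      field_simp
    rw [this]
    linear_combination b0
  rw [e]
  have s3 : s ^ 3 ≤ s := by
    simpa using pow_le_pow_of_le_one hs.le h.hs1 (show 1 ≤ 3 by norm_num)
  have h1 : |q / s| ≤ η := div_s hs (h.hq.trans (by gcongr))
  have h2 : |(q / s) * (s * U1) / a| ≤ η * 1 / a := by
    rw [abs_div, abs_of_pos ha]
    have := mul_bd h1 (h.sU1 hU1)
    gcongr
  have h3 := mul_bd h.vle hp1
  have h4 : |V1 / s| ≤ C ^ 2 / (2 * a) := div_s hs ((h.V1b hV1).trans (by gcongr))
  have h5 : |q1 / s| ≤ η := div_s hs (hq1.trans (by have := h.s2s; gcongr))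
  have h6 : |s * (j - 1 / (2 * a))| ≤ Bj a C * η := by
    refine h.j_bd.trans ?_
    unfold Bj
    have : 0 ≤ 1 / (2 * a) := by positivity
    exact mul_le_mul_of_nonneg_right (by linarith) hη
  have h7 : |s * j| ≤ Bj a C := h.j_bd'
  refine (add_bd (add_bd (add_bd h2 h3) (mul_bd h6 h4)) (mul_bd h7 h5)).trans (le_of_eq ?_)
  unfold BJ
  ring

lemma J2_bd (h : Pt a C η s U V p q) (hp2 : |p2| ≤ η * s) (hq2 : |q2| ≤ η * s ^ 3) :
    |Jr a (U + p) (V + q) p2 q2| ≤ BJ a C * η * s := by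
  have hs := h.hs
  have ha := h.ha
  have hC := h.hC
  have hη := h.hη
  set j := exp (2 * (U + p)) * kr a (U + p) (V + q) with hj
  have e : Jr a (U + p) (V + q) p2 q2 = ((V + q) / a) * p2 + (s * j) * (q2 / s) := by
    unfold Jr
    rw [← hj]
    field_simp
  have h5 : |q2 / s| ≤ η * s := div_s hs (hq2.trans (by
    have := h.s2s
    rw [show η * s ^ 3 = η * s ^ 2 * s by ring]; gcongr))
  have h7 : |s * j| ≤ Bj a C := h.j_bd'
  rw [e]
  refine (add_bd (mul_bd h.vle hp2) (mul_bd h7 h5)).trans ?_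
  have hb := Bj_pos ha hC
  have h8 : 0 ≤ (1 / a + Bj a C * (C ^ 2 / (2 * a))) * η * s := by positivity
  unfold BJ
  nlinarith
end
end Pt


/-- a small perturbation of the base map -/
structure Per (η : ℝ) (Φ v w₁ w₂ : ℝ → ℝ → ℝ) : Prop where
  r1 : R2 w₁
  r2 : R2 w₂
  hη : 0 ≤ η
  hη4 : η ≤ 1 / 4
  p0 : ∀ θ ∈ Ioo (0 : ℝ) π, ∀ φ, |w₁ θ φ - Φ θ φ| ≤ η
  p1 : ∀ θ ∈ Ioo (0 : ℝ) π, ∀ φ, |pdθ w₁ θ φ - pdθ Φ θ φ| ≤ η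
  p2 : ∀ θ ∈ Ioo (0 : ℝ) π, ∀ φ, |pdφ w₁ θ φ - pdφ Φ θ φ| ≤ η * sin θ
  pl : ∀ θ ∈ Ioo (0 : ℝ) π, ∀ φ, |lapS2 w₁ θ φ - lapS2 Φ θ φ| ≤ 1
  q0 : ∀ θ ∈ Ioo (0 : ℝ) π, ∀ φ, |w₂ θ φ - v θ φ| ≤ η * sin θ ^ 3
  q1 : ∀ θ ∈ Ioo (0 : ℝ) π, ∀ φ, |pdθ w₂ θ φ - pdθ v θ φ| ≤ η * sin θ ^ 2
  q2 : ∀ θ ∈ Ioo (0 : ℝ) π, ∀ φ, |pdφ w₂ θ φ - pdφ v θ φ| ≤ η * sin θ ^ 3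
  q1' : ∀ θ ∈ Ioo (0 : ℝ) π, ∀ φ, (pdθ w₂ θ φ - pdθ v θ φ) ^ 2 ≤ sin θ ^ 5
  ql : ∀ θ ∈ Ioo (0 : ℝ) π, ∀ φ, (lapS2 w₂ θ φ - lapS2 v θ φ) ^ 2 ≤ sin θ ^ 3

section
variable {a C η : ℝ} {Φ L v w₁ w₂ : ℝ → ℝ → ℝ}

lemma Per.pt (h : Per η Φ v w₁ w₂) (b : Bar a C Φ L v) (ha : 0 < a) {θ : ℝ} (hθ : θ ∈ Ioo (0 : ℝ) π)
    (φ : ℝ) : Pt a C η (sin θ) (Φ θ φ - L θ φ) (v θ φ) (w₁ θ φ - Φ θ φ) (w₂ θ φ - v θ φ) :=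
  ⟨ha, b.one, h.hη, h.hη4, sin_pos_D hθ, sin_le_one θ, b.e1 θ hθ φ, b.e2 θ hθ φ, b.cr.hX θ hθ φ,
    h.p0 θ hθ φ, h.q0 θ hθ φ⟩

lemma spl (x y z : ℝ) : x - z = (y - z) + (x - y) := by ring
lemma spl2 (x y : ℝ) : x = y + (x - y) := by ring

lemma Per.u1 (h : Per η Φ v w₁ w₂) (b : Bar a C Φ L v) {θ : ℝ} (hθ : θ ∈ Ioo (0 : ℝ) π)
    (φ : ℝ) : pdθ (fun θ φ => w₁ θ φ - L θ φ) θ φ =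
      pdθ (fun θ φ => Φ θ φ - L θ φ) θ φ + (pdθ w₁ θ φ - pdθ Φ θ φ) := by
  rw [h.r1.sub_θ b.rL hθ, b.rΦ.sub_θ b.rL hθ]; ring

lemma Per.u2 (h : Per η Φ v w₁ w₂) (b : Bar a C Φ L v) {θ : ℝ} (hθ : θ ∈ Ioo (0 : ℝ) π)
    (φ : ℝ) : pdφ (fun θ φ => w₁ θ φ - L θ φ) θ φ = (pdφ w₁ θ φ - pdφ Φ θ φ) := by
  have := b.cr.u2 θ hθ φ
  rw [b.rΦ.sub_φ b.rL hθ] at this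
  rw [h.r1.sub_φ b.rL hθ]; linarith

lemma Per.v2 (b : Bar a C Φ L v) {θ : ℝ} (hθ : θ ∈ Ioo (0 : ℝ) π)
    (φ : ℝ) : pdφ w₂ θ φ = (pdφ w₂ θ φ - pdφ v θ φ) := by
  rw [b.cr.v2 θ hθ φ]; ring

lemma Per.X_bd (h : Per η Φ v w₁ w₂) (b : Bar a C Φ L v) (ha : 0 < a) {θ : ℝ} (hθ : θ ∈ Ioo (0 : ℝ) π)
    (φ : ℝ) : |XX a (fun θ φ => w₁ θ φ - L θ φ) w₂ θ φ| ≤ B0 a C * (η * sin θ) := by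
  unfold XX
  beta_reduce
  rw [spl (w₁ θ φ) (Φ θ φ), spl2 (w₂ θ φ) (v θ φ)]
  exact (h.pt b ha hθ φ).X_bd

lemma Per.X1_bd (h : Per η Φ v w₁ w₂) (b : Bar a C Φ L v) (ha : 0 < a) {θ : ℝ} (hθ : θ ∈ Ioo (0 : ℝ) π)
    (φ : ℝ) : |X1 a (fun θ φ => w₁ θ φ - L θ φ) w₂ θ φ| ≤ BX a C := by
  unfold X1
  rw [h.u1 b hθ, spl2 (pdθ w₂ θ φ) (pdθ v θ φ)]
  beta_reduce
  rw [spl (w₁ θ φ) (Φ θ φ), spl2 (w₂ θ φ) (v θ φ)]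
  exact (h.pt b ha hθ φ).X1_bd (b.cr.u1 θ hθ φ) (b.cr.v1 θ hθ φ) (h.p1 θ hθ φ) (h.q1 θ hθ φ)

lemma Per.X2_bd (h : Per η Φ v w₁ w₂) (b : Bar a C Φ L v) (ha : 0 < a) {θ : ℝ} (hθ : θ ∈ Ioo (0 : ℝ) π)
    (φ : ℝ) : |X2 a (fun θ φ => w₁ θ φ - L θ φ) w₂ θ φ| ≤ BX a C * sin θ := by
  unfold X2
  rw [Per.v2 (w₂ := w₂) b hθ, h.u2 b hθ]
  beta_reduce
  rw [spl (w₁ θ φ) (Φ θ φ), spl2 (w₂ θ φ) (v θ φ)]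
  exact (h.pt b ha hθ φ).X2_bd (h.p2 θ hθ φ) (h.q2 θ hθ φ)

lemma Per.J1_bd (h : Per η Φ v w₁ w₂) (b : Bar a C Φ L v) (ha : 0 < a) {θ : ℝ} (hθ : θ ∈ Ioo (0 : ℝ) π)
    (φ : ℝ) : |J1 a (fun θ φ => w₁ θ φ - L θ φ) w₂ θ φ + (sin θ)⁻¹| ≤ BJ a C * η := by
  unfold J1
  rw [h.u1 b hθ, spl2 (pdθ w₂ θ φ) (pdθ v θ φ)]
  beta_reduce
  rw [spl (w₁ θ φ) (Φ θ φ), spl2 (w₂ θ φ) (v θ φ)]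
  exact (h.pt b ha hθ φ).J1_bd (b.cr.u1 θ hθ φ) (b.cr.v1 θ hθ φ) (h.p1 θ hθ φ) (h.q1 θ hθ φ)

lemma Per.J2_bd (h : Per η Φ v w₁ w₂) (b : Bar a C Φ L v) (ha : 0 < a) {θ : ℝ} (hθ : θ ∈ Ioo (0 : ℝ) π)
    (φ : ℝ) : |J2 a (fun θ φ => w₁ θ φ - L θ φ) w₂ θ φ| ≤ BJ a C * η * sin θ := by
  unfold J2
  rw [Per.v2 (w₂ := w₂) b hθ, h.u2 b hθ]
  beta_reduce
  rw [spl (w₁ θ φ) (Φ θ φ), spl2 (w₂ θ φ) (v θ φ)]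
  exact (h.pt b ha hθ φ).J2_bd (h.p2 θ hθ φ) (h.q2 θ hθ φ)

/-- smallness needed -/
def Bs (a C : ℝ) : ℝ := BJ a C + B0 a C ^ 2 + B0 a C

lemma Per.S1_bd (h : Per η Φ v w₁ w₂) (b : Bar a C Φ L v) (ha : 0 < a) {θ : ℝ} (hθ : θ ∈ Ioo (0 : ℝ) π)
    (φ : ℝ) : |S1 a (fun θ φ => w₁ θ φ - L θ φ) w₂ θ φ| ≤ Bs a C * η := by
  have hs := sin_pos_D hθ
  have hs1 := sin_le_one θ
  have hη := h.hη
  have hη1 : η ≤ 1 := by linarith [h.hη4]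
  have hX := h.X_bd b ha hθ φ
  have hJ := h.J1_bd b ha hθ φ
  unfold S1
  set X := XX a (fun θ φ => w₁ θ φ - L θ φ) w₂ θ φ
  set J := J1 a (fun θ φ => w₁ θ φ - L θ φ) w₂ θ φ
  have pX : 0 < 1 + X ^ 2 := by positivity
  have e : J / (1 + X ^ 2) + (sin θ)⁻¹ = (J + (sin θ)⁻¹ + X * (X / sin θ)) * (1 + X ^ 2)⁻¹ := by
    field_simp
    ring
  have h1 : |X / sin θ| ≤ B0 a C * η := Pt.div_s hs (hX.trans (le_of_eq (by ring)))
  have h2 : |(1 + X ^ 2)⁻¹| ≤ 1 := by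
    rw [abs_of_pos (by positivity)]
    exact inv_le_one_of_one_le₀ (by nlinarith [sq_nonneg X])
  rw [e]
  refine (mul_bd (add_bd hJ (mul_bd hX h1)) h2).trans ?_
  have hb := B0_pos ha b.one
  have h3 : η * sin θ ≤ 1 := by nlinarith
  have h4 : B0 a C * (η * sin θ) * (B0 a C * η) ≤ B0 a C * 1 * (B0 a C * η) := by gcongr
  have h5 : 0 ≤ B0 a C * η := by positivity
  unfold Bs
  nlinarith

lemma Per.S2_bd (h : Per η Φ v w₁ w₂) (b : Bar a C Φ L v) (ha : 0 < a) {θ : ℝ} (hθ : θ ∈ Ioo (0 : ℝ) π)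
    (φ : ℝ) : |S2 a (fun θ φ => w₁ θ φ - L θ φ) w₂ θ φ| ≤ Bs a C * η * sin θ := by
  have hs := sin_pos_D hθ
  have hη := h.hη
  have hJ := h.J2_bd b ha hθ φ
  unfold S2
  set X := XX a (fun θ φ => w₁ θ φ - L θ φ) w₂ θ φ
  set J := J2 a (fun θ φ => w₁ θ φ - L θ φ) w₂ θ φ
  have h2 : |(1 + X ^ 2)⁻¹| ≤ 1 := by
    rw [abs_of_pos (by positivity)]
    exact inv_le_one_of_one_le₀ (by nlinarith [sq_nonneg X])
  rw [div_eq_mul_inv]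
  refine (mul_bd hJ h2).trans ?_
  have hb := B0_pos ha b.one
  have h5 : 0 ≤ (B0 a C ^ 2 + B0 a C) * η * sin θ := by positivity
  unfold Bs
  nlinarith

lemma grad_join {x y s A : ℝ} (hs : 0 < s) (hx : |x| ≤ A) (hy : |y| ≤ A * s) :
    x ^ 2 + (s ^ 2)⁻¹ * y ^ 2 ≤ 2 * A ^ 2 := by
  have h1 := Pt.div_s hs hy
  have e : (s ^ 2)⁻¹ * y ^ 2 = (y / s) ^ 2 := by field_simp
  rw [e]
  have := sq_le_sq' (abs_le.1 hx).1 (abs_le.1 hx).2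
  have := sq_le_sq' (abs_le.1 h1).1 (abs_le.1 h1).2
  linarith

lemma Per.gX_bd (h : Per η Φ v w₁ w₂) (b : Bar a C Φ L v) (ha : 0 < a) {θ : ℝ} (hθ : θ ∈ Ioo (0 : ℝ) π)
    (φ : ℝ) : gX a (fun θ φ => w₁ θ φ - L θ φ) w₂ θ φ ≤ 2 * BX a C ^ 2 :=
  grad_join (sin_pos_D hθ) (h.X1_bd b ha hθ φ) (h.X2_bd b ha hθ φ)

lemma Per.gS_bd (h : Per η Φ v w₁ w₂) (b : Bar a C Φ L v) (ha : 0 < a) {θ : ℝ} (hθ : θ ∈ Ioo (0 : ℝ) π)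
    (φ : ℝ) : gS a (fun θ φ => w₁ θ φ - L θ φ) w₂ θ φ ≤ 2 * (Bs a C * η) ^ 2 :=
  grad_join (sin_pos_D hθ) (h.S1_bd b ha hθ φ) (h.S2_bd b ha hθ φ)

/-- bounds needed for the Fermi coordinates -/
def CF (C : ℝ) : ℝ := 2 * C + 2
def DF (a C : ℝ) : ℝ := (CF C ^ 3 + CF C) / a

lemma DF_pos {a C : ℝ} (ha : 0 < a) (hC : 1 ≤ C) : 0 < DF a C := by unfold DF CF; positivity

lemma Per.fermi (h : Per η Φ v w₁ w₂) (b : Bar a C Φ L v) (ha : 0 < a) {θ : ℝ} (hθ : θ ∈ Ioo (0 : ℝ) π)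
    (φ : ℝ) : Pr a (w₁ θ φ - L θ φ) (w₂ θ φ) ≤ DF a C * ((1 + cos θ) / (1 - cos θ)) ∧
    Pr a (w₁ θ φ - L θ φ) (-w₂ θ φ) ≤ DF a C * ((1 - cos θ) / (1 + cos θ)) := by
  have hs := sin_pos_D hθ
  have hC := b.one
  have pt := h.pt b ha hθ φ
  obtain ⟨c1, c2⟩ := cos_bd hθ
  have hq : |w₂ θ φ - v θ φ| ≤ sin θ ^ 2 := by
    refine (h.q0 θ hθ φ).trans ?_
    have h1 : sin θ ^ 3 ≤ sin θ ^ 2 := pow_le_pow_of_le_one hs.le (sin_le_one θ) (by norm_num)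
    have := pow_pos hs 3
    nlinarith [h.hη4, h.hη]
  rw [sin_sq_fac] at hq
  refine fermi_bd ha hθ (by unfold CF; positivity) ?_ ?_ ?_ ?_
  · rw [spl (w₁ θ φ) (Φ θ φ), exp_split]
    have h1 := (le_abs_self _).trans pt.t2
    have := b.e1 θ hθ φ
    calc _ = (exp (2 * (Φ θ φ - L θ φ)) * sin θ ^ 2) * exp (2 * (w₁ θ φ - Φ θ φ)) := by ring
      _ ≤ C * 2 := by gcongr
      _ ≤ _ := by unfold CF; linarith
  · rw [spl (w₁ θ φ) (Φ θ φ), exp_split']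
    have h1 := (le_abs_self _).trans pt.r2
    have := b.e2 θ hθ φ
    calc _ ≤ (C * sin θ ^ 2) * 2 := by gcongr
      _ ≤ _ := by unfold CF; nlinarith [pow_pos hs 2]
  · have h1 := b.v3 θ hθ φ
    have : |w₂ θ φ - a| ≤ |v θ φ - a| + |w₂ θ φ - v θ φ| := by
      rw [spl (w₂ θ φ) (v θ φ) a]; exact abs_add_le _ _
    unfold CF
    nlinarith [cos_le_one θ, neg_one_le_cos θ]
  · have h1 := b.v4 θ hθ φ
    have : |w₂ θ φ + a| ≤ |v θ φ + a| + |w₂ θ φ - v θ φ| := by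
      rw [show w₂ θ φ + a = (v θ φ + a) + (w₂ θ φ - v θ φ) by ring]; exact abs_add_le _ _
    unfold CF
    nlinarith [cos_le_one θ, neg_one_le_cos θ]

end


section
variable {a C η s U V p q : ℝ}

lemma Pt.neg (h : Pt a C η s U V p q) : Pt a C η s U (-V) p (-q) :=
  ⟨h.ha, h.hC, h.hη, h.hη4, h.hs, h.hs1, h.e1, h.e2, by rw [Xr_neg]; exact h.hX, h.hp,
    by rw [abs_neg]; exact h.hq⟩

def Ksig (a C : ℝ) : ℝ := C * (2 * (a + a) + 1) / a + C * 5 / (4 * a)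

lemma Pt.sig (h : Pt a C η s U V p q) {m : ℝ} (hm : 0 < m) (h1 : m ≤ Pr a U V)
    (h2 : m ≤ Pr a (U + p) (V + q)) :
    |sr a (U + p) (V + q) - p - sr a U V| ≤ Ksig a C * s / m + B0 a C ^ 2 * s := by
  have ha := h.ha
  have hC := h.hC
  have hs := h.hs
  have hη1 : η ≤ 1 := by linarith [h.hη4]
  have hX := h.X_bd
  have hηs : η * s ≤ s := by nlinarith
  have hηs0 : 0 ≤ η * s := mul_nonneg h.hη hs.le
  have hb := B0_pos ha hC
  rw [sr_eq ha, sr_eq ha U V, h.hX]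
  set X := Xr a (U + p) (V + q)
  have hp2 : log (Pr a (U + p) (V + q) * exp (-(2 * p))) = log (Pr a (U + p) (V + q)) - 2 * p := by
    rw [log_mul (Pr_pos ha _ _).ne' (exp_pos _).ne', log_exp]; ring
  have e : 1 / 2 * log (Pr a (U + p) (V + q)) - 1 / 4 * log (1 + X ^ 2) - p -
      (1 / 2 * log (Pr a U V) - 1 / 4 * log (1 + 0 ^ 2)) =
      1 / 2 * (log (Pr a (U + p) (V + q) * exp (-(2 * p))) - log (Pr a U V))
        - 1 / 4 * log (1 + X ^ 2) := by
    rw [hp2]; norm_num; ring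
  rw [e]
  have hlX : |log (1 + X ^ 2)| ≤ B0 a C ^ 2 * s := by
    have g1 : 0 ≤ log (1 + X ^ 2) := log_nonneg (by nlinarith [sq_nonneg X])
    rw [abs_of_nonneg g1]
    have g2 : log (1 + X ^ 2) ≤ X ^ 2 := by
      have := log_le_sub_one_of_pos (show 0 < 1 + X ^ 2 by positivity)
      linarith
    have g3 : X ^ 2 ≤ (B0 a C * (η * s)) ^ 2 := sq_le_sq' (abs_le.1 hX).1 (abs_le.1 hX).2
    have g4 : (η * s) ^ 2 ≤ s := by nlinarith [h.hs1]
    nlinarith [pow_pos hb 2]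
  have hr : 1 / 2 ≤ exp (-(2 * p)) := by
    have := add_one_le_exp (-(2 * p))
    have := (abs_le.1 h.hp).2
    linarith [h.hη4]
  have hA : m / 2 ≤ Pr a (U + p) (V + q) * exp (-(2 * p)) := by nlinarith
  have hP : Pr a (U + p) (V + q) * exp (-(2 * p)) - Pr a U V =
      exp (2 * U) * q * (2 * (a + V) + q) / a +
        exp (-(2 * U)) * (exp (-(2 * p)) * exp (-(2 * p)) - 1) / (4 * a) := by
    unfold Pr
    rw [exp_split, exp_split']
    have := EI p
    have e1 : exp (2 * U) * exp (2 * p) * (a + (V + q)) ^ 2 / a * exp (-(2 * p)) =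
        exp (2 * U) * (a + (V + q)) ^ 2 / a * (exp (2 * p) * exp (-(2 * p))) := by ring
    rw [add_mul, e1, this]
    field_simp
    ring
  have hd : |Pr a (U + p) (V + q) * exp (-(2 * p)) - Pr a U V| ≤ Ksig a C * s := by
    rw [hP]
    have b1 : |exp (2 * U) * q * (2 * (a + V) + q)| ≤ C * s * (2 * (a + a) + 1) := by
      refine mul_bd (h.Eq.trans (by gcongr)) (add_bd ?_ h.qle)
      have := h.Vle
      rw [abs_mul, abs_two]
      have := abs_add_le a V
      rw [abs_of_pos ha] at this
      linarith
    have b2 : |exp (-(2 * U)) * (exp (-(2 * p)) * exp (-(2 * p)) - 1)| ≤ C * s * 5 := by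
      refine mul_bd ?_ ?_
      · rw [abs_of_pos (exp_pos _)]
        refine h.e2.trans ?_
        have : s ^ 2 ≤ s := by nlinarith [h.hs1]
        gcongr
      · refine (sub_bd (mul_bd h.r2 h.r2) (le_of_eq abs_one)).trans (by norm_num)
    refine (abs_add_le _ _).trans ?_
    rw [abs_div, abs_div, abs_of_pos ha, abs_of_pos (show 0 < 4 * a by positivity)]
    unfold Ksig
    have c1 := div_le_div_of_nonneg_right b1 ha.le
    have c2 := div_le_div_of_nonneg_right b2 (show 0 ≤ 4 * a by positivity)
    calc _ ≤ _ := add_le_add c1 c2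
      _ = _ := by ring
  have hl := log_sub_le (B := Pr a U V) (show 0 < m / 2 by positivity) hA (by linarith)
  have hl2 : |log (Pr a (U + p) (V + q) * exp (-(2 * p))) - log (Pr a U V)| ≤ 2 * (Ksig a C * s / m) := by
    refine hl.trans ?_
    calc _ ≤ Ksig a C * s / (m / 2) := by gcongr
      _ = _ := by field_simp
  have f1 := mul_bd (le_of_eq (abs_of_pos (show (0 : ℝ) < 1 / 2 by norm_num))) hl2
  have f2 := mul_bd (le_of_eq (abs_of_pos (show (0 : ℝ) < 1 / 4 by norm_num))) hlX
  refine (sub_bd f1 f2).trans ?_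
  have : 0 ≤ B0 a C ^ 2 * s := by positivity
  linarith

end

section
variable {a C η : ℝ} {Φ L v w₁ w₂ : ℝ → ℝ → ℝ}

lemma Ksig_pos (ha : 0 < a) (hC : 1 ≤ C) : 0 < Ksig a C := by unfold Ksig; positivity

lemma Bar.self (b : Bar a C Φ L v) : Per 0 Φ v Φ v := by
  refine ⟨b.rΦ, b.rv, le_rfl, by norm_num, ?_, ?_, ?_, ?_, ?_, ?_, ?_, ?_, ?_⟩ <;> intro θ hθ φ <;>
    simp [(pow_pos (sin_pos_D hθ) _).le]

/-- the boundary behaviour of the Fermi coordinate -/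
lemma Per.A_bd (h : Per η Φ v w₁ w₂) (b : Bar a C Φ L v) (ha : 0 < a) {θ : ℝ}
    (hθ : θ ∈ Ioo (0 : ℝ) π) (φ : ℝ) :
    |(w₁ θ φ - Φ θ φ) * cos θ - (sr a (w₁ θ φ - L θ φ) (w₂ θ φ) - sr a (Φ θ φ - L θ φ) (v θ φ))|
      ≤ (2 * (Ksig a C * DF a C) + 2 * B0 a C ^ 2) * sin θ := by
  have hs := sin_pos_D hθ
  have hC := b.one
  have pt := h.pt b ha hθ φ
  obtain ⟨c1, c2⟩ := cos_bd hθ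
  have hD := DF_pos ha hC
  have hK := Ksig_pos ha hC
  have f := h.fermi b ha hθ φ
  have f0 := b.self.fermi b ha hθ φ
  obtain ⟨-, -, l1, l2⟩ := fermi_bd2 ha hθ hD f.1 f.2
  obtain ⟨-, -, l3, l4⟩ := fermi_bd2 ha hθ hD f0.1 f0.2
  have e1 : w₁ θ φ - L θ φ = (Φ θ φ - L θ φ) + (w₁ θ φ - Φ θ φ) := by ring
  have e2 : w₂ θ φ = v θ φ + (w₂ θ φ - v θ φ) := by ring
  have e3 : -w₂ θ φ = -v θ φ + -(w₂ θ φ - v θ φ) := by ring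
  have g1 := pt.sig (by positivity) l3 (by rw [← e1, ← e2]; exact l1)
  have g2 := pt.neg.sig (by positivity) l4 (by rw [← e1, ← e3]; exact l2)
  rw [← e1, ← e2] at g1
  rw [← e1, ← e3, sr_neg, sr_neg] at g2
  set σ := sr a (w₁ θ φ - L θ φ) (w₂ θ φ)
  set σ' := sr a (Φ θ φ - L θ φ) (v θ φ)
  set p := w₁ θ φ - Φ θ φ
  have hb : 0 ≤ B0 a C ^ 2 * sin θ := by positivity
  have k1 : Ksig a C * sin θ / ((DF a C)⁻¹ * ((1 + cos θ) / (1 - cos θ))) * (1 + cos θ)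
      = Ksig a C * sin θ * DF a C * (1 - cos θ) := by field_simp
  have k2 : Ksig a C * sin θ / ((DF a C)⁻¹ * ((1 - cos θ) / (1 + cos θ))) * (1 - cos θ)
      = Ksig a C * sin θ * DF a C * (1 + cos θ) := by field_simp
  have e : p * cos θ - (σ - σ') = (-σ - p - -σ') * ((1 - cos θ) / 2) - (σ - p - σ') * ((1 + cos θ) / 2) := by
    ring
  rw [e]
  have m1 := mul_bd g1 (le_of_eq (abs_of_pos (show 0 < (1 + cos θ) / 2 by positivity)))
  have m2 := mul_bd g2 (le_of_eq (abs_of_pos (show 0 < (1 - cos θ) / 2 by positivity)))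
  refine (sub_bd m2 m1).trans ?_
  have hKD : 0 ≤ Ksig a C * sin θ * DF a C := by positivity
  nlinarith
end


/-- the integrand with zero integral -/
def FF (a : ℝ) (Φ L w₁ w₂ : ℝ → ℝ → ℝ) (θ φ : ℝ) : ℝ :=
  -(S1 a (fun θ φ => w₁ θ φ - L θ φ) w₂ θ φ) * (sin θ)⁻¹
    + ((pdθ w₁ θ φ - pdθ Φ θ φ) * pdθ L θ φ
      + (sin θ ^ 2)⁻¹ * (pdφ w₁ θ φ - pdφ Φ θ φ) * pdφ L θ φ)
    + (w₁ θ φ - Φ θ φ) * lapS2 L θ φ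

section
variable {a C η : ℝ} {Φ L v w₁ w₂ : ℝ → ℝ → ℝ}

lemma Bar.sL (b : Bar a C Φ L v) {θ : ℝ} (hθ : θ ∈ Ioo (0 : ℝ) π) (φ : ℝ) :
    |sin θ * pdθ L θ φ| ≤ C + 1 := by
  have h1 := b.bL1 θ hθ φ
  have h2 := abs_cos_le_one θ
  have h3 := sin_le_one θ
  have hC := b.one
  have e : sin θ * pdθ L θ φ = (sin θ * pdθ L θ φ - cos θ) + cos θ := by ring
  rw [e]
  refine (add_bd h1 h2).trans ?_
  nlinarith

lemma Per.F_adm (h : Per η Φ v w₁ w₂) (b : Bar a C Φ L v) (ha : 0 < a) :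
    Adm (FF a Φ L w₁ w₂) := by
  have hg := sg_grad ha (h.r1.sub b.rL) h.r2 0
  have hη1 : η ≤ 1 := by linarith [h.hη4]
  have hη := h.hη
  refine ⟨((hg.c1.neg.mul CD.sin_inv).add (((h.r1.c1.sub b.rΦ.c1).mul b.rL.c1).add
    ((CD.sinv2.mul (h.r1.c2.sub b.rΦ.c2)).mul b.rL.c2))).add ((h.r1.c0.sub b.rΦ.c0).mul b.rL.clap),
    Bs a C * η + (1 * (C + 1) + 1 * C) + 1 * C, fun θ hθ φ => ?_⟩
  have hs := sin_pos_D hθ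
  have hC := b.one
  have s1 := h.S1_bd b ha hθ φ
  have s1' := s1
  rw [← abs_neg] at s1'
  have p0 := (h.p0 θ hθ φ).trans hη1
  have p1 := (h.p1 θ hθ φ).trans hη1
  have p2 := (Pt.div_s hs (h.p2 θ hθ φ)).trans hη1
  have l2 := Pt.div_s hs (b.bL2 θ hθ φ)
  have e : FF a Φ L w₁ w₂ θ φ * sin θ =
      -(S1 a (fun θ φ => w₁ θ φ - L θ φ) w₂ θ φ)
      + ((pdθ w₁ θ φ - pdθ Φ θ φ) * (sin θ * pdθ L θ φ)
      + ((pdφ w₁ θ φ - pdφ Φ θ φ) / sin θ) * (pdφ L θ φ / sin θ) * sin θ)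
      + (w₁ θ φ - Φ θ φ) * lapS2 L θ φ * sin θ := by
    unfold FF
    field_simp
  have hss : |sin θ| ≤ 1 := abs_sin_le_one θ
  rw [show |FF a Φ L w₁ w₂ θ φ| * sin θ = |FF a Φ L w₁ w₂ θ φ * sin θ| by
    rw [abs_mul, abs_of_pos hs], e]
  refine (add_bd (add_bd s1' (add_bd (mul_bd p1 (b.sL hθ φ))
    (mul_bd (mul_bd p2 l2) hss))) (mul_bd (mul_bd p0 (b.bΔ θ hθ φ)) hss)).trans (le_of_eq (by ring))

lemma Per.F_int (h : Per η Φ v w₁ w₂) (b : Bar a C Φ L v) (ha : 0 < a) :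
    sphInt (FF a Φ L w₁ w₂) = 0 := by
  have hg := sg_grad ha (h.r1.sub b.rL) h.r2 0
  have hg0 := sg_grad ha (b.rΦ.sub b.rL) b.rv 0
  have hη1 : η ≤ 1 := by linarith [h.hη4]
  have hs0 : ∀ θ ∈ Ioo (0 : ℝ) π, ∀ φ, S1 a (fun θ φ => Φ θ φ - L θ φ) v θ φ = 0 := by
    intro θ hθ φ
    have := b.self.S1_bd b ha hθ φ
    rw [mul_zero] at this
    exact abs_nonpos_iff.1 this
  refine sphInt_div
    (A := fun θ φ => (w₁ θ φ - Φ θ φ) * (sin θ * pdθ L θ φ)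
      - ((sg a (fun θ φ => w₁ θ φ - L θ φ) w₂ θ φ - 0) - (sg a (fun θ φ => Φ θ φ - L θ φ) v θ φ - 0)))
    (A' := fun θ φ => (pdθ w₁ θ φ - pdθ Φ θ φ) * (sin θ * pdθ L θ φ)
      + (w₁ θ φ - Φ θ φ) * (cos θ * pdθ L θ φ + sin θ * pdθ (pdθ L) θ φ)
      - (S1 a (fun θ φ => w₁ θ φ - L θ φ) w₂ θ φ - S1 a (fun θ φ => Φ θ φ - L θ φ) v θ φ))
    (B := fun θ φ => (w₁ θ φ - Φ θ φ) * pdφ L θ φ * (sin θ)⁻¹)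
    (B' := fun θ φ => ((pdφ w₁ θ φ - pdφ Φ θ φ) * pdφ L θ φ + (w₁ θ φ - Φ θ φ) * pdφ (pdφ L) θ φ)
      * (sin θ)⁻¹)
    (C := (2 * (Ksig a C * DF a C) + 2 * B0 a C ^ 2) + C)
    ?_ ?_ ?_ ?_ ?_ ?_ (h.F_adm b ha) ?_ ?_
  · exact ((h.r1.c0.sub b.rΦ.c0).mul (CD.sin.mul b.rL.c1)).sub (hg.c0.sub hg0.c0)
  · exact (((h.r1.c1.sub b.rΦ.c1).mul (CD.sin.mul b.rL.c1)).add ((h.r1.c0.sub b.rΦ.c0).mul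
      ((CD.cos.mul b.rL.c1).add (CD.sin.mul b.rL.c11)))).sub (hg.c1.sub hg0.c1)
  · exact ((((h.r1.c2.sub b.rΦ.c2).mul b.rL.c2).add ((h.r1.c0.sub b.rΦ.c0).mul b.rL.c22))).mul CD.sin_inv
  · intro θ hθ φ
    exact (((h.r1.d1 θ hθ φ).sub (b.rΦ.d1 θ hθ φ)).mul ((hasDerivAt_sin θ).mul (b.rL.d11 θ hθ φ))).sub
      ((hg.d1 θ hθ φ).sub (hg0.d1 θ hθ φ))
  · intro θ hθ φ
    exact (((h.r1.d2 θ hθ φ).sub (b.rΦ.d2 θ hθ φ)).mul (b.rL.d22 θ hθ φ)).mul_const _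
  · intro θ φ
    simp only [h.r1.per, b.rΦ.per, per_pdφ b.rL.per]
  · intro θ hθ φ
    have hs := (sin_pos_D hθ).ne'
    rw [hs0 θ hθ φ]
    unfold FF lapS2
    field_simp
    ring
  · intro θ hθ φ
    have h1 := h.A_bd b ha hθ φ
    have h2 := mul_bd ((h.p0 θ hθ φ).trans hη1) (b.bL1 θ hθ φ)
    have e : (w₁ θ φ - Φ θ φ) * (sin θ * pdθ L θ φ)
      - ((sg a (fun θ φ => w₁ θ φ - L θ φ) w₂ θ φ - 0) - (sg a (fun θ φ => Φ θ φ - L θ φ) v θ φ - 0)) =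
      ((w₁ θ φ - Φ θ φ) * cos θ - (sr a (w₁ θ φ - L θ φ) (w₂ θ φ) - sr a (Φ θ φ - L θ φ) (v θ φ)))
      + (w₁ θ φ - Φ θ φ) * (sin θ * pdθ L θ φ - cos θ) := by
      unfold sg
      ring
    rw [e]
    exact (add_bd h1 h2).trans (le_of_eq (by ring))

end


def II (L w₁ w₂ : ℝ → ℝ → ℝ) (θ φ : ℝ) : ℝ :=
  gradNormSqS2 w₁ θ φ + exp (4 * (w₁ θ φ - L θ φ)) * gradNormSqS2 w₂ θ φ + 2 * lapS2 L θ φ * w₁ θ φ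

section
variable {a C η : ℝ} {Φ L v w₁ w₂ : ℝ → ℝ → ℝ}

lemma sq_gn (f : ℝ → ℝ → ℝ) (θ φ : ℝ) :
    gradNormSqS2 f θ φ = pdθ f θ φ ^ 2 + (sin θ ^ 2)⁻¹ * pdφ f θ φ ^ 2 := by
  unfold gradNormSqS2 gradDotS2; ring

def Kv (a C : ℝ) : ℝ := C * (C ^ 2 / (2 * a) + 1) * 2

lemma Kv_pos (ha : 0 < a) (hC : 1 ≤ C) : 0 < Kv a C := by unfold Kv; positivity

lemma Per.ev1 (h : Per η Φ v w₁ w₂) (b : Bar a C Φ L v) (ha : 0 < a) {θ : ℝ}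
    (hθ : θ ∈ Ioo (0 : ℝ) π) (φ : ℝ) : |exp (2 * (w₁ θ φ - L θ φ)) * pdθ w₂ θ φ| ≤ Kv a C := by
  have pt := h.pt b ha hθ φ
  have hs := sin_pos_D hθ
  have hs1 := sin_le_one θ
  have hC := b.one
  have hη1 : η ≤ 1 := by linarith [h.hη4]
  have hv : |pdθ w₂ θ φ| ≤ (C ^ 2 / (2 * a) + 1) * sin θ ^ 2 := by
    rw [spl2 (pdθ w₂ θ φ) (pdθ v θ φ)]
    refine (add_bd (pt.V1b (b.cr.v1 θ hθ φ)) (h.q1 θ hθ φ)).trans ?_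
    have h1 : sin θ ^ 3 ≤ sin θ ^ 2 := pow_le_pow_of_le_one hs.le hs1 (by norm_num)
    have h2 : 0 ≤ C ^ 2 / (2 * a) := by positivity
    have h3 := pow_pos hs 2
    nlinarith
  have := mul_bd (pt.Emul hv) pt.t2
  rw [spl (w₁ θ φ) (Φ θ φ), exp_split]
  refine le_trans (le_of_eq ?_) this
  congr 1; ring

lemma Per.ev2 (h : Per η Φ v w₁ w₂) (b : Bar a C Φ L v) (ha : 0 < a) {θ : ℝ}
    (hθ : θ ∈ Ioo (0 : ℝ) π) (φ : ℝ) : |exp (2 * (w₁ θ φ - L θ φ)) * pdφ w₂ θ φ| ≤ Kv a C * sin θ := by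
  have pt := h.pt b ha hθ φ
  have hs := sin_pos_D hθ
  have hs1 := sin_le_one θ
  have hC := b.one
  have hη1 : η ≤ 1 := by linarith [h.hη4]
  have hv : |pdφ w₂ θ φ| ≤ ((C ^ 2 / (2 * a) + 1) * sin θ) * sin θ ^ 2 := by
    rw [Per.v2 (w₂ := w₂) b hθ]
    refine (h.q2 θ hθ φ).trans ?_
    have h2 : 0 ≤ C ^ 2 / (2 * a) := by positivity
    have h3 := pow_pos hs 3
    nlinarith
  have := mul_bd (pt.Emul hv) pt.t2
  rw [spl (w₁ θ φ) (Φ θ φ), exp_split]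
  refine le_trans (le_of_eq ?_) (this.trans (le_of_eq (by unfold Kv; ring)))
  congr 1; ring

lemma Per.eg (h : Per η Φ v w₁ w₂) (b : Bar a C Φ L v) (ha : 0 < a) {θ : ℝ}
    (hθ : θ ∈ Ioo (0 : ℝ) π) (φ : ℝ) :
    |exp (4 * (w₁ θ φ - L θ φ)) * gradNormSqS2 w₂ θ φ| ≤ 2 * Kv a C ^ 2 := by
  have := grad_join (sin_pos_D hθ) (h.ev1 b ha hθ φ) (h.ev2 b ha hθ φ)
  rw [sq_gn, abs_of_nonneg (by positivity), exp4]
  refine le_trans (le_of_eq (by ring)) this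

lemma Per.I_adm (h : Per η Φ v w₁ w₂) (b : Bar a C Φ L v) (ha : 0 < a) : Adm (II L w₁ w₂) := by
  have hη1 : η ≤ 1 := by linarith [h.hη4]
  have hη := h.hη
  refine Adm.of_bdd (C := 2 * (C + 1) ^ 2 + 2 * Kv a C ^ 2 + 2 * C * (C + 1))
    ((h.r1.cg.add ((h.r1.sub b.rL).c0.e4.mul h.r2.cg)).add (((CD.const 2).mul b.rL.clap).mul h.r1.c0))
    fun θ hθ φ => ?_
  have hs := sin_pos_D hθ
  have g0 : |w₁ θ φ| ≤ C + 1 := by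
    rw [spl2 (w₁ θ φ) (Φ θ φ)]; exact add_bd (b.bΦ θ hθ φ) ((h.p0 θ hθ φ).trans hη1)
  have g1 : |pdθ w₁ θ φ| ≤ C + 1 := by
    rw [spl2 (pdθ w₁ θ φ) (pdθ Φ θ φ)]; exact add_bd (b.bΦ1 θ hθ φ) ((h.p1 θ hθ φ).trans hη1)
  have g2 : |pdφ w₁ θ φ| ≤ (C + 1) * sin θ := by
    rw [spl2 (pdφ w₁ θ φ) (pdφ Φ θ φ), add_mul]
    exact add_bd (b.bΦ2 θ hθ φ) ((h.p2 θ hθ φ).trans (by gcongr))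
  have k := grad_join hs g1 g2
  unfold II
  refine add_bd (add_bd ?_ (h.eg b ha hθ φ)) (mul_bd (mul_bd (le_of_eq abs_two) (b.bΔ θ hθ φ)) g0)
  rw [sq_gn, abs_of_nonneg (by positivity)]
  exact k

lemma Per.I_eq (h : Per η Φ v w₁ w₂) (b : Bar a C Φ L v) {θ : ℝ}
    (hθ : θ ∈ Ioo (0 : ℝ) π) (φ : ℝ) :
    QQ a (fun θ φ => w₁ θ φ - L θ φ) w₂ θ φ =
      II L w₁ w₂ θ φ - II L Φ v θ φ - 2 * FF a Φ L w₁ w₂ θ φ := by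
  have h1 := b.cr.e θ hθ φ
  have e : ∀ {f g : ℝ → ℝ → ℝ}, R2 f → ee (fun θ φ => f θ φ - L θ φ) g θ φ =
      gradNormSqS2 f θ φ - 2 * gradDotS2 f L θ φ + gradNormSqS2 L θ φ
        + exp (4 * (f θ φ - L θ φ)) * gradNormSqS2 g θ φ := by
    intro f g hf
    unfold ee
    simp only [sq_gn, gradDotS2]
    rw [hf.sub_θ b.rL hθ, hf.sub_φ b.rL hθ]
    ring
  rw [e b.rΦ] at h1
  unfold QQ II FF
  rw [e h.r1]
  simp only [sq_gn, gradDotS2] at h1 ⊢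
  linear_combination h1

lemma Per.energy (h : Per η Φ v w₁ w₂) (b : Bar a C Φ L v) (ha : 0 < a) :
    sphInt (II L w₁ w₂) - sphInt (II L Φ v) = sphInt (QQ a (fun θ φ => w₁ θ φ - L θ φ) w₂) := by
  have e := sphInt_congr (fun θ hθ φ => h.I_eq b hθ φ)
  rw [e, sphInt_sub ((h.I_adm b ha).sub (b.self.I_adm b ha)) ((h.F_adm b ha).smul 2),
    sphInt_sub (h.I_adm b ha) (b.self.I_adm b ha), sphInt_smul, h.F_int b ha]
  ring

end


def mm (L w₁ w₂ : ℝ → ℝ → ℝ) (θ φ : ℝ) : ℝ :=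
  M1 (fun θ φ => w₁ θ φ - L θ φ) w₂ θ φ ^ 2 +
    (exp (L θ φ) ^ 4)⁻¹ * M2 (fun θ φ => w₁ θ φ - L θ φ) w₂ θ φ ^ 2

section
variable {a C η : ℝ} {Φ L v w₁ w₂ : ℝ → ℝ → ℝ}

lemma Per.M1_bd (h : Per η Φ v w₁ w₂) (b : Bar a C Φ L v) (ha : 0 < a) {θ : ℝ}
    (hθ : θ ∈ Ioo (0 : ℝ) π) (φ : ℝ) :
    |M1 (fun θ φ => w₁ θ φ - L θ φ) w₂ θ φ| ≤ 1 + 8 * Kv a C ^ 2 := by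
  have h0 := (b.hM θ hθ φ).1
  have h1 := h.eg b ha hθ φ
  have h2 := b.self.eg b ha hθ φ
  have h3 := h.pl θ hθ φ
  unfold M1 at h0 ⊢
  rw [b.rΦ.sub_lap b.rL hθ] at h0
  rw [h.r1.sub_lap b.rL hθ]
  rw [abs_le] at *
  beta_reduce at *
  constructor <;> linarith [h1.1, h1.2, h2.1, h2.2, h3.1, h3.2]

def Kw (a C : ℝ) : ℝ := C ^ 2 / (2 * a) + 1

lemma sq_of {x A : ℝ} (h : |x| ≤ A) : x ^ 2 ≤ A ^ 2 := sq_le_sq' (abs_le.1 h).1 (abs_le.1 h).2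

lemma Per.w21 (h : Per η Φ v w₁ w₂) (b : Bar a C Φ L v) (ha : 0 < a) {θ : ℝ}
    (hθ : θ ∈ Ioo (0 : ℝ) π) (φ : ℝ) : |pdθ w₂ θ φ| ≤ Kw a C * sin θ ^ 2 := by
  have pt := h.pt b ha hθ φ
  have hs := sin_pos_D hθ
  have hs1 := sin_le_one θ
  have hC := b.one
  have hη1 : η ≤ 1 := by linarith [h.hη4]
  unfold Kw
  rw [spl2 (pdθ w₂ θ φ) (pdθ v θ φ)]
  refine (add_bd (pt.V1b (b.cr.v1 θ hθ φ)) (h.q1 θ hθ φ)).trans ?_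
  have h1 : sin θ ^ 3 ≤ sin θ ^ 2 := pow_le_pow_of_le_one hs.le hs1 (by norm_num)
  have h2 : 0 ≤ C ^ 2 / (2 * a) := by positivity
  have h3 := pow_pos hs 2
  nlinarith

lemma Per.M2_bd (h : Per η Φ v w₁ w₂) (b : Bar a C Φ L v) (ha : 0 < a) {θ : ℝ}
    (hθ : θ ∈ Ioo (0 : ℝ) π) (φ : ℝ) :
    M2 (fun θ φ => w₁ θ φ - L θ φ) w₂ θ φ ^ 2 ≤ (132 + 64 * Kw a C ^ 2) * sin θ ^ 3 := by
  have pt := h.pt b ha hθ φ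
  have hs := sin_pos_D hθ
  have hs1 := sin_le_one θ
  have hη := h.hη
  have hη1 : η ≤ 1 := by linarith [h.hη4]
  have hs43 : sin θ ^ 4 ≤ sin θ ^ 3 := pow_le_pow_of_le_one hs.le hs1 (by norm_num)
  have h0 := (b.hM θ hθ φ).2
  have hw := h.w21 b ha hθ φ
  have hu1 := pt.sU1 (b.cr.u1 θ hθ φ)
  have hp1 := (h.p1 θ hθ φ).trans hη1
  have hp2 := (Pt.div_s hs (h.p2 θ hθ φ)).trans hη1
  have hq2 : |(pdφ w₂ θ φ - pdφ v θ φ) / sin θ| ≤ sin θ ^ 2 := by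
    refine Pt.div_s hs ((h.q2 θ hθ φ).trans ?_)
    have := pow_pos hs 3
    nlinarith
  have hql := h.ql θ hθ φ
  have hq1 := h.q1' θ hθ φ
  set U1 := pdθ (fun θ φ => Φ θ φ - L θ φ) θ φ
  have e : M2 (fun θ φ => w₁ θ φ - L θ φ) w₂ θ φ =
      (lapS2 w₂ θ φ - lapS2 v θ φ) + 4 * (U1 * (pdθ w₂ θ φ - pdθ v θ φ))
        + 4 * ((pdθ w₁ θ φ - pdθ Φ θ φ) * pdθ w₂ θ φ)
        + 4 * (((pdφ w₁ θ φ - pdφ Φ θ φ) / sin θ) * ((pdφ w₂ θ φ - pdφ v θ φ) / sin θ)) := by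
    have e2 : ((pdφ w₁ θ φ - pdφ Φ θ φ) / sin θ) * ((pdφ w₂ θ φ - pdφ v θ φ) / sin θ) =
       (sin θ ^ 2)⁻¹ * (pdφ w₁ θ φ - pdφ Φ θ φ) * (pdφ w₂ θ φ - pdφ v θ φ) := by field_simp
    rw [e2]
    unfold M2 gradDotS2 at h0 ⊢
    rw [h.u1 b hθ, h.u2 b hθ]
    rw [b.cr.v2 θ hθ φ] at h0 ⊢
    linear_combination h0
  rw [e]
  set x := lapS2 w₂ θ φ - lapS2 v θ φ
  set y := U1 * (pdθ w₂ θ φ - pdθ v θ φ) with hy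
  set z := (pdθ w₁ θ φ - pdθ Φ θ φ) * pdθ w₂ θ φ
  set t := ((pdφ w₁ θ φ - pdφ Φ θ φ) / sin θ) * ((pdφ w₂ θ φ - pdφ v θ φ) / sin θ)
  have hz : z ^ 2 ≤ Kw a C ^ 2 * sin θ ^ 3 := by
    refine (sq_of (mul_bd hp1 hw)).trans ?_
    have := mul_le_mul_of_nonneg_left hs43 (sq_nonneg (Kw a C))
    calc _ = Kw a C ^ 2 * sin θ ^ 4 := by ring
      _ ≤ _ := this
  have ht : t ^ 2 ≤ sin θ ^ 3 := by
    refine (sq_of (mul_bd hp2 hq2)).trans ?_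
    calc _ = sin θ ^ 4 := by ring
      _ ≤ _ := hs43
  have hyb : y ^ 2 ≤ sin θ ^ 3 := by
    have h1 : (sin θ * U1) ^ 2 ≤ 1 := by have := sq_of hu1; linarith
    have h2 : sin θ ^ 2 * y ^ 2 ≤ sin θ ^ 2 * sin θ ^ 3 := by
      calc sin θ ^ 2 * y ^ 2 = (sin θ * U1) ^ 2 * (pdθ w₂ θ φ - pdθ v θ φ) ^ 2 := by rw [hy]; ring
        _ ≤ 1 * sin θ ^ 5 := by gcongr
        _ = _ := by ring
    exact le_of_mul_le_mul_left h2 (pow_pos hs 2)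
  have key : (x + 4 * y + 4 * z + 4 * t) ^ 2 ≤ 4 * (x ^ 2 + 16 * y ^ 2 + 16 * z ^ 2 + 16 * t ^ 2) := by
    nlinarith [sq_nonneg (x - 4 * y), sq_nonneg (x - 4 * z), sq_nonneg (x - 4 * t), sq_nonneg (y - z),
      sq_nonneg (y - t), sq_nonneg (z - t)]
  refine key.trans ?_
  linarith

lemma CD.mm (hw₁ : R2 w₁) (hw₂ : R2 w₂) (hL : R2 L) : CD (mm L w₁ w₂) :=
  ((CD.M1 (hw₁.sub hL) hw₂).pow 2).add (((hL.c0.exp.pow 4).inv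
    (fun _ _ _ => (by positivity))).mul ((CD.M2 (hw₁.sub hL) hw₂).pow 2))

lemma Per.m_adm (h : Per η Φ v w₁ w₂) (b : Bar a C Φ L v) (ha : 0 < a) : Adm (mm L w₁ w₂) := by
  refine ⟨CD.mm h.r1 h.r2 b.rL, (1 + 8 * Kv a C ^ 2) ^ 2 + C ^ 4 * (132 + 64 * Kw a C ^ 2),
    fun θ hθ φ => ?_⟩
  have hs := sin_pos_D hθ
  have hs1 := sin_le_one θ
  have h1 := sq_of (h.M1_bd b ha hθ φ)
  have h2 := h.M2_bd b ha hθ φ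
  have hw := b.w2 θ hθ φ
  unfold mm
  rw [abs_of_nonneg (by positivity), add_mul]
  have k1 : M1 (fun θ φ => w₁ θ φ - L θ φ) w₂ θ φ ^ 2 * sin θ ≤ (1 + 8 * Kv a C ^ 2) ^ 2 * 1 := by
    gcongr
  have hw4 : sin θ ^ 4 ≤ (C * exp (L θ φ)) ^ 4 := by gcongr
  have k2 : (exp (L θ φ) ^ 4)⁻¹ * M2 (fun θ φ => w₁ θ φ - L θ φ) w₂ θ φ ^ 2 * sin θ ≤
      C ^ 4 * (132 + 64 * Kw a C ^ 2) := by
    calc _ ≤ (exp (L θ φ) ^ 4)⁻¹ * ((132 + 64 * Kw a C ^ 2) * sin θ ^ 3) * sin θ := by gcongr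
      _ = (exp (L θ φ) ^ 4)⁻¹ * (132 + 64 * Kw a C ^ 2) * sin θ ^ 4 := by ring
      _ ≤ (exp (L θ φ) ^ 4)⁻¹ * (132 + 64 * Kw a C ^ 2) * (C * exp (L θ φ)) ^ 4 := by gcongr
      _ = _ := by have := (exp_pos (L θ φ)).ne'; field_simp
  linarith

lemma Per.m_le (h : Per η Φ v w₁ w₂) (b : Bar a C Φ L v) (ha : 0 < a) {θ : ℝ}
    (hθ : θ ∈ Ioo (0 : ℝ) π) (φ : ℝ) :
    M1 (fun θ φ => w₁ θ φ - L θ φ) w₂ θ φ ^ 2 +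
      exp (4 * (w₁ θ φ - L θ φ)) * M2 (fun θ φ => w₁ θ φ - L θ φ) w₂ θ φ ^ 2
      ≤ (4 * C ^ 6) * mm L w₁ w₂ θ φ := by
  have pt := h.pt b ha hθ φ
  have hs := sin_pos_D hθ
  have hC := b.one
  have hC6 : 1 ≤ C ^ 6 := one_le_pow₀ hC
  have hw := b.w1 θ hθ φ
  have e0 := b.e1 θ hθ φ
  have h1 := (le_abs_self _).trans pt.t2
  have hE : exp (2 * (w₁ θ φ - L θ φ)) * sin θ ^ 2 ≤ C * 2 := by
    rw [spl (w₁ θ φ) (Φ θ φ), exp_split]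
    calc _ = (exp (2 * (Φ θ φ - L θ φ)) * sin θ ^ 2) * exp (2 * (w₁ θ φ - Φ θ φ)) := by ring
      _ ≤ C * 2 := by gcongr
  have hw4 : exp (L θ φ) ^ 4 ≤ (C * sin θ) ^ 4 := by gcongr
  have key : exp (4 * (w₁ θ φ - L θ φ)) ≤ 4 * C ^ 6 * (exp (L θ φ) ^ 4)⁻¹ := by
    rw [← div_eq_mul_inv, le_div_iff₀ (by positivity), exp4]
    calc _ ≤ exp (2 * (w₁ θ φ - L θ φ)) ^ 2 * (C * sin θ) ^ 4 := by gcongr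
      _ = (exp (2 * (w₁ θ φ - L θ φ)) * sin θ ^ 2) ^ 2 * C ^ 4 := by ring
      _ ≤ (C * 2) ^ 2 * C ^ 4 := by gcongr
      _ = _ := by ring
  unfold mm
  have := mul_le_mul_of_nonneg_right key (sq_nonneg (M2 (fun θ φ => w₁ θ φ - L θ φ) w₂ θ φ))
  have := sq_nonneg (M1 (fun θ φ => w₁ θ φ - L θ φ) w₂ θ φ)
  nlinarith

/-- the inequality for small perturbations -/
lemma Per.final (h : Per η Φ v w₁ w₂) (b : Bar a C Φ L v) (ha : 0 < a)
    (hη1 : B0 a C * η ≤ 1) (hη2 : 2 * (Bs a C * η) ^ 2 ≤ 1 / 4) :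
    0 ≤ sphInt (II L w₁ w₂) - sphInt (II L Φ v) ∧ sphInt (II L w₁ w₂) - sphInt (II L Φ v) ≤
      (18 + 36 * π ^ 2) * (4 * C ^ 6) * sphInt (mm L w₁ w₂) := by
  have hC := b.one
  have hB := B0_pos ha hC
  have hη := h.hη
  have hη4 := h.hη4
  have hBX := BX_pos ha hC
  have ml := main_est ha (h.r1.sub b.rL) h.r2 (B := B0 a C + 2 * BX a C ^ 2 + |log (DF a C)|)
    (by positivity) (h.m_adm b ha) (fun θ hθ φ => h.m_le b ha hθ φ)
    (fun θ hθ φ => (h.X_bd b ha hθ φ).trans (by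
      have := sin_le_one θ
      have := sin_pos_D hθ
      nlinarith [mul_nonneg hB.le hη]))
    (fun θ hθ φ => (h.X_bd b ha hθ φ).trans (by
      have := sin_pos_D hθ
      have h1 : 0 ≤ 2 * BX a C ^ 2 + |log (DF a C)| := by positivity
      have h2 : η * sin θ ≤ 1 * sin θ := by gcongr; linarith
      have h3 : B0 a C * (η * sin θ) ≤ B0 a C * (1 * sin θ) := by gcongr
      nlinarith))
    (fun θ hθ φ => (h.gX_bd b ha hθ φ).trans (by
      have := abs_nonneg (log (DF a C))
      linarith))
    (fun θ hθ φ => (h.gS_bd b ha hθ φ).trans hη2)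
    (fun θ hθ φ => by
      have f := h.fermi b ha hθ φ
      have := (fermi_bd2 ha hθ (DF_pos ha hC) f.1 f.2).2.1
      unfold sg
      refine this.trans ((le_abs_self _).trans ?_)
      have : 0 ≤ 2 * BX a C ^ 2 := by positivity
      linarith)
  rw [h.energy b ha]
  refine ⟨?_, ml.2⟩
  have := sphInt_mono (ml.1.smul 0) ml.1 (fun θ hθ φ => by
    rw [zero_mul]; exact QQ_nonneg ha θ φ)
  rwa [sphInt_smul, zero_mul] at this

end


lemma wt {W r x ε : ℝ} (n : ℕ) (hW : 0 < W) (hr : r * (2 : ℕ) = -(n : ℝ)) (hx : 0 ≤ x)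
    (h : W ^ r * x ≤ ε) : x ^ 2 ≤ ε ^ 2 * W ^ n := by
  have h1 : (W ^ r) ^ 2 = (W ^ n)⁻¹ := by
    rw [← rpow_mul_natCast hW.le, hr, rpow_neg hW.le, rpow_natCast]
  have h2 : (W ^ r * x) ^ 2 ≤ ε ^ 2 := by
    have : 0 ≤ W ^ r * x := by positivity
    gcongr
  rw [mul_pow, h1, inv_mul_le_iff₀ (by positivity)] at h2
  linarith

lemma wt2 {W x C η s : ℝ} (n : ℕ) (hn : n ≤ 7) (hW : 0 < W) (hC : 1 ≤ C) (hs : 0 < s) (hWs : W ≤ C * s)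
    (h : x ^ 2 ≤ (η / (2 * C ^ 4)) ^ 2 * W ^ n) : x ^ 2 ≤ η ^ 2 / 4 * s ^ n := by
  have h1 : W ^ n ≤ C ^ 8 * s ^ n := by
    calc W ^ n ≤ (C * s) ^ n := by gcongr
      _ = C ^ n * s ^ n := mul_pow _ _ _
      _ ≤ _ := by
        have : C ^ n ≤ C ^ 8 := pow_le_pow_right₀ hC (by omega)
        gcongr
  calc x ^ 2 ≤ _ := h
    _ ≤ (η / (2 * C ^ 4)) ^ 2 * (C ^ 8 * s ^ n) := by gcongr
    _ = _ := by field_simp; ring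

lemma covNorm_nonneg (k : ℕ) (f : ℝ → ℝ → ℝ) (θ φ : ℝ) : 0 ≤ covNorm k f θ φ := sqrt_nonneg _

lemma holder_nonneg {f : ℝ → ℝ → ℝ} {h α : ℝ}
    (H : ∀ I : Fin 2 → Fin 2, ∀ θ ∈ Ioo (0 : ℝ) π, ∀ θ' ∈ Ioo (0 : ℝ) π, ∀ φ φ' : ℝ,
      |covIter f 2 I θ φ - covIter f 2 I θ' φ'| ≤ h * sDist θ φ θ' φ' ^ α) : 0 ≤ h := by
  have pp := pi_pos
  have h1 := H (fun _ => 0) (π / 2) ⟨by linarith, by linarith⟩ (π / 3) ⟨by linarith, by linarith⟩ 0 0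
  have h2 : 0 < sDist (π / 2) 0 (π / 3) 0 := by
    unfold sDist
    rw [arccos_pos]
    simp only [cos_pi_div_two, sin_pi_div_two, sin_pi_div_three, sub_zero, cos_zero]
    have : √3 < 2 := by
      rw [sqrt_lt' (by norm_num)]; norm_num
    linarith
  have h3 := rpow_pos_of_pos h2 α
  have h4 := (abs_nonneg _).trans h1
  exact nonneg_of_mul_nonneg_left h4 h3

lemma Per.mk' {a C η α : ℝ} {ω Φ v w₁ w₂ : ℝ → ℝ → ℝ} (hη : 0 < η) (hη4 : η ≤ 1 / 4)
    (hω : ∀ θ ∈ Ioo (0 : ℝ) π, ∀ φ : ℝ, 0 < ω θ φ)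
    (b : Bar a C Φ (fun θ φ => log (ω θ φ)) v)
    (r1 : R2 w₁) (r2 : R2 w₂) {s₁ s₂ : ℕ → ℝ} {h₁ h₂ : ℝ}
    (hs1 : ∀ j ≤ 2, ∀ θ ∈ Ioo (0 : ℝ) π, ∀ φ : ℝ,
          covNorm j (fun θ φ => w₁ θ φ - Φ θ φ) θ φ ≤ s₁ j)
    (hs2 : ∀ j : ℕ, j ≤ 2 → ∀ θ ∈ Ioo (0 : ℝ) π, ∀ φ : ℝ,
          ω θ φ ^ ((j : ℝ) - 7 / 2) *
            covNorm j (fun θ φ => w₂ θ φ - v θ φ) θ φ ≤ s₂ j)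
    (H1 : ∀ I : Fin 2 → Fin 2, ∀ θ ∈ Ioo (0 : ℝ) π, ∀ θ' ∈ Ioo (0 : ℝ) π, ∀ φ φ' : ℝ,
          |covIter (fun θ φ => w₁ θ φ - Φ θ φ) 2 I θ φ
              - covIter (fun θ φ => w₁ θ φ - Φ θ φ) 2 I θ' φ'|
            ≤ h₁ * sDist θ φ θ' φ' ^ α)
    (H2 : ∀ I : Fin 2 → Fin 2, ∀ θ ∈ Ioo (0 : ℝ) π, ∀ θ' ∈ Ioo (0 : ℝ) π, ∀ φ φ' : ℝ,
          |covIter (fun θ φ => w₂ θ φ - v θ φ) 2 I θ φ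
              - covIter (fun θ φ => w₂ θ φ - v θ φ) 2 I θ' φ'|
            ≤ h₂ * sDist θ φ θ' φ' ^ α)
    (hlt : (s₁ 0 + s₁ 1 + s₁ 2) + (s₂ 0 + s₂ 1 + s₂ 2) + h₁ + h₂ < η / (2 * C ^ 4)) :
    Per η Φ v w₁ w₂ := by
  have pp := pi_pos
  have hC := b.one
  have n1 := holder_nonneg H1
  have n2 := holder_nonneg H2
  have hmid : π / 2 ∈ Ioo (0 : ℝ) π := ⟨by linarith, by linarith⟩
  have m1 : ∀ j ≤ 2, 0 ≤ s₁ j := fun j hj => (covNorm_nonneg _ _ _ _).trans (hs1 j hj _ hmid 0)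
  have m2 : ∀ j ≤ 2, 0 ≤ s₂ j := fun j hj => le_trans (mul_nonneg
    (rpow_nonneg (hω _ hmid 0).le _) (covNorm_nonneg _ _ _ _)) (hs2 j hj _ hmid 0)
  have a0 := m1 0 (by norm_num)
  have a1 := m1 1 (by norm_num)
  have a2 := m1 2 (by norm_num)
  have b0 := m2 0 (by norm_num)
  have b1 := m2 1 (by norm_num)
  have b2 := m2 2 (by norm_num)
  have hC4 : 1 ≤ C ^ 4 := one_le_pow₀ hC
  have hε : η / (2 * C ^ 4) ≤ η := div_le_self hη.le (by linarith)
  set ε := η / (2 * C ^ 4) with hεd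
  have hε0 : 0 < ε := by positivity
  have E : ∀ θ ∈ Ioo (0 : ℝ) π, ∀ φ, ω θ φ ≤ C * sin θ := by
    intro θ hθ φ
    have := b.w1 θ hθ φ
    rwa [exp_log (hω θ hθ φ)] at this
  have P0 : ∀ θ ∈ Ioo (0 : ℝ) π, ∀ φ, |w₁ θ φ - Φ θ φ| ≤ η := by
    intro θ hθ φ
    have := hs1 0 (by norm_num) θ hθ φ
    rw [covNorm0] at this
    exact this.trans (by linarith)
  have P1 : ∀ θ ∈ Ioo (0 : ℝ) π, ∀ φ, |pdθ w₁ θ φ - pdθ Φ θ φ| ≤ η ∧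
      |pdφ w₁ θ φ - pdφ Φ θ φ| ≤ η * sin θ := by
    intro θ hθ φ
    have h1 := hs1 1 (by norm_num) θ hθ φ
    have h2 := covNorm1 (fun θ φ => w₁ θ φ - Φ θ φ) θ φ
    rw [r1.sub_θ b.rΦ hθ, r1.sub_φ b.rΦ hθ] at h2
    refine grad_split (sin_pos_D hθ) hη.le (h2.trans ?_)
    have := covNorm_nonneg 1 (fun θ φ => w₁ θ φ - Φ θ φ) θ φ
    exact pow_le_pow_left₀ this (by linarith) 2
  have P2 : ∀ θ ∈ Ioo (0 : ℝ) π, ∀ φ, |lapS2 w₁ θ φ - lapS2 Φ θ φ| ≤ 1 := by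
    intro θ hθ φ
    have h1 := hs1 2 (by norm_num) θ hθ φ
    have h2 := covNorm2 (fun θ φ => w₁ θ φ - Φ θ φ) θ φ
    rw [r1.sub_lap b.rΦ hθ] at h2
    have h3 := covNorm_nonneg 2 (fun θ φ => w₁ θ φ - Φ θ φ) θ φ
    have h4 : covNorm 2 (fun θ φ => w₁ θ φ - Φ θ φ) θ φ ^ 2 ≤ (1 / 4) ^ 2 :=
      pow_le_pow_left₀ h3 (by linarith) 2
    refine abs_le_of_sq_le_sq ?_ zero_le_one
    linarith
  have Q : ∀ j : ℕ, ∀ n : ℕ, j ≤ 2 → n ≤ 7 → ((j : ℝ) - 7 / 2) * (2 : ℕ) = -(n : ℝ) →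
      ∀ θ ∈ Ioo (0 : ℝ) π, ∀ φ,
      covNorm j (fun θ φ => w₂ θ φ - v θ φ) θ φ ^ 2 ≤ η ^ 2 / 4 * sin θ ^ n := by
    intro j n hj hn hjn θ hθ φ
    have h0 : s₂ j ≤ ε := by interval_cases j <;> linarith
    have h1 := wt n (hω θ hθ φ) hjn (covNorm_nonneg _ _ _ _) ((hs2 j hj θ hθ φ).trans h0)
    exact wt2 n hn (hω θ hθ φ) hC (sin_pos_D hθ) (E θ hθ φ) h1
  have Q0 := Q 0 7 (by norm_num) (by norm_num) (by norm_num)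
  have Q1 := Q 1 5 (by norm_num) (by norm_num) (by norm_num)
  have Q2 := Q 2 3 (by norm_num) (by norm_num) (by norm_num)
  have hη2 : η ^ 2 ≤ 1 := by nlinarith
  have R1 : ∀ θ ∈ Ioo (0 : ℝ) π, ∀ φ, (pdθ w₂ θ φ - pdθ v θ φ) ^ 2 +
      (sin θ ^ 2)⁻¹ * (pdφ w₂ θ φ - pdφ v θ φ) ^ 2 ≤ η ^ 2 / 4 * sin θ ^ 5 := by
    intro θ hθ φ
    have h2 := covNorm1 (fun θ φ => w₂ θ φ - v θ φ) θ φ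
    rw [r2.sub_θ b.rv hθ, r2.sub_φ b.rv hθ] at h2
    exact h2.trans (Q1 θ hθ φ)
  have R1' : ∀ θ ∈ Ioo (0 : ℝ) π, ∀ φ, |pdθ w₂ θ φ - pdθ v θ φ| ≤ η * sin θ ^ 2 ∧
      |pdφ w₂ θ φ - pdφ v θ φ| ≤ η * sin θ ^ 2 * sin θ := by
    intro θ hθ φ
    have hs := sin_pos_D hθ
    refine grad_split hs (by positivity) ((R1 θ hθ φ).trans ?_)
    have h1 : sin θ ^ 5 ≤ sin θ ^ 4 := pow_le_pow_of_le_one hs.le (sin_le_one θ) (by norm_num)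
    have h2 := mul_le_mul_of_nonneg_left h1 (sq_nonneg η)
    have h3 : 0 ≤ η ^ 2 * sin θ ^ 5 := by positivity
    have e : (η * sin θ ^ 2) ^ 2 = η ^ 2 * sin θ ^ 4 := by ring
    rw [e]
    linarith
  refine ⟨r1, r2, hη.le, hη4, P0, fun θ hθ φ => (P1 θ hθ φ).1, fun θ hθ φ => (P1 θ hθ φ).2, P2, ?_,
    fun θ hθ φ => (R1' θ hθ φ).1, fun θ hθ φ => ((R1' θ hθ φ).2).trans (le_of_eq (by ring)), ?_, ?_⟩
  · intro θ hθ φ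
    have hs := sin_pos_D hθ
    have h1 := Q0 θ hθ φ
    rw [covNorm0, sq_abs] at h1
    refine abs_le_of_sq_le_sq (h1.trans ?_) (by positivity)
    have h1 : sin θ ^ 7 ≤ sin θ ^ 6 := pow_le_pow_of_le_one hs.le (sin_le_one θ) (by norm_num)
    have h2 := mul_le_mul_of_nonneg_left h1 (sq_nonneg η)
    have h3 : 0 ≤ η ^ 2 * sin θ ^ 7 := by positivity
    have e : (η * sin θ ^ 3) ^ 2 = η ^ 2 * sin θ ^ 6 := by ring
    rw [e]
    linarith
  · intro θ hθ φ
    have hs := sin_pos_D hθ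
    have h1 := R1 θ hθ φ
    have h2 : 0 ≤ (sin θ ^ 2)⁻¹ * (pdφ w₂ θ φ - pdφ v θ φ) ^ 2 := by positivity
    have h3 := pow_pos hs 5
    nlinarith
  · intro θ hθ φ
    have hs := sin_pos_D hθ
    have h2 := covNorm2 (fun θ φ => w₂ θ φ - v θ φ) θ φ
    rw [r2.sub_lap b.rv hθ] at h2
    have h1 := Q2 θ hθ φ
    have h3 := pow_pos hs 3
    nlinarith

/-- Proposition `prop:functional-F`: Łojasiewicz–Simon inequality
`|E(w) − E(w̄)|^{1/2} ≤ C̄‖M(w)‖` for maps `w` close to the critical point `w̄` in the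
weighted `C^{2,α}` norm. -/
theorem statement_16
    (ω : ℝ → ℝ → ℝ) (a : ℝ) (ha : 0 < a)
    (hωpos : ∀ θ ∈ Ioo (0 : ℝ) π, ∀ φ : ℝ, 0 < ω θ φ)
    (hωper : ∀ θ φ : ℝ, ω θ (φ + 2 * π) = ω θ φ)
    (hωsmooth : ContDiffOn ℝ (⊤ : ℕ∞) (fun p : ℝ × ℝ => ω p.1 p.2)
      (Ioo 0 π ×ˢ (univ : Set ℝ)))
    (hωext : ∀ l n : ℕ, l + n ≤ 10 → ∃ G : ℝ → ℝ → ℝ,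
      ContinuousOn (fun p : ℝ × ℝ => G p.1 p.2) (Icc 0 π ×ˢ (univ : Set ℝ)) ∧
      ∀ θ ∈ Ioo (0 : ℝ) π, ∀ φ : ℝ,
        G θ φ = (pdθ^[l] (pdφ^[n]
          (fun θ φ => Real.log (ω θ φ) - Real.log (Real.sin θ)))) θ φ)
    (Φb vb : ℝ → ℝ → ℝ)
    (hΦb : CkSphere 3 Φb) (hvb : CkSphere 3 vb)
    (hcrit : ∀ θ ∈ Ioo (0 : ℝ) π, ∀ φ : ℝ,
      Mop1 ω Φb vb θ φ = 0 ∧ Mop2 ω Φb vb θ φ = 0)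
    (htrN : ∀ φ : ℝ, Tendsto (fun θ => vb θ φ) (nhdsWithin 0 (Ioi 0)) (nhds a))
    (htrS : ∀ φ : ℝ, Tendsto (fun θ => vb θ φ) (nhdsWithin π (Iio π)) (nhds (-a)))
    (α : ℝ) (hα : α ∈ Ioo (0 : ℝ) 1) :
    ∃ η > (0 : ℝ), ∃ Cb > (0 : ℝ), ∀ w₁ w₂ : ℝ → ℝ → ℝ,
      ContDiffOn ℝ 2 (fun p : ℝ × ℝ => w₁ p.1 p.2) (Ioo 0 π ×ˢ (univ : Set ℝ)) →
      ContDiffOn ℝ 2 (fun p : ℝ × ℝ => w₂ p.1 p.2) (Ioo 0 π ×ˢ (univ : Set ℝ)) →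
      (∀ θ φ : ℝ, w₁ θ (φ + 2 * π) = w₁ θ φ) →
      (∀ θ φ : ℝ, w₂ θ (φ + 2 * π) = w₂ θ φ) →
      (∃ (s₁ s₂ : ℕ → ℝ) (h₁ h₂ : ℝ),
        (∀ j ≤ 2, ∀ θ ∈ Ioo (0 : ℝ) π, ∀ φ : ℝ,
          covNorm j (fun θ φ => w₁ θ φ - Φb θ φ) θ φ ≤ s₁ j) ∧
        (∀ j : ℕ, j ≤ 2 → ∀ θ ∈ Ioo (0 : ℝ) π, ∀ φ : ℝ,
          ω θ φ ^ ((j : ℝ) - 7 / 2) *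
            covNorm j (fun θ φ => w₂ θ φ - vb θ φ) θ φ ≤ s₂ j) ∧
        (∀ I : Fin 2 → Fin 2, ∀ θ ∈ Ioo (0 : ℝ) π, ∀ θ' ∈ Ioo (0 : ℝ) π, ∀ φ φ' : ℝ,
          |covIter (fun θ φ => w₁ θ φ - Φb θ φ) 2 I θ φ
              - covIter (fun θ φ => w₁ θ φ - Φb θ φ) 2 I θ' φ'|
            ≤ h₁ * sDist θ φ θ' φ' ^ α) ∧
        (∀ I : Fin 2 → Fin 2, ∀ θ ∈ Ioo (0 : ℝ) π, ∀ θ' ∈ Ioo (0 : ℝ) π, ∀ φ φ' : ℝ,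
          |covIter (fun θ φ => w₂ θ φ - vb θ φ) 2 I θ φ
              - covIter (fun θ φ => w₂ θ φ - vb θ φ) 2 I θ' φ'|
            ≤ h₂ * sDist θ φ θ' φ' ^ α) ∧
        (s₁ 0 + s₁ 1 + s₁ 2) + (s₂ 0 + s₂ 1 + s₂ 2) + h₁ + h₂ < η) →
      Real.sqrt |Efun ω w₁ w₂ - Efun ω Φb vb|
        ≤ Cb * Real.sqrt (sphInt (fun θ φ =>
            (Mop1 ω w₁ w₂ θ φ) ^ 2 + ((ω θ φ) ^ 4)⁻¹ * (Mop2 ω w₁ w₂ θ φ) ^ 2)) := by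

  obtain ⟨C, b⟩ := bar_exists ω a ha hωpos hωper hωsmooth hωext Φb vb hΦb hvb hcrit htrN htrS
  have hC := b.one
  have hB0 := B0_pos ha hC
  have hBJ := BJ_pos ha hC
  have hBs : 0 < Bs a C := by unfold Bs; positivity
  set η : ℝ := 1 / (4 + B0 a C + 3 * Bs a C) with hηd
  have hη : 0 < η := by positivity
  have hηm : η * (4 + B0 a C + 3 * Bs a C) = 1 := by rw [hηd]; field_simp
  have t1 : 0 < η * B0 a C := by positivity
  have t2 : 0 < η * Bs a C := by positivity
  have hη4 : η ≤ 1 / 4 := by nlinarith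
  have hη1 : B0 a C * η ≤ 1 := by nlinarith
  have hη2 : 2 * (Bs a C * η) ^ 2 ≤ 1 / 4 := by
    have : Bs a C * η ≤ 1 / 3 := by nlinarith
    nlinarith
  set K : ℝ := (18 + 36 * π ^ 2) * (4 * C ^ 6) with hK
  have hK0 : 0 < K := by positivity
  refine ⟨η / (2 * C ^ 4), by positivity, √K, sqrt_pos.2 hK0, ?_⟩
  rintro w₁ w₂ c1 c2 per1 per2 ⟨s₁, s₂, h₁, h₂, hs1, hs2, H1, H2, hlt⟩
  have r1 := R2.of_contDiffOn c1 per1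
  have r2 := R2.of_contDiffOn c2 per2
  have hP := Per.mk' hη hη4 hωpos b r1 r2 hs1 hs2 H1 H2 hlt
  obtain ⟨f1, f2⟩ := hP.final b ha hη1 hη2
  have em : sphInt (fun θ φ => (Mop1 ω w₁ w₂ θ φ) ^ 2 + ((ω θ φ) ^ 4)⁻¹ * (Mop2 ω w₁ w₂ θ φ) ^ 2) =
      sphInt (mm (fun θ φ => Real.log (ω θ φ)) w₁ w₂) := by
    refine sphInt_congr fun θ hθ φ => ?_
    unfold mm M1 M2 Mop1 Mop2
    rw [r1.sub_lap b.rL hθ]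
    beta_reduce
    rw [exp_log (hωpos θ hθ φ)]
    ring
  have eE : Efun ω w₁ w₂ - Efun ω Φb vb = 1 / 2 * (sphInt (II (fun θ φ => Real.log (ω θ φ)) w₁ w₂)
      - sphInt (II (fun θ φ => Real.log (ω θ φ)) Φb vb)) := by
    unfold Efun II
    ring
  rw [em, eE, abs_of_nonneg (by positivity), ← sqrt_mul hK0.le]
  exact sqrt_le_sqrt (by linarith)
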